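/- arXiv:1801.02957 — 2 statements merged into one kernel-verified Lean document; each statement's English description precedes it below -/
import Mathlib

section
/- Let A, B ∈ ℤ with |A| ≤ B and B ≥ 2, let M be a 2×2 integer matrix with characteristic polynomial x² + A·x + B, let v ∈ ℤ² be such that v and M·v are linearly independent over ℝ, and let T be the associated self-affine tile with digit set D = {0, v, 2v, …, (B−1)v}. Then T is connected, and T has a cut point — i.e., there exists z ∈ T such that T ∖ {z} is not preconnected — if and only if 2|A| − B ≥ 5. -/
open Polynomial
open Set Filter Topology Metric

theorem one_lt_rank_plane : 1 < Module.rank ℝ (ℝ × ℝ) := by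
  rw [← Module.finrank_eq_rank]; simp

theorem isPreconnected_ball_diff_center (z : ℝ × ℝ) {r : ℝ} (hr : 0 < r) :
    IsPreconnected (ball z r \ {z}) := by
  have h := (isConnected_compl_singleton_of_one_lt_rank one_lt_rank_plane
    (0 : ℝ × ℝ)).isPreconnected
  let e := OpenPartialHomeomorph.univBall z r
  have h2 := h.image e ((OpenPartialHomeomorph.continuous_univBall z r).continuousOn)
  convert h2 using 1
  have hs : e.source = univ := OpenPartialHomeomorph.univBall_source z r
  have ht : e.target = ball z r := OpenPartialHomeomorph.univBall_target z hr
  have h0 : e 0 = z := OpenPartialHomeomorph.univBall_apply_zero z r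
  ext x
  constructor
  · rintro ⟨hx, hxz⟩
    rw [← ht] at hx
    refine ⟨e.symm x, ?_, e.right_inv hx⟩
    intro h'
    apply hxz
    rw [mem_singleton_iff] at h' ⊢
    rw [← e.right_inv hx, h', h0]
  · rintro ⟨y, hy, rfl⟩
    refine ⟨ht ▸ e.map_source (hs ▸ mem_univ y), ?_⟩
    intro h'
    apply hy
    rw [mem_singleton_iff] at h' ⊢
    rw [← h0] at h'
    exact e.injOn (hs ▸ mem_univ y) (hs ▸ mem_univ 0) h'

/-- Removing a point from a connected open subset of the plane does not disconnect it. -/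
theorem IsPreconnected.diff_singleton_of_isOpen {U : Set (ℝ × ℝ)} (hU : IsPreconnected U)
    (ho : IsOpen U) (z : ℝ × ℝ) : IsPreconnected (U \ {z}) := by
  by_cases hz : z ∈ U
  swap
  · rwa [sdiff_singleton_eq_self hz]
  obtain ⟨r, hr, hrU⟩ := Metric.isOpen_iff.1 ho z hz
  have hb := isPreconnected_ball_diff_center z hr
  have key : ∀ u v : Set (ℝ × ℝ), IsOpen u → IsOpen v → U \ {z} ⊆ u ∪ v →
      ball z r \ {z} ⊆ u → ((U \ {z}) ∩ v).Nonempty → ((U \ {z}) ∩ (u ∩ v)).Nonempty := by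
    intro u v hu hv huv hbu ⟨y, hy, hyv⟩
    obtain ⟨x, hxU, hx1, hx2⟩ := hU (u ∪ ball z r) (v \ {z}) (hu.union isOpen_ball)
      (hv.sdiff isClosed_singleton) (fun x hx => by
        by_cases hxz : x = z
        · exact Or.inl (Or.inr (hxz ▸ mem_ball_self hr))
        · rcases huv ⟨hx, hxz⟩ with h | h
          · exact Or.inl (Or.inl h)
          · exact Or.inr ⟨h, hxz⟩) ⟨z, hz, Or.inr (mem_ball_self hr)⟩ ⟨y, hy.1, hyv, hy.2⟩
    refine ⟨x, ⟨hxU, hx2.2⟩, ?_, hx2.1⟩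
    rcases hx1 with h | h
    · exact h
    · exact hbu ⟨h, hx2.2⟩
  intro u v hu hv huv hnu hnv
  by_contra hcon
  have hsub : ball z r \ {z} ⊆ u ∪ v := fun x hx => huv ⟨hrU hx.1, hx.2⟩
  have hdis : ball z r \ {z} ⊆ u ∨ ball z r \ {z} ⊆ v := by
    by_contra! hne
    obtain ⟨x, hx, hxu⟩ := not_subset.1 hne.1
    obtain ⟨y, hy, hyv⟩ := not_subset.1 hne.2
    obtain ⟨w, hw, hw'⟩ := hb u v hu hv hsub ⟨y, hy, (hsub hy).resolve_right hyv⟩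
      ⟨x, hx, (hsub hx).resolve_left hxu⟩
    exact hcon ⟨w, ⟨hrU hw.1, hw.2⟩, hw'⟩
  rcases hdis with h | h
  · exact hcon (key u v hu hv huv h hnv)
  · rw [inter_comm u v] at hcon
    exact hcon (key v u hv hu (by rwa [union_comm]) h hnu)

theorem subset_closure_diff_singleton_of_isOpen {U : Set (ℝ × ℝ)} (ho : IsOpen U) (z : ℝ × ℝ) :
    closure U ⊆ closure (U \ {z}) := by
  have := (Module.punctured_nhds_neBot ℝ (ℝ × ℝ) z)
  have hd : Dense ({z}ᶜ : Set (ℝ × ℝ)) := dense_compl_singleton z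
  rw [sdiff_eq]
  exact closure_minimal (hd.open_subset_closure_inter ho) isClosed_closure
  
/-- `X` and `Y` lie, up to the point `z`, in a connected subset of `T \ {z}`. -/
def Linked {α : Type*} [TopologicalSpace α] (T : Set α) (z : α) (X Y : Set α) : Prop :=
  ∃ C ⊆ T \ {z}, IsPreconnected C ∧ X \ {z} ⊆ C ∧ Y \ {z} ⊆ C

namespace Linked
variable {α : Type*} [TopologicalSpace α] {T X Y W : Set α} {z : α}

theorem symm (h : Linked T z X Y) : Linked T z Y X := by
  obtain ⟨C, h1, h2, h3, h4⟩ := h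
  exact ⟨C, h1, h2, h4, h3⟩

theorem mono {X' Y' : Set α} (h : Linked T z X Y) (hX : X' ⊆ X) (hY : Y' ⊆ Y) :
    Linked T z X' Y' := by
  obtain ⟨C, h1, h2, h3, h4⟩ := h
  exact ⟨C, h1, h2, (sdiff_subset_sdiff_left hX).trans h3, (sdiff_subset_sdiff_left hY).trans h4⟩

theorem trans (h : Linked T z X Y) (hY : (Y \ {z}).Nonempty) (h' : Linked T z Y W) :
    Linked T z X W := by
  obtain ⟨C, h1, h2, h3, h4⟩ := h
  obtain ⟨C', h1', h2', h3', h4'⟩ := h'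
  obtain ⟨y, hy⟩ := hY
  exact ⟨C ∪ C', union_subset h1 h1', h2.union y (h4 hy) (h3' hy) h2',
    h3.trans subset_union_left, h4'.trans subset_union_right⟩

theorem of_isPreconnected (hX : IsPreconnected (X \ {z})) (hT : X ⊆ T) : Linked T z X X :=
  ⟨X \ {z}, sdiff_subset_sdiff_left hT, hX, Subset.rfl, Subset.rfl⟩

theorem of_inter (hX : IsPreconnected (X \ {z})) (hY : IsPreconnected (Y \ {z}))
    (hXT : X ⊆ T) (hYT : Y ⊆ T) (h : ((X ∩ Y) \ {z}).Nonempty) : Linked T z X Y := by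
  obtain ⟨y, hy, hyz⟩ := h
  exact ⟨X \ {z} ∪ Y \ {z}, union_subset (sdiff_subset_sdiff_left hXT) (sdiff_subset_sdiff_left hYT),
    hX.union y ⟨hy.1, hyz⟩ ⟨hy.2, hyz⟩ hY, subset_union_left, subset_union_right⟩

end Linked

/-- The inverse of the companion map of `x² - a x + B`. -/
noncomputable def invM (a B : ℤ) (p : ℝ × ℝ) : ℝ × ℝ := ((a * p.1 - p.2) / B, p.1)

/-- A quadratic Lyapunov function for `invM`. -/
noncomputable def lyap (a B : ℤ) (p : ℝ × ℝ) : ℝ :=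
  p.1 ^ 2 + p.2 ^ 2 - 2 * (a / (B + 1)) * p.1 * p.2

section contraction
variable {a B : ℤ}

theorem abs_ratio_lt_one (hB : 2 ≤ B) (ha : |a| ≤ B) : |(a / (B + 1) : ℝ)| < 1 := by
  have h1 : |(a : ℝ)| ≤ B := by exact_mod_cast ha
  have h2 : (2 : ℝ) ≤ B := by exact_mod_cast hB
  rw [abs_div, abs_of_pos (by linarith : (0 : ℝ) < B + 1), div_lt_one (by linarith)]
  linarith

theorem lyap_invM (hB : 2 ≤ B) (p : ℝ × ℝ) :
    lyap a B p - lyap a B (invM a B p) =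
      (1 - (1 / B) ^ 2) * (p.2 - a / (B + 1) * p.1) ^ 2 := by
  have h2 : (2 : ℝ) ≤ B := by exact_mod_cast hB
  have : (B : ℝ) ≠ 0 := by linarith
  have : (B : ℝ) + 1 ≠ 0 := by linarith
  simp only [lyap, invM]
  field_simp
  ring

theorem inv_B_sq_lt (hB : 2 ≤ B) : (1 / (B : ℝ)) ^ 2 ≤ 1 / 4 := by
  have h2 : (2 : ℝ) ≤ B := by exact_mod_cast hB
  rw [div_pow, one_pow]
  apply one_div_le_one_div_of_le <;> nlinarith

theorem lyap_invM_le (hB : 2 ≤ B) (p : ℝ × ℝ) : lyap a B (invM a B p) ≤ lyap a B p := by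
  have h := lyap_invM (a := a) hB p
  have h4 := inv_B_sq_lt hB
  nlinarith [sq_nonneg (p.2 - a / (B + 1) * p.1)]

theorem lyap_invM_invM (hB : 2 ≤ B) (ha : |a| ≤ B) : ∃ ρ : ℝ, 0 ≤ ρ ∧ ρ < 1 ∧
    ∀ p, lyap a B (invM a B (invM a B p)) ≤ ρ * lyap a B p := by
  have hγ := abs_ratio_lt_one hB ha
  set γ : ℝ := a / (B + 1) with hγd
  set β : ℝ := 1 / B with hβd
  have h2 : (2 : ℝ) ≤ B := by exact_mod_cast hB
  have hβ : 0 < β ∧ β ≤ 1 / 2 := ⟨by positivity, by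
    apply one_div_le_one_div_of_le <;> linarith⟩
  have hγ2 : γ ^ 2 < 1 := by rwa [sq_lt_one_iff_abs_lt_one]
  set δ := 1 - γ ^ 2 with hδ
  have hδ0 : 0 < δ := by linarith
  have hδ1 : δ ≤ 1 := by nlinarith [sq_nonneg γ]
  refine ⟨1 - δ / 4, by linarith, by linarith, fun p => ?_⟩
  have e1 := lyap_invM (a := a) hB p
  have e2 := lyap_invM (a := a) hB (invM a B p)
  have hr : (invM a B p).2 - γ * (invM a B p).1 = δ * p.1 + γ * β * (p.2 - γ * p.1) := by
    have : (B : ℝ) ≠ 0 := by linarith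
    have : (B : ℝ) + 1 ≠ 0 := by linarith
    simp only [invM, hδ, hγd, hβd]
    field_simp
    ring
  rw [← hγd, ← hβd] at e1 e2
  rw [hr] at e2
  have hV : lyap a B p = (p.2 - γ * p.1) ^ 2 + δ * p.1 ^ 2 := by
    simp only [lyap, ← hγd, hδ]; ring
  set u := p.2 - γ * p.1
  set x := p.1
  set w := δ * x + γ * β * u with hw
  have hS : δ * (u ^ 2 + δ * x ^ 2) ≤ 3 * (u ^ 2 + w ^ 2) := by
    have hgb : (γ * β) ^ 2 ≤ 1 := by nlinarith [sq_nonneg γ, sq_nonneg β]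
    have h3 : (δ * x) ^ 2 ≤ 2 * w ^ 2 + 2 * u ^ 2 := by
      have : δ * x = w - γ * β * u := by rw [hw]; ring
      rw [this]
      nlinarith [sq_nonneg (w + γ * β * u), mul_nonneg (sub_nonneg.2 hgb) (sq_nonneg u)]
    nlinarith [mul_nonneg (sub_nonneg.2 hδ1) (sq_nonneg u), sq_nonneg w]
  have hβ2 : β ^ 2 ≤ 1 / 4 := by nlinarith
  nlinarith [sq_nonneg u, sq_nonneg w]

theorem sq_norm_le_lyap (hB : 2 ≤ B) (ha : |a| ≤ B) : ∃ c : ℝ, 0 < c ∧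
    ∀ p, c * ‖p‖ ^ 2 ≤ lyap a B p := by
  have hγ := abs_ratio_lt_one hB ha
  set γ : ℝ := a / (B + 1) with hγd
  have hγ2 : γ ^ 2 < 1 := by rwa [sq_lt_one_iff_abs_lt_one]
  refine ⟨1 - γ ^ 2, by linarith, fun p => ?_⟩
  have h1 : (1 - γ ^ 2) * p.1 ^ 2 ≤ lyap a B p := by
    simp only [lyap, ← hγd]; nlinarith [sq_nonneg (p.2 - γ * p.1)]
  have h2 : (1 - γ ^ 2) * p.2 ^ 2 ≤ lyap a B p := by
    simp only [lyap, ← hγd]; nlinarith [sq_nonneg (p.1 - γ * p.2)]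
  rw [Prod.norm_def, Real.norm_eq_abs, Real.norm_eq_abs]
  rcases max_cases |p.1| |p.2| with ⟨h, -⟩ | ⟨h, -⟩ <;> rw [h, sq_abs] <;> assumption

theorem lyap_le (hB : 2 ≤ B) (ha : |a| ≤ B) (p : ℝ × ℝ) : lyap a B p ≤ 4 * ‖p‖ ^ 2 := by
  have hγ := abs_lt.1 (abs_ratio_lt_one hB ha)
  set γ : ℝ := a / (B + 1) with hγd
  have h1 : p.1 ^ 2 ≤ ‖p‖ ^ 2 := by
    rw [← sq_abs p.1]; exact pow_le_pow_left₀ (abs_nonneg _) (norm_fst_le p) 2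
  have h2 : p.2 ^ 2 ≤ ‖p‖ ^ 2 := by
    rw [← sq_abs p.2]; exact pow_le_pow_left₀ (abs_nonneg _) (norm_snd_le p) 2
  simp only [lyap, ← hγd]
  nlinarith [mul_nonneg (by linarith : 0 ≤ 1 + γ) (sq_nonneg (p.1 - p.2)),
    mul_nonneg (by linarith : 0 ≤ 1 - γ) (sq_nonneg (p.1 + p.2))]

theorem exists_iterate_invM_lt (hB : 2 ≤ B) (ha : |a| ≤ B) (R : ℝ) {ε : ℝ} (hε : 0 < ε) :
    ∃ N, ∀ n ≥ N, ∀ p : ℝ × ℝ, ‖p‖ ≤ R → ‖(invM a B)^[n] p‖ < ε := by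
  obtain ⟨ρ, hρ0, hρ1, hρ⟩ := lyap_invM_invM hB ha
  obtain ⟨c, hc, hcV⟩ := sq_norm_le_lyap hB ha
  have hpow : ∀ n p, lyap a B ((invM a B)^[2 * n] p) ≤ ρ ^ n * lyap a B p := by
    intro n p
    induction n with
    | zero => simp
    | succ n ih =>
      rw [show 2 * (n + 1) = (2 * n + 1) + 1 by ring, Function.iterate_succ_apply',
        Function.iterate_succ_apply', pow_succ']
      calc _ ≤ ρ * lyap a B ((invM a B)^[2 * n] p) := hρ _
        _ ≤ ρ * (ρ ^ n * lyap a B p) := by gcongr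
        _ = _ := by ring
  have hanti : ∀ p, Antitone fun n => lyap a B ((invM a B)^[n] p) := fun p =>
    antitone_nat_of_succ_le fun n => by
      simp only [Function.iterate_succ_apply']; exact lyap_invM_le hB _
  have hlim : Tendsto (fun n => ρ ^ n * (4 * R ^ 2)) atTop (𝓝 0) := by
    simpa using (tendsto_pow_atTop_nhds_zero_of_lt_one hρ0 hρ1).mul_const (4 * R ^ 2)
  obtain ⟨N, hN⟩ := ((tendsto_order.1 hlim).2 (c * ε ^ 2) (by positivity)).exists
  refine ⟨2 * N, fun n hn p hp => ?_⟩
  have h1 := hcV ((invM a B)^[n] p)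
  have h2 : lyap a B ((invM a B)^[n] p) ≤ lyap a B ((invM a B)^[2 * N] p) := hanti p hn
  have h3 := hpow N p
  have h4 : lyap a B p ≤ 4 * R ^ 2 := (lyap_le hB ha p).trans (by gcongr)
  have h5 : ρ ^ N * lyap a B p ≤ ρ ^ N * (4 * R ^ 2) := by gcongr
  have h6 : c * ‖(invM a B)^[n] p‖ ^ 2 < c * ε ^ 2 := by linarith
  exact lt_of_pow_lt_pow_left₀ 2 hε.le (lt_of_mul_lt_mul_left h6 hc.le)

end contraction

/-- The contraction `p ↦ M⁻¹ (p + (j - (B - 1) / 2) v)`, where `M` is the companion map of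
`x² - a x + B` and `v = (0, 1)`. -/
noncomputable def br (a B j : ℤ) (p : ℝ × ℝ) : ℝ × ℝ :=
  ((a * p.1 - p.2 - j + (B - 1) / 2) / B, p.1)

/-- The inverse of `br a B j`. -/
noncomputable def ubr (a B j : ℤ) (p : ℝ × ℝ) : ℝ × ℝ :=
  (p.2, a * p.2 - B * p.1 - j + (B - 1) / 2)

/-- `T` is the self-affine tile of the companion map of `x² - a x + B`, translated so that
its centre of symmetry is the origin. -/
structure IsTile (a B : ℤ) (T : Set (ℝ × ℝ)) : Prop where
  two_le : 2 ≤ B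
  abs_le : |a| ≤ B
  nonempty : T.Nonempty
  isCompact : IsCompact T
  exists_ubr_mem : ∀ p ∈ T, ∃ j, 0 ≤ j ∧ j < B ∧ ubr a B j p ∈ T
  br_mem : ∀ j, 0 ≤ j → j < B → ∀ p ∈ T, br a B j p ∈ T

theorem continuous_br (a B j : ℤ) : Continuous (br a B j) := by unfold br; fun_prop

theorem continuous_ubr (a B j : ℤ) : Continuous (ubr a B j) := by unfold ubr; fun_prop

theorem br_sub_br (a B j : ℤ) (p q : ℝ × ℝ) :
    br a B j p - br a B j q = invM a B (p - q) := by
  simp only [br, invM, Prod.mk_sub_mk, Prod.fst_sub, Prod.snd_sub, Prod.mk.injEq, and_true]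
  ring

theorem br_add (a B j k : ℤ) (p : ℝ × ℝ) : br a B j (p + (0, (k : ℝ))) = br a B (j + k) p := by
  simp only [br, Prod.fst_add, Prod.snd_add, Prod.mk.injEq, add_zero, and_true, Int.cast_add]
  ring

theorem neg_br (a B j : ℤ) (p : ℝ × ℝ) : -br a B j p = br a B (B - 1 - j) (-p) := by
  simp only [br, Prod.neg_mk, Prod.fst_neg, Prod.snd_neg, Prod.mk.injEq, and_true]
  push_cast
  ring

namespace IsTile
variable {a B : ℤ} {T : Set (ℝ × ℝ)} (h : IsTile a B T)
include h

theorem two_le_real : (2 : ℝ) ≤ B := by exact_mod_cast h.two_le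

theorem br_ubr (j : ℤ) (p : ℝ × ℝ) : br a B j (ubr a B j p) = p := by
  have := h.two_le_real
  have : (B : ℝ) ≠ 0 := by linarith
  simp only [br, ubr]
  ext <;> simp only
  field_simp
  ring

theorem ubr_br (j : ℤ) (p : ℝ × ℝ) : ubr a B j (br a B j p) = p := by
  have := h.two_le_real
  have : (B : ℝ) ≠ 0 := by linarith
  simp only [br, ubr]
  ext <;> simp only
  field_simp
  ring

theorem br_injective (j : ℤ) : Function.Injective (br a B j) :=
  Function.LeftInverse.injective (h.ubr_br j)

theorem isOpen_image_br (j : ℤ) {U : Set (ℝ × ℝ)} (hU : IsOpen U) : IsOpen (br a B j '' U) := by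
  rw [Set.image_eq_preimage_of_inverse (h.ubr_br j) (h.br_ubr j)]
  exact hU.preimage (continuous_ubr a B j)

theorem image_br_subset {j : ℤ} (h0 : 0 ≤ j) (h1 : j < B) : br a B j '' T ⊆ T := by
  rintro _ ⟨p, hp, rfl⟩; exact h.br_mem j h0 h1 p hp

/-- Bounded sets that are reproduced by the expanding maps are contained in the tile. -/
theorem subset_of_exists_ubr_mem {P : Set (ℝ × ℝ)} (hP : Bornology.IsBounded P)
    (hu : ∀ p ∈ P, ∃ j, 0 ≤ j ∧ j < B ∧ ubr a B j p ∈ P) : P ⊆ T := by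
  obtain ⟨t₀, ht₀⟩ := h.nonempty
  have key : ∀ n : ℕ, ∀ p ∈ P, ∃ t ∈ T, ∃ q ∈ P, p - t = (invM a B)^[n] (q - t₀) := by
    intro n
    induction n with
    | zero => exact fun p hp => ⟨t₀, ht₀, p, hp, rfl⟩
    | succ n ih =>
      intro p hp
      obtain ⟨j, hj0, hj1, hj⟩ := hu p hp
      obtain ⟨t, ht, q, hq, e⟩ := ih _ hj
      refine ⟨br a B j t, h.br_mem j hj0 hj1 t ht, q, hq, ?_⟩
      rw [Function.iterate_succ_apply', ← e, ← br_sub_br, h.br_ubr]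
  obtain ⟨R, hR⟩ := hP.exists_norm_le
  intro p hp
  rw [← h.isCompact.isClosed.closure_eq, Metric.mem_closure_iff]
  intro ε hε
  obtain ⟨N, hN⟩ := exists_iterate_invM_lt h.two_le h.abs_le (R + ‖t₀‖) hε
  obtain ⟨t, ht, q, hq, e⟩ := key N p hp
  refine ⟨t, ht, ?_⟩
  rw [dist_eq_norm, e]
  exact hN N le_rfl _ ((norm_sub_le _ _).trans (by linarith [hR q hq]))

theorem neg_mem {p : ℝ × ℝ} (hp : p ∈ T) : -p ∈ T := by
  have : (Neg.neg '' T) ⊆ T := by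
    apply h.subset_of_exists_ubr_mem
    · exact (h.isCompact.image continuous_neg).isBounded
    · rintro _ ⟨q, hq, rfl⟩
      obtain ⟨j, hj0, hj1, hj⟩ := h.exists_ubr_mem q hq
      refine ⟨B - 1 - j, by omega, by omega, ubr a B j q, hj, ?_⟩
      apply h.br_injective (B - 1 - j)
      rw [← neg_br, h.br_ubr, h.br_ubr]
  exact this ⟨p, hp, rfl⟩

/-- A family of subsets of the tile that is reproduced by the contractions is dense. -/
theorem subset_closure_of_image_br_subset {ι : Type*} {U : ι → Set (ℝ × ℝ)} {σ : ℤ → ι → ι}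
    (hne : ∀ i, (U i).Nonempty) (hUT : ∀ i, U i ⊆ T)
    (hU : ∀ i j, 0 ≤ j → j < B → br a B j '' U (σ j i) ⊆ U i) (i : ι) : T ⊆ closure (U i) := by
  have key : ∀ n : ℕ, ∀ i, ∀ p ∈ T, ∃ y ∈ U i, ∃ t ∈ T, ∃ t' ∈ T,
      p - y = (invM a B)^[n] (t - t') := by
    intro n
    induction n with
    | zero =>
      intro i p hp
      obtain ⟨y, hy⟩ := hne i
      exact ⟨y, hy, p, hp, y, hUT i hy, rfl⟩
    | succ n ih =>
      intro i p hp
      obtain ⟨j, hj0, hj1, hj⟩ := h.exists_ubr_mem p hp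
      obtain ⟨y, hy, t, ht, t', ht', e⟩ := ih (σ j i) _ hj
      refine ⟨br a B j y, hU i j hj0 hj1 ⟨y, hy, rfl⟩, t, ht, t', ht', ?_⟩
      rw [Function.iterate_succ_apply', ← e, ← br_sub_br, h.br_ubr]
  obtain ⟨R, hR⟩ := h.isCompact.isBounded.exists_norm_le
  intro p hp
  rw [Metric.mem_closure_iff]
  intro ε hε
  obtain ⟨N, hN⟩ := exists_iterate_invM_lt h.two_le h.abs_le (R + R) hε
  obtain ⟨y, hy, t, ht, t', ht', e⟩ := key N i p hp
  refine ⟨y, hy, ?_⟩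
  rw [dist_eq_norm, e]
  exact hN N le_rfl _ ((norm_sub_le _ _).trans (add_le_add (hR t ht) (hR t' ht')))

/-- The tile is connected as soon as it meets its translate by `v`. -/
theorem isConnected_of_sub_mem {p₀ : ℝ × ℝ} (h₀ : p₀ ∈ T) (h₁ : p₀ - (0, 1) ∈ T) :
    IsConnected T := by
  refine ⟨h.nonempty, isPreconnected_closed_iff.2 fun t t' ht ht' hsub hnt hnt' => ?_⟩
  by_contra hcon
  have hdis : Disjoint (T ∩ t) (T ∩ t') := by
    rw [disjoint_iff_inter_eq_empty, ← inter_inter_distrib_left]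
    exact not_nonempty_iff_eq_empty.1 hcon
  obtain ⟨δ, hδ, hδ'⟩ := hdis.exists_thickenings (h.isCompact.inter_right ht)
    (h.isCompact.isClosed.inter ht')
  obtain ⟨R, hR⟩ := h.isCompact.isBounded.exists_norm_le
  obtain ⟨N, hN⟩ := exists_iterate_invM_lt h.two_le h.abs_le (R + R) hδ
  have key : ∀ n ≤ N, ∀ g : ℝ × ℝ → ℝ × ℝ, MapsTo g T T →
      (∀ p q, g p - g q = (invM a B)^[n] (p - q)) → g '' T ⊆ t ∨ g '' T ⊆ t' := by
    intro n hn
    induction hn using Nat.decreasingInduction with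
    | self =>
      intro g hg hgd
      by_contra! hne
      obtain ⟨x, ⟨p, hp, rfl⟩, hx⟩ := not_subset.1 hne.1
      obtain ⟨y, ⟨q, hq, rfl⟩, hy⟩ := not_subset.1 hne.2
      have hx' : g p ∈ T ∩ t' := ⟨hg hp, (hsub (hg hp)).resolve_left hx⟩
      have hy' : g q ∈ T ∩ t := ⟨hg hq, (hsub (hg hq)).resolve_right hy⟩
      refine Set.disjoint_left.1 hδ' (self_subset_thickening hδ _ hy') ?_
      rw [mem_thickening_iff]
      refine ⟨g p, hx', ?_⟩
      rw [dist_eq_norm, hgd]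
      exact hN N le_rfl _ ((norm_sub_le _ _).trans (add_le_add (hR q hq) (hR p hp)))
    | of_succ k hk ih =>
      intro g hg hgd
      have hc : ∀ j, 0 ≤ j → j < B → (g ∘ br a B j) '' T ⊆ t ∨ (g ∘ br a B j) '' T ⊆ t' := by
        intro j hj0 hj1
        refine ih _ (fun p hp => hg (h.br_mem j hj0 hj1 p hp)) fun p q => ?_
        rw [Function.iterate_succ_apply, ← br_sub_br a B j, ← hgd]; rfl
      have hall : ∀ s s' : Set (ℝ × ℝ), (∀ j, 0 ≤ j → j < B →
          (g ∘ br a B j) '' T ⊆ s ∨ (g ∘ br a B j) '' T ⊆ s') → T ∩ (s ∩ s') = ∅ →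
          (g ∘ br a B 0) '' T ⊆ s → g '' T ⊆ s := by
        intro s s' hss hemp hs0
        have hind : ∀ j : ℕ, (j : ℤ) < B → (g ∘ br a B j) '' T ⊆ s := by
          intro j
          induction j with
          | zero => intro _; simpa using hs0
          | succ j ihj =>
            intro hj
            push_cast at hj ⊢
            refine (hss _ (by omega) hj).resolve_right fun hs' => ?_
            have e : br a B j p₀ = br a B (j + 1) (p₀ - (0, 1)) := by
              rw [← br_add]; simp
            have m1 : g (br a B j p₀) ∈ s := ihj (by omega) ⟨p₀, h₀, rfl⟩
            have m2 : g (br a B j p₀) ∈ s' := by rw [e]; exact hs' ⟨_, h₁, rfl⟩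
            have m3 : g (br a B j p₀) ∈ T := hg (h.br_mem _ (by omega) (by omega) _ h₀)
            exact (Set.eq_empty_iff_forall_notMem.1 hemp) _ ⟨m3, m1, m2⟩
        rintro _ ⟨p, hp, rfl⟩
        obtain ⟨j, hj0, hj1, hj⟩ := h.exists_ubr_mem p hp
        lift j to ℕ using hj0
        exact hind j hj1 ⟨_, hj, by simp [h.br_ubr]⟩
      have hemp := not_nonempty_iff_eq_empty.1 hcon
      rcases hc 0 le_rfl (by have := h.two_le; omega) with h0 | h0
      · exact Or.inl (hall t t' hc hemp h0)
      · exact Or.inr (hall t' t (fun j h0 h1 => (hc j h0 h1).symm) (by rwa [inter_comm t' t]) h0)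
  rcases key 0 (Nat.zero_le _) id (mapsTo_id _) (fun p q => rfl) with h0 | h0
  · obtain ⟨y, hy, hy'⟩ := hnt'
    exact hcon ⟨y, hy, h0 ⟨y, hy, rfl⟩, hy'⟩
  · obtain ⟨y, hy, hy'⟩ := hnt
    exact hcon ⟨y, hy, hy', h0 ⟨y, hy, rfl⟩⟩

/-- The union of the lattice translates of the tile by a set of lattice vectors. -/
theorem isClosed_translates (S : Set (ℤ × ℤ)) :
    IsClosed {p : ℝ × ℝ | ∃ s ∈ S, p - ((s.1 : ℝ), (s.2 : ℝ)) ∈ T} := by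
  have hS : IsClosed ((Prod.map (Int.cast : ℤ → ℝ) (Int.cast : ℤ → ℝ)) '' S) :=
    (Int.isClosedEmbedding_coe_real.prodMap Int.isClosedEmbedding_coe_real).isClosedMap _
      (isClosed_discrete S)
  convert hS.add_left_of_isCompact h.isCompact using 1
  ext p
  simp only [mem_ofPred_eq, Set.mem_add]
  constructor
  · rintro ⟨s, hs, hp⟩
    exact ⟨_, hp, _, ⟨s, hs, rfl⟩, by simp [Prod.map]⟩
  · rintro ⟨t, ht, _, ⟨s, hs, rfl⟩, rfl⟩
    exact ⟨s, hs, by simpa [Prod.map] using ht⟩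

/-- The lattice translates of the tile cover the plane. -/
theorem exists_sub_mem (p : ℝ × ℝ) : ∃ m n : ℤ, p - ((m : ℝ), (n : ℝ)) ∈ T := by
  set X : Set (ℝ × ℝ) := {p | ∃ s ∈ (univ : Set (ℤ × ℤ)), p - ((s.1 : ℝ), (s.2 : ℝ)) ∈ T} with hX
  have hXc : IsClosed X := h.isClosed_translates univ
  have hB := h.two_le
  have hBR := h.two_le_real
  have hG : ∀ q ∈ X, br a B 0 q ∈ X := by
    rintro q ⟨⟨m, n⟩, -, hq⟩
    have hj0 := Int.emod_nonneg (n - a * m) (by omega : B ≠ 0)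
    have hj1 := Int.emod_lt_of_pos (n - a * m) (by omega : 0 < B)
    refine ⟨(-((n - a * m) / B), m), mem_univ _, ?_⟩
    convert h.br_mem _ hj0 hj1 _ hq using 1
    have e : (n : ℝ) - a * m = B * ((n - a * m) / B : ℤ) + ((n - a * m) % B : ℤ) := by
      exact_mod_cast (Int.mul_ediv_add_emod (n - a * m) B).symm
    have : (B : ℝ) ≠ 0 := by linarith
    simp only [br, Prod.mk_sub_mk, Prod.fst_sub, Prod.snd_sub, Prod.mk.injEq, and_true, Int.cast_neg]
    field_simp
    simp only [Int.cast_zero]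
    linear_combination -2 * e
  obtain ⟨t₀, ht₀⟩ := h.nonempty
  have key : ∀ n : ℕ, ∀ q, ∃ y ∈ X, ∃ d : ℝ × ℝ, ‖d‖ ≤ 1 ∧ q - y = (invM a B)^[n] d := by
    intro n
    induction n with
    | zero =>
      intro q
      refine ⟨t₀ + ((⌊(q - t₀).1⌋ : ℝ), (⌊(q - t₀).2⌋ : ℝ)),
        ⟨(⌊(q - t₀).1⌋, ⌊(q - t₀).2⌋), mem_univ _, by simpa using ht₀⟩, _, ?_, rfl⟩
      rw [← sub_sub, Prod.norm_def, max_le_iff, Real.norm_eq_abs, Real.norm_eq_abs]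
      have e1 := Int.fract_nonneg (q - t₀).1
      have e2 := Int.fract_lt_one (q - t₀).1
      have e3 := Int.fract_nonneg (q - t₀).2
      have e4 := Int.fract_lt_one (q - t₀).2
      simp only [Int.fract] at e1 e2 e3 e4
      simp only [Prod.fst_sub, Prod.snd_sub] at *
      constructor <;> rw [_root_.abs_le] <;> constructor <;> linarith
    | succ n ih =>
      intro q
      obtain ⟨y, hy, d, hd, e⟩ := ih (ubr a B 0 q)
      exact ⟨_, hG y hy, d, hd, by
        rw [Function.iterate_succ_apply', ← e, ← br_sub_br a B 0, h.br_ubr]⟩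
  have hpX : p ∈ X := by
    rw [← hXc.closure_eq, Metric.mem_closure_iff]
    intro ε hε
    obtain ⟨N, hN⟩ := exists_iterate_invM_lt h.two_le h.abs_le 1 hε
    obtain ⟨y, hy, d, hd, e⟩ := key N p
    exact ⟨y, hy, by rw [dist_eq_norm, e]; exact hN N le_rfl d hd⟩
  obtain ⟨s, -, hs⟩ := hpX
  exact ⟨s.1, s.2, hs⟩

theorem mem_interior_of_forall {S : Set (ℤ × ℤ)} {p : ℝ × ℝ}
    (hp : ∀ m n : ℤ, p - ((m : ℝ), (n : ℝ)) ∈ T → (m, n) ∈ S) :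
    p ∈ interior {q : ℝ × ℝ | ∃ s ∈ S, q - ((s.1 : ℝ), (s.2 : ℝ)) ∈ T} := by
  rw [mem_interior]
  refine ⟨_, ?_, (h.isClosed_translates Sᶜ).isOpen_compl, ?_⟩
  · intro q hq
    obtain ⟨m, n, hmn⟩ := h.exists_sub_mem q
    refine ⟨(m, n), ?_, hmn⟩
    by_contra hS
    exact hq ⟨(m, n), hS, hmn⟩
  · rintro ⟨⟨m, n⟩, hs, hm⟩
    exact hs (hp m n hm)

end IsTile

namespace IsTile
variable {a B : ℤ} {T : Set (ℝ × ℝ)} (h : IsTile a B T)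
include h

theorem exists_eigenvalues (hd : 5 ≤ 2 * a - B) : ∃ lam μ : ℝ,
    ((B / 2 : ℤ) : ℝ) + 1 < lam ∧ 1 < μ ∧ lam + μ = a ∧ lam * μ = B := by
  have hB := h.two_le
  have haB : a ≤ B := (_root_.abs_le.1 h.abs_le).2
  set i : ℤ := B / 2 with hi
  have h1 : i + 3 ≤ a := by omega
  have h2 : B ≤ 2 * i + 1 := by omega
  have h3 : 1 ≤ i := by omega
  have r1 : (i : ℝ) + 3 ≤ a := by exact_mod_cast h1
  have r2 : (B : ℝ) ≤ 2 * i + 1 := by exact_mod_cast h2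
  have r3 : (1 : ℝ) ≤ i := by exact_mod_cast h3
  have r4 : (a : ℝ) ≤ B := by exact_mod_cast haB
  have hcont : ContinuousOn (fun x : ℝ => x ^ 2 - a * x + B) (Icc (i + 1 : ℝ) (a - 1)) := by
    fun_prop
  obtain ⟨x, hx, hx0⟩ := intermediate_value_Ioo (by linarith) hcont
    (show (0 : ℝ) ∈ Ioo _ _ from ⟨by nlinarith, by nlinarith⟩)
  simp only at hx0
  exact ⟨x, a - x, hx.1, by linarith [hx.2], by ring, by linarith⟩

/-- If `5 ≤ 2 a - B`, then the fixed point of a central contraction is a cut point. -/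
theorem exists_cutPoint (hd : 5 ≤ 2 * a - B) : ∃ z ∈ T, ¬ IsPreconnected (T \ {z}) := by
  obtain ⟨lam, μ, hlam, hμ, hadd, hmul⟩ := h.exists_eigenvalues hd
  have hB := h.two_le
  have haB : a ≤ B := (_root_.abs_le.1 h.abs_le).2
  have hBR := h.two_le_real
  have haBR : (a : ℝ) ≤ B := by exact_mod_cast haB
  set i : ℤ := B / 2 with hi
  have h3 : 1 ≤ i := by omega
  have r3 : (1 : ℝ) ≤ i := by exact_mod_cast h3
  have hiB : i + 1 < B := by omega
  have hBi : (B : ℝ) ≤ 2 * i + 1 := by exact_mod_cast (by omega : B ≤ 2 * i + 1)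
  set φ : ℝ × ℝ → ℝ := fun p => p.2 - μ * p.1 with hφ
  have hφc : Continuous φ := by fun_prop
  have hφbr : ∀ (j : ℤ) p, lam * φ (br a B j p) = φ p + (j - (B - 1) / 2) := by
    intro j p
    have : (B : ℝ) ≠ 0 := by linarith
    have e : μ * ((a * p.1 - p.2 - j + (B - 1) / 2) / B) * lam =
        a * p.1 - p.2 - j + (B - 1) / 2 := by
      rw [mul_comm μ, mul_assoc, mul_comm μ, hmul]; field_simp
    simp only [hφ, br]
    linear_combination -e + p.1 * hadd
  have hbound : ∀ p ∈ T, |φ p| * (lam - 1) ≤ (B - 1) / 2 := by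
    obtain ⟨p₀, hp₀, hmax⟩ := h.isCompact.exists_isMaxOn h.nonempty
      (hφc.abs.continuousOn (s := T))
    have hm : |φ p₀| * (lam - 1) ≤ (B - 1) / 2 := by
      obtain ⟨j, hj0, hj1, hj⟩ := h.exists_ubr_mem p₀ hp₀
      have e := hφbr j (ubr a B j p₀)
      rw [h.br_ubr] at e
      have hle : |φ (ubr a B j p₀)| ≤ |φ p₀| := hmax hj
      have j0 : (0 : ℝ) ≤ j := by exact_mod_cast hj0
      have j1 : (j : ℝ) + 1 ≤ B := by exact_mod_cast hj1
      have e2 : lam * |φ p₀| = |φ (ubr a B j p₀) + (j - (B - 1) / 2)| := by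
        rw [← e, abs_mul, abs_of_pos (by linarith : 0 < lam)]
      have e3 : |(j - (B - 1) / 2 : ℝ)| ≤ (B - 1) / 2 := by
        rw [_root_.abs_le]; constructor <;> linarith
      have := abs_add_le (φ (ubr a B j p₀)) (j - (B - 1) / 2 : ℝ)
      linarith
    intro p hp
    have hle : |φ p| ≤ |φ p₀| := hmax hp
    nlinarith
  set x : ℝ := -(i - (B - 1) / 2) / (B - a + 1) with hx
  set z : ℝ × ℝ := (x, x) with hz
  have hzfix : br a B i z = z := by
    have : (B : ℝ) ≠ 0 := by linarith
    have h' : (B : ℝ) - a + 1 ≠ 0 := by linarith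
    have e : x * (B - a + 1) = -(i - (B - 1) / 2) := by rw [hx]; field_simp
    simp only [br, hz, Prod.mk.injEq, and_true]
    rw [div_eq_iff this]
    linear_combination -e
  have hzT : z ∈ T := by
    have : ({z} : Set (ℝ × ℝ)) ⊆ T := h.subset_of_exists_ubr_mem Bornology.isBounded_singleton
      (by
        rintro p rfl
        exact ⟨i, by omega, by omega, by
          nth_rewrite 2 [← hzfix]; rw [h.ubr_br]; exact mem_singleton z⟩)
    exact this rfl
  have hφz : (lam - 1) * φ z = i - (B - 1) / 2 := by
    have := hφbr i z
    rw [hzfix] at this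
    linarith
  have hdigit : ∀ p ∈ T, φ p = φ z → ∃ p' ∈ T, φ p' = φ z ∧ p = br a B i p' := by
    intro p hp hpz
    obtain ⟨j, hj0, hj1, hj⟩ := h.exists_ubr_mem p hp
    have e := hφbr j (ubr a B j p)
    rw [h.br_ubr, hpz] at e
    have hb : |φ (ubr a B j p) * (lam - 1)| ≤ ((B : ℝ) - 1) / 2 := by
      rw [abs_mul, abs_of_pos (by linarith : 0 < lam - 1)]; exact hbound _ hj
    obtain ⟨b1, b2⟩ := _root_.abs_le.1 hb
    have hval : φ (ubr a B j p) = φ z + (i - j) := by linarith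
    rw [hval] at b1 b2
    have hij : j = i := by
      rcases lt_trichotomy j i with hlt | heq | hgt
      · have : (j : ℝ) + 1 ≤ i := by exact_mod_cast hlt
        nlinarith
      · exact heq
      · have : (i : ℝ) + 1 ≤ j := by exact_mod_cast hgt
        nlinarith
    subst hij
    exact ⟨_, hj, by linarith, (h.br_ubr _ p).symm⟩
  have huniq : ∀ p ∈ T, φ p = φ z → p = z := by
    have hSc : IsCompact (T ∩ {p | φ p = φ z}) :=
      h.isCompact.inter_right (isClosed_eq hφc continuous_const)
    obtain ⟨p₀, ⟨hp₀, hp₀z⟩, hmax⟩ := hSc.exists_isMaxOn ⟨z, hzT, rfl⟩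
      (show ContinuousOn (fun p : ℝ × ℝ => |p.1 - x|) _ by fun_prop)
    obtain ⟨p', hp', hp'z, e⟩ := hdigit p₀ hp₀ hp₀z
    have hle : |p'.1 - x| ≤ |p₀.1 - x| := hmax ⟨hp', hp'z⟩
    have e2 : p₀.2 = p'.1 := by rw [e]; rfl
    have e3 : p'.1 - x = μ * (p₀.1 - x) := by
      have : p₀.2 - μ * p₀.1 = x - μ * x := hp₀z
      linear_combination this - e2
    rw [e3, abs_mul, abs_of_pos (by linarith : 0 < μ)] at hle
    have h0 : |p₀.1 - x| ≤ 0 := by nlinarith [abs_nonneg (p₀.1 - x)]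
    intro p hp hpz
    have hle' : |p.1 - x| ≤ |p₀.1 - x| := hmax ⟨hp, hpz⟩
    have e4 : p.1 = x := by
      have := abs_nonpos_iff.1 (hle'.trans h0); linarith
    have e5 : p.2 = x := by
      have : p.2 - μ * p.1 = x - μ * x := hpz
      rw [e4] at this; linarith
    exact Prod.ext e4 e5
  refine ⟨z, hzT, fun hpre => ?_⟩
  have hval : ∀ j : ℤ, lam * (φ (br a B j z) - φ z) = j - i := fun j => by
    have := hφbr j z
    linarith
  have hlow : φ (br a B (i - 1) z) < φ z := by
    have := hval (i - 1); push_cast at this; nlinarith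
  have hhigh : φ z < φ (br a B (i + 1) z) := by
    have := hval (i + 1); push_cast at this; nlinarith
  obtain ⟨y, -, hy1, hy2⟩ := hpre {p | φ p < φ z} {p | φ z < φ p}
    (isOpen_lt hφc continuous_const) (isOpen_lt continuous_const hφc)
    (fun p hp => lt_or_gt_of_ne fun e => hp.2 (huniq p hp.1 e))
    ⟨_, ⟨h.br_mem (i - 1) (by omega) (by omega) z hzT, fun e => hlow.ne (congrArg φ e)⟩, hlow⟩
    ⟨_, ⟨h.br_mem (i + 1) (by omega) (by omega) z hzT, fun e => hhigh.ne' (congrArg φ e)⟩, hhigh⟩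
  exact lt_asymm (show φ y < φ z from hy1) (show φ z < φ y from hy2)

end IsTile

theorem lt_one_of_recurrence {a B : ℤ} (hs : (B = 2 ∧ a = 1) ∨ (B = 2 ∧ a = 2) ∨
    (B = 3 ∧ a = 1) ∨ (B = 3 ∧ a = 2) ∨ (B = 4 ∧ a = 2) ∨ (B = 4 ∧ a = 3) ∨ (B = 5 ∧ a = 2) ∨
    (B = 5 ∧ a = 3) ∨ (B = 6 ∧ a = 4) ∨ (B = 8 ∧ a = 5)) {x : ℕ → ℝ}
    (hx : ∀ n, |(B * x n - a * x (n + 1) + x (n + 2) : ℝ)| ≤ (B - 1) / 2)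
    (hQ : ∀ n, |x n| ≤ x 0) : x 0 < 1 := by
  by_contra! h1
  have x0 := abs_le.1 (hx 0)
  have x1 := abs_le.1 (hx 1)
  have x2 := abs_le.1 (hx 2)
  have Q1 := abs_le.1 (hQ 1)
  have Q2 := abs_le.1 (hQ 2)
  have Q3 := abs_le.1 (hQ 3)
  have Q4 := abs_le.1 (hQ 4)
  clear hx hQ
  rcases hs with ⟨rfl, rfl⟩ | ⟨rfl, rfl⟩ | ⟨rfl, rfl⟩ | ⟨rfl, rfl⟩ | ⟨rfl, rfl⟩ |
    ⟨rfl, rfl⟩ | ⟨rfl, rfl⟩ | ⟨rfl, rfl⟩ | ⟨rfl, rfl⟩ | ⟨rfl, rfl⟩ <;>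
  · norm_num at *
    linarith

theorem lt_of_recurrence {a B : ℤ} (hs : (B = 3 ∧ a = 3) ∨ (B = 5 ∧ a = 4)) {x y : ℕ → ℝ}
    {Q F : ℝ} (hx0 : x 0 = Q) (hy0 : y 1 - 2 * y 0 = F)
    (hx : ∀ n, |(B * x n - a * x (n + 1) + x (n + 2) : ℝ)| ≤ (B - 1) / 2)
    (hy : ∀ n, |(B * y n - a * y (n + 1) + y (n + 2) : ℝ)| ≤ (B - 1) / 2)
    (hQ : ∀ n, |x n| ≤ Q) (hQ' : ∀ n, |y n| ≤ Q) (hF : ∀ n, |x (n + 1) - 2 * x n| ≤ F)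
    (hF' : ∀ n, |y (n + 1) - 2 * y n| ≤ F) : Q < 3 / 2 ∧ F < 3 / 2 := by
  have x0 := abs_le.1 (hx 0)
  have x1 := abs_le.1 (hx 1)
  have x2 := abs_le.1 (hx 2)
  have y0 := abs_le.1 (hy 0)
  have y1 := abs_le.1 (hy 1)
  have y2 := abs_le.1 (hy 2)
  have Q1 := abs_le.1 (hQ 1)
  have Q2 := abs_le.1 (hQ 2)
  have Q3 := abs_le.1 (hQ 3)
  have Q4 := abs_le.1 (hQ 4)
  have P1 := abs_le.1 (hQ' 1)
  have P2 := abs_le.1 (hQ' 2)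
  have P3 := abs_le.1 (hQ' 3)
  have P4 := abs_le.1 (hQ' 4)
  have R1 := abs_le.1 (hF 1)
  have R2 := abs_le.1 (hF 2)
  have R3 := abs_le.1 (hF 3)
  have S1 := abs_le.1 (hF' 1)
  have S2 := abs_le.1 (hF' 2)
  have S3 := abs_le.1 (hF' 3)
  clear hx hy hQ hQ' hF hF'
  rcases hs with ⟨rfl, rfl⟩ | ⟨rfl, rfl⟩ <;>
  · norm_num at *
    constructor <;> linarith

namespace IsTile
variable {a B : ℤ} {T : Set (ℝ × ℝ)} (h : IsTile a B T)
include h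

theorem exists_seq {p : ℝ × ℝ} (hp : p ∈ T) : ∃ x : ℕ → ℝ, x 0 = p.1 ∧ x 1 = p.2 ∧
    (∀ n, (x n, x (n + 1)) ∈ T) ∧
    ∀ n, |(B * x n - a * x (n + 1) + x (n + 2) : ℝ)| ≤ (B - 1) / 2 := by
  choose! f hf0 hf1 hfT using h.exists_ubr_mem
  set g : ℝ × ℝ → ℝ × ℝ := fun q => ubr a B (f q) q with hg
  have hT : ∀ n : ℕ, g^[n] p ∈ T := by
    intro n
    induction n with
    | zero => exact hp
    | succ n ih => rw [Function.iterate_succ_apply']; exact hfT _ ih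
  have hsucc : ∀ n : ℕ, (g^[n] p).2 = (g^[n + 1] p).1 := by
    intro n
    rw [Function.iterate_succ_apply', hg]; rfl
  refine ⟨fun n => (g^[n] p).1, rfl, (hsucc 0).symm, fun n => ?_, fun n => ?_⟩
  · show ((g^[n] p).1, (g^[n + 1] p).1) ∈ T
    rw [← hsucc]; exact hT n
  · have e : (g^[n + 2] p).1 = a * (g^[n] p).2 - B * (g^[n] p).1 - f (g^[n] p) + (B - 1) / 2 := by
      rw [← hsucc, Function.iterate_succ_apply']; rfl
    show |(B * (g^[n] p).1 - a * (g^[n + 1] p).1 + (g^[n + 2] p).1 : ℝ)| ≤ (B - 1) / 2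
    rw [e, ← hsucc]
    have j0 : (0 : ℝ) ≤ f (g^[n] p) := by exact_mod_cast hf0 _ (hT n)
    have j1 : (f (g^[n] p) : ℝ) + 1 ≤ B := by exact_mod_cast hf1 _ (hT n)
    rw [_root_.abs_le]
    constructor <;> linarith

theorem exists_maxima : ∃ (Q F : ℝ) (x y : ℕ → ℝ), 0 ≤ Q ∧ 0 ≤ F ∧
    (∀ p ∈ T, |p.1| ≤ Q) ∧ (∀ p ∈ T, |p.2 - 2 * p.1| ≤ F) ∧
    x 0 = Q ∧ y 1 - 2 * y 0 = F ∧ (∀ n, (x n, x (n + 1)) ∈ T) ∧ (∀ n, (y n, y (n + 1)) ∈ T) ∧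
    (∀ n, |(B * x n - a * x (n + 1) + x (n + 2) : ℝ)| ≤ (B - 1) / 2) ∧
    (∀ n, |(B * y n - a * y (n + 1) + y (n + 2) : ℝ)| ≤ (B - 1) / 2) ∧
    B * F ≤ |(B - 2 * a + 4 : ℝ)| * Q + 2 * F + (B - 1) ∧
    (2 ≤ a → B * Q ≤ (a - 2) * Q + F + (B - 1) / 2) := by
  obtain ⟨p, hp, hpm⟩ := h.isCompact.exists_isMaxOn h.nonempty
    (show ContinuousOn (fun p : ℝ × ℝ => p.1) T by fun_prop)
  obtain ⟨q, hq, hqm⟩ := h.isCompact.exists_isMaxOn h.nonempty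
    (show ContinuousOn (fun p : ℝ × ℝ => p.2 - 2 * p.1) T by fun_prop)
  obtain ⟨x, hx0, hx1, hxT, hx⟩ := h.exists_seq hp
  obtain ⟨y, hy0, hy1, hyT, hy⟩ := h.exists_seq hq
  have m1 : ∀ r ∈ T, |r.1| ≤ p.1 := fun r hr => by
    have e1 : r.1 ≤ p.1 := hpm hr
    have e2 : (-r).1 ≤ p.1 := hpm (h.neg_mem hr)
    rw [Prod.fst_neg] at e2
    exact abs_le'.2 ⟨e1, e2⟩
  have m2 : ∀ r ∈ T, |r.2 - 2 * r.1| ≤ q.2 - 2 * q.1 := fun r hr => by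
    have e1 : r.2 - 2 * r.1 ≤ q.2 - 2 * q.1 := hqm hr
    have e2 : (-r).2 - 2 * (-r).1 ≤ q.2 - 2 * q.1 := hqm (h.neg_mem hr)
    rw [Prod.fst_neg, Prod.snd_neg] at e2
    exact abs_le'.2 ⟨e1, by linarith⟩
  refine ⟨p.1, q.2 - 2 * q.1, x, y, (abs_nonneg _).trans (m1 p hp), (abs_nonneg _).trans (m2 q hq),
    m1, m2, hx0, by rw [hy0, hy1], hxT, hyT, hx, hy, ?_, fun ha => ?_⟩
  · have b1 := m1 _ (hyT 1)
    have b2 := m2 _ (hyT 1)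
    have b3 := _root_.abs_le.1 (hy 0)
    simp only [zero_add, Nat.reduceAdd] at b1 b2 b3
    have b4 := mul_le_mul_of_nonneg_left b1 (abs_nonneg (B - 2 * a + 4 : ℝ))
    rw [← abs_mul] at b4
    rw [hy0, hy1] at b3
    rw [hy1] at b2 b4
    have b5 := le_abs_self ((B - 2 * a + 4 : ℝ) * q.2)
    have b6 := le_abs_self (y 2 - 2 * q.2)
    linarith
  · have b1 := le_of_abs_le (m1 _ (hxT 1))
    have b2 := neg_le_of_abs_le (m2 _ (hxT 1))
    have b3 := _root_.abs_le.1 (hx 0)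
    have hc : (0 : ℝ) ≤ a - 2 := by exact_mod_cast (by omega : 0 ≤ a - 2)
    have b4 := mul_le_mul_of_nonneg_left b1 hc
    simp only [zero_add, Nat.reduceAdd] at b1 b2 b3 b4
    rw [hx0, hx1] at b3
    rw [hx1] at b2 b4
    linarith

theorem abs_snd_lt {c : ℝ} (hc : ∀ p ∈ T, |p.1| < c) {p : ℝ × ℝ} (hp : p ∈ T) : |p.2| < c := by
  obtain ⟨j, -, -, hj⟩ := h.exists_ubr_mem p hp
  exact hc _ hj

theorem abs_fst_lt_one (ha : 0 ≤ a) (hd : 2 * a ≤ B + 2) : ∀ p ∈ T, |p.1| < 1 := by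
  obtain ⟨Q, F, x, y, hQ, hF, bQ, bF, hx0, hy0, hxT, hyT, hx, hy, hFle, hQle⟩ := h.exists_maxima
  have hB := h.two_le
  have hBR := h.two_le_real
  suffices hlt : Q < 1 from fun p hp => (bQ p hp).trans_lt hlt
  rcases le_or_gt (2 * a) (B - 2) with hs | hs
  · have : (2 * a : ℝ) ≤ B - 2 := by exact_mod_cast hs
    have haR : (0 : ℝ) ≤ a := by exact_mod_cast ha
    have x0 := _root_.abs_le.1 (hx 0)
    have Q1 := le_of_abs_le (bQ _ (hxT 1))
    have Q2 := neg_le_of_abs_le (bQ _ (hxT 2))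
    simp only [zero_add, hx0] at x0 Q1 Q2
    have := mul_le_mul_of_nonneg_left Q1 haR
    have : B * Q ≤ a * Q + Q + (B - 1) / 2 := by linarith
    by_contra! h1
    nlinarith
  by_cases hsmall : (B = 2 ∧ a = 1) ∨ (B = 2 ∧ a = 2) ∨ (B = 3 ∧ a = 1) ∨ (B = 3 ∧ a = 2) ∨
      (B = 4 ∧ a = 2) ∨ (B = 4 ∧ a = 3) ∨ (B = 5 ∧ a = 2) ∨ (B = 5 ∧ a = 3) ∨
      (B = 6 ∧ a = 4) ∨ (B = 8 ∧ a = 5)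
  · rw [← hx0]
    exact lt_one_of_recurrence hsmall hx fun n => (bQ _ (hxT n)).trans hx0.ge
  have hB6 : (6 : ℝ) ≤ B := by exact_mod_cast (by omega : 6 ≤ B)
  have hQle := hQle (by omega)
  rw [abs_of_nonneg (by exact_mod_cast (by omega : 0 ≤ B - 2 * a + 4))] at hFle
  by_contra! h1
  set c : ℝ := B - 2 * a + 4 with hc
  have e1 : Q * (B + c) ≤ 2 * F + (B - 1) := by rw [hc]; linarith
  have e2 := mul_le_mul_of_nonneg_right e1 (by linarith : (0 : ℝ) ≤ B - 2)
  have e3 : Q * (B * (B - 2) + c * (B - 4)) ≤ B * (B - 1) := by linarith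
  have hc2 : 2 ≤ c := by
    have : (2 * a : ℝ) ≤ B + 2 := by exact_mod_cast hd
    linarith
  have e4 := mul_le_mul_of_nonneg_right h1
    (show 0 ≤ B * (B - 2) + c * (B - 4) by nlinarith)
  have e5 : c * (B - 4) ≤ B := by linarith
  have e6 : (B - 2 * a + 4) * (B - 4) ≤ B := by
    rw [hc] at e5; exact_mod_cast e5
  obtain hk | hk | hk | hk : 2 * a = B + 2 ∨ 2 * a = B + 1 ∨ 2 * a = B ∨ 2 * a = B - 1 := by omega
  all_goals
    rw [hk] at e6
    ring_nf at e6
    omega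

theorem abs_lt_of_add_three (hd : 2 * a = B + 3) :
    ∀ p ∈ T, |p.1| < 3 / 2 ∧ |p.2 - 2 * p.1| < 3 / 2 := by
  obtain ⟨Q, F, x, y, hQ, hF, bQ, bF, hx0, hy0, hxT, hyT, hx, hy, hFle, hQle⟩ := h.exists_maxima
  have hB := h.two_le
  suffices hlt : Q < 3 / 2 ∧ F < 3 / 2 from
    fun p hp => ⟨(bQ p hp).trans_lt hlt.1, (bF p hp).trans_lt hlt.2⟩
  have haB := (_root_.abs_le.1 h.abs_le).2
  by_cases hsmall : (B = 3 ∧ a = 3) ∨ (B = 5 ∧ a = 4)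
  · exact lt_of_recurrence hsmall hx0 hy0 hx hy (fun n => bQ _ (hxT n)) (fun n => bQ _ (hyT n))
      (fun n => bF _ (hxT n)) (fun n => bF _ (hyT n))
  have hB7 : (7 : ℝ) ≤ B := by exact_mod_cast (by omega : 7 ≤ B)
  have hQle := hQle (by omega)
  have hk : (a : ℝ) = (B + 3) / 2 := by
    have : (2 * a : ℝ) = B + 3 := by exact_mod_cast hd
    linarith
  rw [hk, show (B - 2 * ((B + 3) / 2) + 4 : ℝ) = 1 by ring, abs_one] at hFle
  rw [hk] at hQle
  have : F < 3 / 2 := by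
    by_contra! h1
    nlinarith
  constructor
  · nlinarith
  · exact this

theorem abs_le_of_add_four (hd : 2 * a = B + 4) : ∀ p ∈ T,
    |p.1| * (B - 2) ≤ B - 1 ∧ |p.2 - 2 * p.1| * (B - 2) ≤ B - 1 := by
  obtain ⟨Q, F, x, y, hQ, hF, bQ, bF, hx0, hy0, hxT, hyT, hx, hy, hFle, hQle⟩ := h.exists_maxima
  have hB := h.two_le
  have haB := (_root_.abs_le.1 h.abs_le).2
  have hB4 : (4 : ℝ) ≤ B := by exact_mod_cast (by omega : 4 ≤ B)
  suffices hlt : Q * (B - 2) ≤ B - 1 ∧ F * (B - 2) ≤ B - 1 from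
    fun p hp => ⟨(mul_le_mul_of_nonneg_right (bQ p hp) (by linarith)).trans hlt.1,
      (mul_le_mul_of_nonneg_right (bF p hp) (by linarith)).trans hlt.2⟩
  have hQle := hQle (by omega)
  have hk : (a : ℝ) = (B + 4) / 2 := by
    have : (2 * a : ℝ) = B + 4 := by exact_mod_cast hd
    linarith
  rw [hk, show (B - 2 * ((B + 4) / 2) + 4 : ℝ) = 0 by ring, abs_zero] at hFle
  rw [hk] at hQle
  have hF1 : F * (B - 2 : ℝ) ≤ B - 1 := by linarith
  refine ⟨?_, hF1⟩
  by_contra! h1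
  nlinarith

end IsTile

namespace IsTile
variable {a B : ℤ} {T : Set (ℝ × ℝ)} (h : IsTile a B T)
include h

theorem mem_interior_of_forall_ubr {p : ℝ × ℝ}
    (hp : ∀ m n : ℤ, ubr a B 0 p - ((m : ℝ), (n : ℝ)) ∈ T → m = 0 ∧ 0 ≤ n ∧ n < B) :
    p ∈ interior T := by
  have h1 := h.mem_interior_of_forall (S := {s | s.1 = 0 ∧ 0 ≤ s.2 ∧ s.2 < B}) hp
  rw [mem_interior]
  refine ⟨_, ?_, h.isOpen_image_br 0 isOpen_interior, ⟨_, h1, h.br_ubr 0 p⟩⟩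
  rintro _ ⟨q, hq, rfl⟩
  obtain ⟨⟨m, n⟩, ⟨hm, hn0, hn1⟩, hT⟩ := interior_subset hq
  simp only at hm hn0 hn1 hT
  rw [hm, Int.cast_zero] at hT
  have := h.br_mem n hn0 hn1 _ hT
  have e := br_add a B 0 n (q - (0, (n : ℝ)))
  rw [sub_add_cancel, zero_add] at e
  rwa [e]

/-- The interior of a tile contained in the open unit square is essentially connected. -/
theorem isPreconnected_of_abs_fst_lt_one (hQ : ∀ p ∈ T, |p.1| < 1) :
    IsConnected T ∧ ∀ z, IsPreconnected (T \ {z}) := by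
  have hB := h.two_le
  have hBR := h.two_le_real
  have hne : ∀ y ∈ Icc (0 : ℝ) (B - 1), br a B 0 (0, y) ∈ interior T := by
    intro y hy
    refine h.mem_interior_of_forall_ubr fun m n hmn => ?_
    rw [h.ubr_br] at hmn
    have h1 := abs_lt.1 (hQ _ hmn)
    have h2 := abs_lt.1 (h.abs_snd_lt hQ hmn)
    simp only [Prod.mk_sub_mk, zero_sub] at h1 h2
    refine ⟨?_, ?_, ?_⟩
    · have e1 : -1 < m := by exact_mod_cast (by linarith : (-1 : ℝ) < m)
      have e2 : m < 1 := by exact_mod_cast (by linarith : (m : ℝ) < 1)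
      omega
    · have e1 : -1 < n := by exact_mod_cast (by linarith [hy.1] : (-1 : ℝ) < n)
      omega
    · exact_mod_cast (by linarith [hy.2] : (n : ℝ) < B)
  set K : Set (ℝ × ℝ) := (fun y : ℝ => br a B 0 (0, y)) '' Icc (0 : ℝ) (B - 1) with hK
  have hKp : IsPreconnected K := isPreconnected_Icc.image _
    ((continuous_br a B 0).comp (by fun_prop : Continuous fun y : ℝ => ((0 : ℝ), y))).continuousOn
  have hKT : K ⊆ interior T := by rintro _ ⟨y, hy, rfl⟩; exact hne y hy
  have h0K : (0 : ℝ × ℝ) ∈ K := by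
    refine ⟨(B - 1) / 2, ⟨by linarith, by linarith⟩, ?_⟩
    simp [br]
  set O := connectedComponentIn (interior T) 0 with hO
  have hKO : K ⊆ O := hKp.subset_connectedComponentIn h0K hKT
  have hOo : IsOpen O := isOpen_interior.connectedComponentIn
  have hOp : IsPreconnected O := isPreconnected_connectedComponentIn
  have hOT : O ⊆ T := (connectedComponentIn_subset _ _).trans interior_subset
  have hbr0 : ∀ j : ℤ, 0 ≤ j → j < B → br a B j 0 ∈ O := by
    intro j h0 h1
    refine hKO ⟨j, ⟨by exact_mod_cast h0, ?_⟩, ?_⟩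
    · have : (j : ℝ) + 1 ≤ B := by exact_mod_cast h1
      linarith
    · have := br_add a B 0 j 0
      simp only [zero_add] at this
      exact this
  have hbr : ∀ j : ℤ, 0 ≤ j → j < B → br a B j '' O ⊆ O := by
    intro j h0 h1
    have e := connectedComponentIn_eq (hbr0 j h0 h1)
    refine subset_trans ?_ e.symm.subset
    refine (hOp.image _ (continuous_br a B j).continuousOn).subset_connectedComponentIn
      ⟨0, hKO h0K, rfl⟩ ?_
    exact interior_maximal ((image_mono hOT).trans (h.image_br_subset h0 h1))
      (h.isOpen_image_br j hOo)
  have hdense : T ⊆ closure O :=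
    h.subset_closure_of_image_br_subset (ι := Unit) (U := fun _ => O) (σ := fun _ _ => ())
      (fun _ => ⟨_, hKO h0K⟩) (fun _ => hOT) (fun _ j => hbr j) ()
  refine ⟨⟨h.nonempty, hOp.subset_closure hOT hdense⟩, fun z => ?_⟩
  refine (hOp.diff_singleton_of_isOpen hOo z).subset_closure (sdiff_subset_sdiff_left hOT) ?_
  exact sdiff_subset.trans (hdense.trans (subset_closure_diff_singleton_of_isOpen hOo z))

theorem br_diag {j : ℤ} {x : ℝ} (hx : x * (B - a + 1) = (B - 1) / 2 - j) :
    br a B j (x, x) = (x, x) := by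
  have := h.two_le_real
  have : (B : ℝ) ≠ 0 := by linarith
  simp only [br, Prod.mk.injEq, and_true]
  rw [div_eq_iff this]
  linear_combination -hx

theorem diag_mem {j : ℤ} (h0 : 0 ≤ j) (h1 : j < B) {x : ℝ}
    (hx : x * (B - a + 1) = (B - 1) / 2 - j) : ((x, x) : ℝ × ℝ) ∈ T := by
  have : ({(x, x)} : Set (ℝ × ℝ)) ⊆ T :=
    h.subset_of_exists_ubr_mem Bornology.isBounded_singleton (by
      rintro p rfl
      exact ⟨j, h0, h1, by
        nth_rewrite 2 [← h.br_diag hx]; rw [h.ubr_br]; exact mem_singleton _⟩)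
  exact this rfl

theorem exists_mem_sub_mem (ha : 2 ≤ a) : ∃ p ∈ T, p - (0, 1) ∈ T := by
  have hB := h.two_le
  have haB := (_root_.abs_le.1 h.abs_le).2
  have haBR : (a : ℝ) ≤ B := by exact_mod_cast haB
  set x : ℝ := (B - 1) / 2 / (B - a + 1) with hx
  have hx1 : x * (B - a + 1) = (B - 1) / 2 - (0 : ℤ) := by
    have : (B - a + 1 : ℝ) ≠ 0 := by linarith
    rw [hx, div_mul_cancel₀ _ this]; simp
  have hx2 : (x - 1) * (B - a + 1) = (B - 1) / 2 - (B - a + 1 : ℤ) := by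
    push_cast at hx1 ⊢; linear_combination hx1
  refine ⟨_, h.br_mem (a - 1) (by omega) (by omega) _ (h.diag_mem le_rfl (by omega) hx1), ?_⟩
  convert h.br_mem 0 le_rfl (by omega) _ (h.diag_mem (by omega) (by omega) hx2) using 1
  simp only [br, Prod.mk_sub_mk, Prod.mk.injEq, and_true]
  push_cast
  ring

theorem isConnected_of_two_le (ha : 2 ≤ a) : IsConnected T := by
  obtain ⟨p, hp, hp'⟩ := h.exists_mem_sub_mem ha
  exact h.isConnected_of_sub_mem hp hp'

end IsTile

theorem Linked.image {α β : Type*} [TopologicalSpace α] [TopologicalSpace β] {T X Y : Set α}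
    {z : α} {T' : Set β} {f : α → β} (hf : Continuous f) (hinj : Function.Injective f)
    (hT : f '' T ⊆ T') (hl : Linked T z X Y) : Linked T' (f z) (f '' X) (f '' Y) := by
  obtain ⟨C, h1, h2, h3, h4⟩ := hl
  refine ⟨f '' C, ?_, h2.image f hf.continuousOn, ?_, ?_⟩
  · rw [← image_singleton]
    exact (image_mono h1).trans ((image_sdiff hinj _ _).subset.trans (sdiff_subset_sdiff_left hT))
  · rw [← image_singleton, ← image_sdiff hinj]; exact image_mono h3
  · rw [← image_singleton, ← image_sdiff hinj]; exact image_mono h4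

namespace IsTile
variable {a B : ℤ} {T : Set (ℝ × ℝ)} (h : IsTile a B T)
include h

theorem image_br_diff (X : Set (ℝ × ℝ)) (j : ℤ) (z : ℝ × ℝ) :
    br a B j '' X \ {z} = br a B j '' (X \ {ubr a B j z}) := by
  rw [image_sdiff (h.br_injective j), image_singleton, h.br_ubr]

theorem linked_image {z : ℝ × ℝ} {j : ℤ} (h0 : 0 ≤ j) (h1 : j < B) {X X' : Set (ℝ × ℝ)}
    (hl : Linked T (ubr a B j z) X X') : Linked T z (br a B j '' X) (br a B j '' X') := by
  have := hl.image (continuous_br a B j) (h.br_injective j) (h.image_br_subset h0 h1)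
  rwa [h.br_ubr] at this

theorem linked_neg {z : ℝ × ℝ} {X X' : Set (ℝ × ℝ)} (hl : Linked T (-z) X X') :
    Linked T z (Neg.neg '' X) (Neg.neg '' X') := by
  have := hl.image (T' := T) continuous_neg neg_injective
    (by rintro _ ⟨p, hp, rfl⟩; exact h.neg_mem hp)
  rwa [neg_neg] at this

end IsTile

/-- A set `O` inside the union of the tile and its translate by `v = (0, 1)`, symmetric about
the centre of that union, which is mapped into itself by `br a B (a - 2)` and which is not
disconnected by the removal of a point of `Y`. -/
structure IsBead (a B : ℤ) (T O Y : Set (ℝ × ℝ)) : Prop where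
  ubr_mem : ∀ z ∈ Y, ∀ j, ubr a B j z ∈ Y
  neg_mem : ∀ z ∈ Y, -z ∈ Y
  subset : ∀ p ∈ O, p ∈ T ∨ p - (0, 1) ∈ T
  reflect : ∀ p ∈ O, (0, 1) - p ∈ O
  br_mem : ∀ p ∈ O, br a B (a - 2) p ∈ O
  isPreconnected : ∀ z ∈ Y, IsPreconnected (O \ {z})
  nontrivial : O.Nontrivial

namespace IsBead
variable {a B : ℤ} {T O Y : Set (ℝ × ℝ)} (hO : IsBead a B T O Y) (h : IsTile a B T)

theorem br_eq_br_succ (a B j : ℤ) (p : ℝ × ℝ) : br a B j p = br a B (j + 1) (p - (0, 1)) := by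
  rw [← br_add]; simp

include hO in
theorem image_image_subset (j : ℤ) :
    br a B j '' (br a B (a - 2) '' O) ⊆ br a B j '' O := by
  rintro _ ⟨_, ⟨p, hp, rfl⟩, rfl⟩
  exact ⟨_, hO.br_mem p hp, rfl⟩

include hO in
theorem image_succ_image_subset (j : ℤ) :
    br a B (j + 1) '' (br a B (B - a) '' O) ⊆ br a B j '' O := by
  rintro _ ⟨_, ⟨p, hp, rfl⟩, rfl⟩
  have h1 : br a B (B - a) p + (0, 1) ∈ O := by
    have h2 := hO.reflect _ (hO.br_mem _ (hO.reflect p hp))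
    have h3 : br a B (a - 2) ((0, 1) - p) = -br a B (B - a) p := by
      rw [neg_br, br_eq_br_succ]
      congr 1
      · ring
      · abel
    rw [h3, sub_neg_eq_add, add_comm] at h2
    exact h2
  refine ⟨_, h1, ?_⟩
  rw [br_eq_br_succ]; simp

include hO in
theorem nonempty_diff (z : ℝ × ℝ) : (O \ {z}).Nonempty := by
  obtain ⟨p, hp, hpz⟩ := hO.nontrivial.exists_ne z
  exact ⟨p, hp, hpz⟩

include hO in
theorem neg_image (j : ℤ) : Neg.neg '' (br a B j '' O) = br a B (B - 2 - j) '' O := by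
  have key : ∀ i : ℤ, Neg.neg '' (br a B i '' O) ⊆ br a B (B - 2 - i) '' O := by
    rintro i _ ⟨_, ⟨p, hp, rfl⟩, rfl⟩
    refine ⟨_, hO.reflect p hp, ?_⟩
    rw [neg_br, br_eq_br_succ]
    congr 1
    · ring
    · abel
  refine (key j).antisymm ?_
  have := image_mono (f := Neg.neg) (key (B - 2 - j))
  rw [image_image] at this
  simpa using this

include hO h

theorem image_subset {j : ℤ} (h0 : 0 ≤ j) (h1 : j + 1 < B) : br a B j '' O ⊆ T := by
  rintro _ ⟨p, hp, rfl⟩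
  rcases hO.subset p hp with hT | hT
  · exact h.br_mem j h0 (by omega) p hT
  · rw [br_eq_br_succ]; exact h.br_mem _ (by omega) h1 _ hT

theorem isPreconnected_image_diff {z : ℝ × ℝ} (hz : z ∈ Y) (j : ℤ) :
    IsPreconnected (br a B j '' O \ {z}) := by
  rw [h.image_br_diff]
  exact (hO.isPreconnected _ (hO.ubr_mem z hz j)).image _ (continuous_br a B j).continuousOn

theorem nonempty_image_diff (j : ℤ) (z : ℝ × ℝ) : (br a B j '' O \ {z}).Nonempty := by
  rw [h.image_br_diff]
  exact (hO.nonempty_diff _).image _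

theorem nonempty_image_image_diff (i j : ℤ) (z : ℝ × ℝ) :
    (br a B i '' (br a B j '' O) \ {z}).Nonempty := by
  rw [h.image_br_diff]
  exact (hO.nonempty_image_diff h j _).image _

theorem linked_self {z : ℝ × ℝ} (hz : z ∈ Y) {j : ℤ} (h0 : 0 ≤ j) (h1 : j + 1 < B) :
    Linked T z (br a B j '' O) (br a B j '' O) :=
  .of_isPreconnected (hO.isPreconnected_image_diff h hz j) (hO.image_subset h h0 h1)

theorem linked_of_Ioc {z : ℝ × ℝ} (hz : z ∈ Y) {l : ℤ} (hl : 0 ≤ l) (n : ℕ) (hn : l + n + 1 < B)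
    (hi : ∀ i, l < i → i ≤ l + n →
      Linked T (ubr a B i z) (br a B (B - a) '' O) (br a B (a - 2) '' O)) :
    Linked T z (br a B l '' O) (br a B (l + n) '' O) := by
  induction n with
  | zero => simpa using hO.linked_self h hz hl (by omega)
  | succ n ih =>
    push_cast at hn hi ⊢
    rw [← add_assoc] at hn hi ⊢
    have h1 := ih (by omega) fun i hi1 hi2 => hi i hi1 (by omega)
    have h2 := h.linked_image (by omega) (by omega) (hi (l + n + 1) (by omega) le_rfl)
    have h3 : Linked T z (br a B (l + n) '' O) (br a B (l + n + 1) '' (br a B (B - a) '' O)) :=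
      (hO.linked_self h hz (by omega) (by omega)).mono Subset.rfl (hO.image_succ_image_subset _)
    have h4 : Linked T z (br a B (l + n + 1) '' (br a B (a - 2) '' O))
        (br a B (l + n + 1) '' O) :=
      (hO.linked_self h hz (by omega) (by omega)).mono (hO.image_image_subset _) Subset.rfl
    exact h1.trans (hO.nonempty_image_diff h _ _) (h3.trans (hO.nonempty_image_image_diff h _ _ _)
      (h2.trans (hO.nonempty_image_image_diff h _ _ _) h4))

/-- If the two central pieces are always linked, then the tile has no cut point in `Y`. -/
theorem isPreconnected_diff (ha : 2 ≤ a)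
    (hl : ∀ z ∈ Y, Linked T z (br a B (B - a) '' O) (br a B (a - 2) '' O)) {z : ℝ × ℝ}
    (hz : z ∈ Y) : IsPreconnected (T \ {z}) := by
  have hB := h.two_le
  have haB := (_root_.abs_le.1 h.abs_le).2
  choose w hw using fun z => hO.nonempty_image_diff h 0 z
  set U : ℝ × ℝ → Set (ℝ × ℝ) := fun z => connectedComponentIn (T \ {z}) (w z) with hU
  have hwT : ∀ z, w z ∈ T \ {z} := fun z =>
    ⟨hO.image_subset h le_rfl (by omega) (hw z).1, (hw z).2⟩
  have hUT : ∀ z, U z ⊆ T \ {z} := fun z => connectedComponentIn_subset _ _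
  have hUp : ∀ z, IsPreconnected (U z) := fun z => isPreconnected_connectedComponentIn
  have hG : ∀ z ∈ Y, ∀ j, 0 ≤ j → j + 1 < B → br a B j '' O \ {z} ⊆ U z := by
    intro z hz j h0 h1
    lift j to ℕ using h0
    have := hO.linked_of_Ioc h hz le_rfl j (by omega) fun i _ _ => hl _ (hO.ubr_mem z hz i)
    rw [zero_add] at this
    obtain ⟨C, hC1, hC2, hC3, hC4⟩ := this
    exact hC4.trans (hC2.subset_connectedComponentIn (hC3 (hw z)) hC1)
  have hstep : ∀ z ∈ Y, ∀ j, 0 ≤ j → j < B → br a B j '' U (ubr a B j z) ⊆ U z := by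
    intro z hz j h0 h1
    have key : ∃ y ∈ br a B j '' U (ubr a B j z), y ∈ U z := by
      rcases lt_or_ge (j + 1) B with h2 | h2
      · obtain ⟨y, hy⟩ := hO.nonempty_image_image_diff h j (a - 2) z
        refine ⟨y, ?_, hG z hz j h0 h2 ⟨hO.image_image_subset j hy.1, hy.2⟩⟩
        rw [h.image_br_diff] at hy
        exact image_mono (hG _ (hO.ubr_mem z hz j) _ (by omega) (by omega)) hy
      · obtain ⟨y, hy⟩ := hO.nonempty_image_image_diff h j (B - a) z
        refine ⟨y, ?_, hG z hz (j - 1) (by omega) (by omega) ⟨?_, hy.2⟩⟩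
        · rw [h.image_br_diff] at hy
          exact image_mono (hG _ (hO.ubr_mem z hz j) _ (by omega) (by omega)) hy
        · have := hO.image_succ_image_subset (j - 1)
          rw [sub_add_cancel] at this
          exact this hy.1
    obtain ⟨y, hy1, hy2⟩ := key
    have e : connectedComponentIn (T \ {z}) (w z) = connectedComponentIn (T \ {z}) y :=
      connectedComponentIn_eq hy2
    refine subset_trans ?_ e.symm.subset
    refine ((hUp _).image _ (continuous_br a B j).continuousOn).subset_connectedComponentIn hy1 ?_
    refine (image_mono (hUT _)).trans ?_
    rw [← h.image_br_diff]
    exact sdiff_subset_sdiff_left (h.image_br_subset h0 h1)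
  have hdense : T ⊆ closure (U z) :=
    h.subset_closure_of_image_br_subset (ι := Y) (U := fun z => U z)
      (σ := fun j z => ⟨ubr a B j z, hO.ubr_mem z z.2 j⟩)
      (fun z => ⟨w z, mem_connectedComponentIn (hwT z)⟩)
      (fun z => (hUT z).trans sdiff_subset) (fun z j => hstep z z.2 j) ⟨z, hz⟩
  exact (hUp z).subset_closure (hUT z) (sdiff_subset.trans hdense)

end IsBead

/-- The union of the outer pieces `br a B j '' T`, `0 ≤ j ≤ B - a`, of the tile. -/
def outerPart (a B : ℤ) (T : Set (ℝ × ℝ)) : Set (ℝ × ℝ) := ⋃ j ∈ Icc 0 (B - a), br a B j '' T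

/-- The points of `Y` for which the two central pieces of the tile are not linked. -/
def badSet (a B : ℤ) (T O Y : Set (ℝ × ℝ)) : Set (ℝ × ℝ) :=
  {z | z ∈ Y ∧ ¬ Linked T z (br a B (B - a) '' O) (br a B (a - 2) '' O)}

/-- Bad points have a unique address, as far as their bad orbits are concerned. -/
def UniqueDigits (a B : ℤ) (T S : Set (ℝ × ℝ)) : Prop :=
  ∀ z ∈ S, ∀ i, B - a < i → i ≤ a - 2 → ubr a B i z ∈ S →
    ∀ j, 0 ≤ j → j < B → ubr a B j z ∈ T → j = i

namespace IsTile
variable {a B : ℤ} {T : Set (ℝ × ℝ)} (h : IsTile a B T)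
include h

theorem isPreconnected_outerPart (ha : 2 ≤ a) : IsPreconnected (outerPart a B T) := by
  obtain ⟨p, hp, hp'⟩ := h.exists_mem_sub_mem ha
  have hT := (h.isConnected_of_two_le ha).isPreconnected
  refine IsPreconnected.biUnion_of_chain ordConnected_Icc
    (fun j _ => hT.image _ (continuous_br a B j).continuousOn) fun j _ _ => ?_
  refine ⟨br a B j p, ⟨p, hp, rfl⟩, p - (0, 1), hp', ?_⟩
  rw [IsBead.br_eq_br_succ a B j]; rfl

theorem outerPart_subset (ha : 2 ≤ a) : outerPart a B T ⊆ T := by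
  refine iUnion₂_subset fun j hj => h.image_br_subset hj.1 ?_
  have := hj.2
  omega

end IsTile

namespace IsBead
variable {a B : ℤ} {T O Y : Set (ℝ × ℝ)} (hO : IsBead a B T O Y) (h : IsTile a B T)
include hO h

theorem badSet_subset (ha : 2 ≤ a) : badSet a B T O Y ⊆ T := by
  rintro z ⟨hzY, hz⟩
  have hB := h.two_le
  have haB := (_root_.abs_le.1 h.abs_le).2
  by_contra hzT
  refine hz ⟨T, (sdiff_singleton_eq_self hzT).symm.subset,
    (h.isConnected_of_two_le ha).isPreconnected, ?_, ?_⟩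
  · exact sdiff_subset.trans (hO.image_subset h (by omega) (by omega))
  · exact sdiff_subset.trans (hO.image_subset h (by omega) (by omega))

theorem exists_ubr_mem_badSet (hd : B + 2 ≤ 2 * a) {z : ℝ × ℝ} (hz : z ∈ badSet a B T O Y) :
    ∃ i, B - a < i ∧ i ≤ a - 2 ∧ ubr a B i z ∈ badSet a B T O Y := by
  have haB := (_root_.abs_le.1 h.abs_le).2
  by_contra! hcon
  obtain ⟨n, hn⟩ := Int.eq_ofNat_of_zero_le (show 0 ≤ a - 2 - (B - a) by omega)
  have e : B - a + n = a - 2 := by omega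
  have := hO.linked_of_Ioc h hz.1 (l := B - a) (by omega) n (by omega) fun i h1 h2 => by
    by_contra hl
    exact hcon i h1 (by omega) ⟨hO.ubr_mem z hz.1 i, hl⟩
  rw [e] at this
  exact hz.2 this

theorem neg_mem_badSet {z : ℝ × ℝ} (hz : z ∈ badSet a B T O Y) : -z ∈ badSet a B T O Y := by
  refine ⟨hO.neg_mem z hz.1, fun hl => hz.2 ?_⟩
  have := h.linked_neg hl
  rw [hO.neg_image, hO.neg_image, show B - 2 - (B - a) = a - 2 by ring,
    show B - 2 - (a - 2) = B - a by ring] at this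
  exact this.symm

section
variable (hd : B + 2 ≤ 2 * a) (hu : UniqueDigits a B T (badSet a B T O Y))
include hd hu

theorem mem_badSet_of_br_mem {t : ℝ × ℝ} (ht : t ∈ T) {j : ℤ} (h0 : 0 ≤ j) (h1 : j < B)
    (hb : br a B j t ∈ badSet a B T O Y) : t ∈ badSet a B T O Y ∧ B - a < j := by
  obtain ⟨i, hi0, hi1, hi⟩ := hO.exists_ubr_mem_badSet h hd hb
  have := hu _ hb i hi0 hi1 hi j h0 h1 (by rwa [h.ubr_br])
  subst this
  rw [h.ubr_br] at hi
  exact ⟨hi, hi0⟩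

theorem notMem_badSet_of_mem_outerPart (ha : 2 ≤ a) {t : ℝ × ℝ} (ht : t ∈ outerPart a B T) :
    t ∉ badSet a B T O Y := by
  simp only [outerPart, mem_iUnion₂] at ht
  obtain ⟨j, ⟨hj0, hj1⟩, t, ht, rfl⟩ := ht
  intro hb
  have := (hO.mem_badSet_of_br_mem h hd hu ht hj0 (by omega) hb).2
  omega

/-- Two neighbouring pieces touch at the tips of their outer parts, and this contact avoids
every bad point. -/
theorem linked_image_of_tip (ha : 3 ≤ a) {g : ℝ × ℝ → ℝ × ℝ} (hgc : Continuous g)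
    (hgT : ∀ t ∈ T, g t ∈ T)
    (hgb : ∀ t ∈ T, g t ∈ badSet a B T O Y → t ∈ badSet a B T O Y)
    (hgO : g '' (br a B (B - a) '' O) ⊆ br a B (B - a) '' O) {x y : ℝ × ℝ}
    (hx : x ∈ outerPart a B T) (hy : y ∈ outerPart a B T)
    (hxy : br a B (a - 2) (g x) - (0, 1) = y) {z : ℝ × ℝ} (hz : z ∈ badSet a B T O Y)
    {j : ℤ} (h0 : B - a < j) (h1 : j ≤ a - 2) :
    Linked T z (br a B j '' (br a B (a - 3) '' O)) (br a B j '' O) := by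
  have hB := h.two_le
  have haB := (_root_.abs_le.1 h.abs_le).2
  have hAT := h.outerPart_subset (by omega : 2 ≤ a)
  have hA := h.isPreconnected_outerPart (by omega : 2 ≤ a)
  have hAb : ∀ t ∈ outerPart a B T, t ∉ badSet a B T O Y := fun t =>
    hO.notMem_badSet_of_mem_outerPart h hd hu (by omega)
  have hGA : br a B (B - a) '' (br a B (a - 2) '' O) ⊆ outerPart a B T := by
    refine subset_trans ?_ (subset_biUnion_of_mem (u := fun j => br a B j '' T)
      (right_mem_Icc.2 (by omega : 0 ≤ B - a)))
    exact image_mono (hO.image_subset h (by omega) (by omega))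
  set X := br a B (j + 1) '' outerPart a B T with hX
  set W := br a B j '' (br a B (a - 2) '' (g '' outerPart a B T)) with hW
  have hXT : X ⊆ T := (image_mono hAT).trans (h.image_br_subset (by omega) (by omega))
  have hzX : z ∉ X := by
    rintro ⟨t, ht, rfl⟩
    exact hAb t ht (hO.mem_badSet_of_br_mem h hd hu (hAT ht) (by omega) (by omega) hz).1
  have hWT : W ⊆ T := by
    rintro _ ⟨_, ⟨_, ⟨t, ht, rfl⟩, rfl⟩, rfl⟩
    exact h.br_mem _ (by omega) (by omega) _ (h.br_mem _ (by omega) (by omega) _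
      (hgT _ (hAT ht)))
  have hzW : z ∉ W := by
    rintro ⟨_, ⟨_, ⟨t, ht, rfl⟩, rfl⟩, rfl⟩
    have hg := hgT _ (hAT ht)
    have e1 := (hO.mem_badSet_of_br_mem h hd hu (h.br_mem _ (by omega) (by omega) _ hg)
      (by omega) (by omega) hz).1
    have e2 := (hO.mem_badSet_of_br_mem h hd hu hg (by omega) (by omega) e1).1
    exact hAb t ht (hgb _ (hAT ht) e2)
  have hXp : IsPreconnected (X \ {z}) := by
    rw [sdiff_singleton_eq_self hzX]
    exact hA.image _ (continuous_br a B _).continuousOn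
  have hWp : IsPreconnected (W \ {z}) := by
    rw [sdiff_singleton_eq_self hzW]
    exact ((hA.image _ hgc.continuousOn).image _ (continuous_br a B _).continuousOn).image _
      (continuous_br a B _).continuousOn
  have hGj := hO.isPreconnected_image_diff h hz.1 j
  have hGjT := hO.image_subset h (j := j) (by omega) (by omega)
  have l1 : Linked T z X (br a B j '' O) := by
    obtain ⟨q, hq⟩ := hO.nonempty_image_image_diff h (B - a) (a - 2) (ubr a B (j + 1) z)
    refine Linked.of_inter hXp hGj hXT hGjT ⟨br a B (j + 1) q, ⟨⟨q, hGA hq.1, rfl⟩, ?_⟩, ?_⟩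
    · exact hO.image_succ_image_subset j ⟨q, hO.image_image_subset _ hq.1, rfl⟩
    · intro e
      exact hq.2 (by rw [mem_singleton_iff] at e ⊢; rw [← e, h.ubr_br])
  have l2 : Linked T z (br a B j '' (br a B (a - 3) '' O)) W := by
    have hp : IsPreconnected (br a B j '' (br a B (a - 3) '' O) \ {z}) := by
      rw [h.image_br_diff]
      exact (hO.isPreconnected_image_diff h (hO.ubr_mem z hz.1 j) _).image _
        (continuous_br a B j).continuousOn
    refine Linked.of_inter hp hWp ((image_mono (hO.image_subset h (by omega) (by omega))).trans
      (h.image_br_subset (by omega) (by omega))) hWT ?_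
    obtain ⟨q, hq⟩ := hO.nonempty_image_image_diff h (B - a) (a - 2) 0
    have hq' : br a B j (br a B (a - 2) (g q)) ∈ W :=
      ⟨_, ⟨_, ⟨q, hGA hq.1, rfl⟩, rfl⟩, rfl⟩
    refine ⟨br a B j (br a B (a - 2) (g q)), ⟨⟨_, ?_, rfl⟩, hq'⟩, fun e => ?_⟩
    · have e := hO.image_succ_image_subset (a - 3)
      rw [show a - 3 + 1 = a - 2 by ring] at e
      exact e ⟨g q, hgO ⟨q, hO.image_image_subset _ hq.1, rfl⟩, rfl⟩
    · rw [mem_singleton_iff] at e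
      exact hzW (e ▸ hq')
  have hyW : br a B (j + 1) y ∈ W := by
    rw [← hxy, ← br_eq_br_succ]
    exact ⟨_, ⟨_, ⟨x, hx, rfl⟩, rfl⟩, rfl⟩
  have hyX : br a B (j + 1) y ∈ X := ⟨y, hy, rfl⟩
  have hyz : br a B (j + 1) y ∉ ({z} : Set (ℝ × ℝ)) := fun e => hzX (mem_singleton_iff.1 e ▸ hyX)
  have l3 : Linked T z W X := Linked.of_inter hWp hXp hWT hXT ⟨_, ⟨hyW, hyX⟩, hyz⟩
  exact l2.trans ⟨_, hyW, hyz⟩ (l3.trans ⟨_, hyX, hyz⟩ l1)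

end

end IsBead

namespace IsBead
variable {a B : ℤ} {T O Y : Set (ℝ × ℝ)} (hO : IsBead a B T O Y) (h : IsTile a B T)
include hO h

section
variable (hu : UniqueDigits a B T (badSet a B T O Y))
include hu

theorem linked_image_image (hd : 2 * a = B + 3 ∨ 2 * a = B + 4) {z : ℝ × ℝ}
    (hz : z ∈ badSet a B T O Y) {j : ℤ} (h0 : B - a < j) (h1 : j ≤ a - 2) :
    Linked T z (br a B j '' (br a B (a - 3) '' O)) (br a B j '' O) := by
  have hB := h.two_le
  have hBR := h.two_le_real
  have hB0 : (B : ℝ) ≠ 0 := by linarith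
  have haB := (_root_.abs_le.1 h.abs_le).2
  have haBR : (a : ℝ) ≤ B := by exact_mod_cast haB
  set x : ℝ := (B - 1) / 2 / (B - a + 1) with hx
  have hx1 : x * (B - a + 1) = (B - 1) / 2 := by
    have : (B - a + 1 : ℝ) ≠ 0 := by linarith
    rw [hx, div_mul_cancel₀ _ this]
  have hx2 : (x - 2) * (B - a + 1) = (B - 1) / 2 - (2 * B - 2 * a + 2 : ℤ) := by
    push_cast; linear_combination hx1
  have hτ : ((x, x) : ℝ × ℝ) ∈ T := h.diag_mem (j := 0) le_rfl (by omega) (by simpa using hx1)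
  have hτ0 : br a B 0 (x, x) = (x, x) := h.br_diag (by simpa using hx1)
  have hτ' : ((x - 2, x - 2) : ℝ × ℝ) ∈ T := h.diag_mem (by omega) (by omega) hx2
  have hmem : ∀ t ∈ T, ∀ j, 0 ≤ j → j ≤ B - a → br a B j t ∈ outerPart a B T := fun t ht j h0 h1 =>
    mem_iUnion₂.2 ⟨j, ⟨h0, h1⟩, t, ht, rfl⟩
  have hτ2 : ((x, x) : ℝ × ℝ) ∈ outerPart a B T := by
    rw [← hτ0]; exact hmem _ hτ 0 le_rfl (by omega)
  have hy : br a B 0 (br a B 0 (x - 2, x - 2)) ∈ outerPart a B T :=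
    hmem _ (h.br_mem _ le_rfl (by omega) _ hτ') _ le_rfl (by omega)
  have htip : br a B (a - 2) (br a B (2 * a - B - 2) (x, x)) - (0, 1) =
      br a B 0 (br a B 0 (x - 2, x - 2)) := by
    simp only [br, Prod.mk_sub_mk, Prod.mk.injEq, Int.cast_zero]
    push_cast
    constructor
    · field_simp
      ring
    · field_simp
      ring
  have hle : B + 2 ≤ 2 * a := by omega
  rcases le_or_gt (2 * a - B - 2) (B - a) with h2 | h2
  · exact hO.linked_image_of_tip h hle hu (by omega) (g := id) continuous_id
      (fun _ => id) (fun _ _ => id) (by simp) (hmem _ hτ _ (by omega) h2) hy htip hz h0 h1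
  rcases eq_or_ne (2 * a - B - 2) (B - a + 1) with h3 | h3
  · refine hO.linked_image_of_tip h hle hu (by omega) (continuous_br a B (2 * a - B - 2))
      (h.br_mem _ (by omega) (by omega)) (fun t ht hb => ?_) ?_ hτ2 hy htip hz h0 h1
    · exact (hO.mem_badSet_of_br_mem h hle hu ht (by omega) (by omega) hb).1
    · rw [h3]; exact hO.image_succ_image_subset _
  obtain rfl : a = 4 := by omega
  obtain rfl : B = 4 := by omega
  have hx3 : x = 3 / 2 := by push_cast at hx1; linarith
  have hb : ∀ t ∈ T, br 4 4 1 t ∈ badSet 4 4 T O Y → t ∈ badSet 4 4 T O Y := fun t ht hb =>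
    (hO.mem_badSet_of_br_mem h hle hu ht (by omega) (by omega) hb).1
  have hgT := h.br_mem 1 (by omega) (by omega)
  refine hO.linked_image_of_tip h hle hu (by omega)
    (g := fun t => br 4 4 1 (br 4 4 1 t)) ((continuous_br 4 4 1).comp (continuous_br 4 4 1))
    (fun t ht => hgT _ (hgT _ ht)) (fun t ht hbt => hb _ ht (hb _ (hgT _ ht) hbt)) ?_ hτ2
    (y := br 4 4 0 (br 4 4 0 (br 4 4 0 (-(3 / 2), -(3 / 2))))) ?_ ?_ hz h0 h1
  · have e := hO.image_succ_image_subset 0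
    simp only [zero_add, sub_self] at e ⊢
    rw [← image_image (br 4 4 1) (br 4 4 1)]
    exact (image_mono e).trans e
  · refine hmem _ (h.br_mem 0 le_rfl (by omega) _ (h.br_mem 0 le_rfl (by omega) _ ?_)) _ le_rfl
      (by omega)
    exact h.diag_mem (j := 3) (by omega) (by omega) (by norm_num)
  · simp only [hx3, br, Prod.mk_sub_mk, Prod.mk.injEq]
    norm_num

theorem badSet_eq_empty (hd : 2 * a = B + 3 ∨ 2 * a = B + 4) : badSet a B T O Y = ∅ := by
  rw [eq_empty_iff_forall_notMem]
  have haB := (_root_.abs_le.1 h.abs_le).2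
  have key := fun {z} hz j => hO.linked_image_image h hu hd (z := z) hz (j := j)
  have hne := hO.nonempty_image_diff h
  have hne2 := hO.nonempty_image_image_diff h
  rcases hd with hd | hd
  · intro z hz
    have h1 := key hz (a - 2) (by omega) le_rfl
    have e := hO.image_succ_image_subset (B - a)
    rw [show a - 3 = B - a by omega] at h1
    rw [show B - a + 1 = a - 2 by omega] at e
    refine hz.2 (((hO.linked_self h hz.1 (by omega) (by omega)).mono Subset.rfl e).trans
      (hne2 _ _ _) h1)
  · have h1 : ∀ z ∈ badSet a B T O Y, Linked T z (br a B (a - 3) '' O) (br a B (a - 2) '' O) := by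
      intro z hz
      have h1 := key hz (a - 2) (by omega) le_rfl
      have h2 := h.linked_neg (key (hO.neg_mem_badSet h hz) (a - 3) (by omega) (by omega))
      have e : ∀ X, Neg.neg '' (br a B (a - 3) '' X) = br a B (a - 2) '' (Neg.neg '' X) := by
        intro X
        simp only [image_image, neg_br]
        rw [show B - 1 - (a - 3) = a - 2 by omega]
      rw [e, hO.neg_image, show B - 2 - (a - 3) = a - 3 by omega] at h2
      exact h2.symm.trans (hne2 _ _ _) h1
    intro z hz
    have h2 := h.linked_neg (h1 _ (hO.neg_mem_badSet h hz))
    rw [hO.neg_image, hO.neg_image, show B - 2 - (a - 3) = a - 3 by omega,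
      show B - 2 - (a - 2) = B - a by omega] at h2
    exact hz.2 (h2.symm.trans (hne _ _) (h1 z hz))

theorem isPreconnected_diff_of_uniqueDigits (hd : 2 * a = B + 3 ∨ 2 * a = B + 4) {z : ℝ × ℝ}
    (hz : z ∈ Y) : IsPreconnected (T \ {z}) := by
  have haB := (_root_.abs_le.1 h.abs_le).2
  refine hO.isPreconnected_diff h (by omega) (fun z hz => ?_) hz
  by_contra hl
  have : z ∈ badSet a B T O Y := ⟨hz, hl⟩
  rw [hO.badSet_eq_empty h hu hd] at this
  exact this

end

end IsBead

/-- The points whose coordinates are both half-integers. -/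
def halfInts : Set (ℝ × ℝ) := {p | ∃ m n : ℤ, p.1 = m + 1 / 2 ∧ p.2 = n + 1 / 2}

namespace IsTile
variable {T : Set (ℝ × ℝ)} (h : IsTile 4 4 T)
include h

theorem abs_le_four {p : ℝ × ℝ} (hp : p ∈ T) : |p.1| ≤ 3 / 2 ∧ |p.2 - 2 * p.1| ≤ 3 / 2 := by
  have := h.abs_le_of_add_four (by norm_num) p hp
  push_cast at this
  constructor <;> linarith [this.1, this.2]

theorem abs_snd_le_four {p : ℝ × ℝ} (hp : p ∈ T) : |p.2| ≤ 3 / 2 := by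
  obtain ⟨j, -, -, hj⟩ := h.exists_ubr_mem p hp
  exact (h.abs_le_four hj).1

theorem eq_of_three_half_le {p : ℝ × ℝ} (hp : p ∈ T) (h1 : 3 / 2 ≤ |p.1|) :
    p = (3 / 2, 3 / 2) ∨ p = (-(3 / 2), -(3 / 2)) := by
  have e1 := _root_.abs_le.1 (h.abs_le_four hp).1
  have e2 := _root_.abs_le.1 (h.abs_le_four hp).2
  have e3 := _root_.abs_le.1 (h.abs_snd_le_four hp)
  rcases le_abs'.1 h1 with h2 | h2
  · right; ext <;> simp only <;> linarith
  · left; ext <;> simp only <;> linarith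

theorem fst_eq_snd_of_mem_halfInts {p : ℝ × ℝ} (hp : p ∈ T) (hL : p ∈ halfInts) :
    p.1 = p.2 := by
  obtain ⟨m, n, hm, hn⟩ := hL
  obtain ⟨j, hj0, hj1, hj⟩ := h.exists_ubr_mem p hp
  have e := _root_.abs_le.1 (h.abs_snd_le_four hj)
  simp only [ubr, hm, hn] at e
  push_cast at e
  have e1 : n - m ≤ 0 := by
    by_contra! hc
    have hc' : (m : ℝ) + 1 ≤ n := by exact_mod_cast (by omega : m + 1 ≤ n)
    have : (j : ℝ) + 1 ≤ 4 := by exact_mod_cast hj1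
    linarith
  have e2 : 0 ≤ n - m := by
    by_contra! hc
    have hc' : (n : ℝ) + 1 ≤ m := by exact_mod_cast (by omega : n + 1 ≤ m)
    have : (0 : ℝ) ≤ j := by exact_mod_cast hj0
    linarith
  rw [hm, hn, show n = m by omega]

end IsTile

namespace IsBead
variable {a B : ℤ} {T O Y : Set (ℝ × ℝ)} (hO : IsBead a B T O Y) (h : IsTile a B T)
include hO h

theorem uniqueDigits_of_abs_sub_lt (hd : B + 2 ≤ 2 * a)
    (hlt : ∀ q ∈ badSet a B T O Y, ∀ s ∈ T, |q.1 - s.1| < 2) :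
    UniqueDigits a B T (badSet a B T O Y) := by
  intro z hz i hi0 hi1 hi j hj0 hj1 hj
  obtain ⟨i', hi0', hi1', hi'⟩ := hO.exists_ubr_mem_badSet h hd hi
  obtain ⟨i'', hi0'', hi1'', hi''⟩ := hO.exists_ubr_mem_badSet h hd hi'
  obtain ⟨j', hj0', hj1', hj'⟩ := h.exists_ubr_mem _ hj
  obtain ⟨j'', hj0'', hj1'', hj''⟩ := h.exists_ubr_mem _ hj'
  have e1 := hlt _ hi' _ hj'
  have e2 := hlt _ hi'' _ hj''
  simp only [ubr] at e1 e2
  have f1 : |j - i| < 2 := by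
    have : |((j - i : ℤ) : ℝ)| < 2 := by
      convert e1 using 2
      push_cast
      ring
    exact_mod_cast this
  have f2 : |a * (j - i) + j' - i'| < 2 := by
    have : |((a * (j - i) + j' - i' : ℤ) : ℝ)| < 2 := by
      convert e2 using 2
      push_cast
      ring
    exact_mod_cast this
  rw [abs_lt] at f1 f2
  have hm : j - i = -1 ∨ j - i = 0 ∨ j - i = 1 := by omega
  rcases hm with hm | hm | hm <;> rw [hm] at f2 <;> omega

theorem smul_mem_of_mem_badSet (hd : B + 2 ≤ 2 * a) (ha : 2 ≤ a) {c : ℝ}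
    (hc : ∀ i, B - a < i → i ≤ a - 2 → ∃ j : ℤ, 0 ≤ j ∧ j < B ∧
      ((B : ℝ) - 1) / 2 - j = c * ((B - 1) / 2 - i)) {z : ℝ × ℝ}
    (hz : z ∈ badSet a B T O Y) : c • z ∈ T := by
  have hb : (fun q : ℝ × ℝ => c • q) '' badSet a B T O Y ⊆ T := by
    apply h.subset_of_exists_ubr_mem
    · refine ((h.isCompact.image (continuous_const_smul c)).isBounded).subset ?_
      exact image_mono (hO.badSet_subset h ha)
    · rintro _ ⟨q, hq, rfl⟩
      obtain ⟨i, hi0, hi1, hi⟩ := hO.exists_ubr_mem_badSet h hd hq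
      obtain ⟨j, hj0, hj1, hj⟩ := hc i hi0 hi1
      refine ⟨j, hj0, hj1, _, hi, ?_⟩
      simp only [ubr, Prod.smul_mk, Prod.smul_fst, Prod.smul_snd, smul_eq_mul, Prod.mk.injEq,
        true_and]
      linear_combination -hj
  exact hb ⟨z, hz, rfl⟩

theorem abs_fst_lt_of_mem_badSet (hd : 2 * a = B + 3) {z : ℝ × ℝ}
    (hz : z ∈ badSet a B T O Y) : |z.1| < 1 / 2 := by
  have haB := (_root_.abs_le.1 h.abs_le).2
  have hdR : 2 * (a : ℝ) = B + 3 := by exact_mod_cast hd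
  have hm := hO.smul_mem_of_mem_badSet h (by omega) (by omega) (c := 3) (fun i hi0 hi1 =>
    ⟨a - 2, by omega, by omega, by
      rw [show i = a - 2 by omega]; push_cast; linarith⟩) hz
  have := (h.abs_lt_of_add_three hd _ hm).1
  rw [Prod.smul_fst, smul_eq_mul, abs_mul, abs_of_pos (by norm_num : (0 : ℝ) < 3)] at this
  linarith

theorem abs_fst_mul_le_of_mem_badSet (hd : 2 * a = B + 4) {z : ℝ × ℝ}
    (hz : z ∈ badSet a B T O Y) : |z.1| * (B - 2) ≤ 1 := by
  have haB := (_root_.abs_le.1 h.abs_le).2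
  have hBR := h.two_le_real
  have hdR : 2 * (a : ℝ) = B + 4 := by exact_mod_cast hd
  have hm := hO.smul_mem_of_mem_badSet h (by omega) (by omega) (c := B - 1) (fun i hi0 hi1 => by
    rcases (by omega : i = a - 3 ∨ i = a - 2) with rfl | rfl
    · refine ⟨0, by omega, by omega, ?_⟩
      push_cast
      linear_combination ((B : ℝ) - 1) / 2 * hdR
    · refine ⟨B - 1, by omega, by omega, ?_⟩
      push_cast
      linear_combination ((B : ℝ) - 1) / 2 * hdR) hz
  have := (h.abs_le_of_add_four hd _ hm).1
  rw [Prod.smul_fst, smul_eq_mul, abs_mul, abs_of_pos (by linarith : (0 : ℝ) < B - 1),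
    mul_assoc] at this
  exact (mul_le_iff_le_one_right (by linarith)).1 this

theorem uniqueDigits_of_ne_four (hd : 2 * a = B + 3 ∨ 2 * a = B + 4 ∧ B ≠ 4) :
    UniqueDigits a B T (badSet a B T O Y) := by
  have haB := (_root_.abs_le.1 h.abs_le).2
  refine hO.uniqueDigits_of_abs_sub_lt h (by omega) fun q hq s hs => ?_
  refine (abs_sub _ _).trans_lt ?_
  rcases hd with hd | ⟨hd, h4⟩
  · linarith [hO.abs_fst_lt_of_mem_badSet h hd hq, (h.abs_lt_of_add_three hd s hs).1]
  · have h1 := hO.abs_fst_mul_le_of_mem_badSet h hd hq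
    have h2 := (h.abs_le_of_add_four hd s hs).1
    have h6 : (6 : ℝ) ≤ B := by exact_mod_cast (by omega : 6 ≤ B)
    by_contra! hc
    nlinarith

end IsBead

theorem IsBead.uniqueDigits_four {T O Y : Set (ℝ × ℝ)} (hO : IsBead 4 4 T O Y)
    (h : IsTile 4 4 T) (hY : ∀ z ∈ Y, ∀ j, ubr 4 4 j z ∈ halfInts → z ∈ halfInts) :
    UniqueDigits 4 4 T (badSet 4 4 T O Y) := by
  intro z hz i hi0 hi1 hi j hj0 hj1 hj
  obtain ⟨i', hi0', hi1', hi'⟩ := hO.exists_ubr_mem_badSet h (by norm_num) hi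
  obtain ⟨i'', hi0'', hi1'', hi''⟩ := hO.exists_ubr_mem_badSet h (by norm_num) hi'
  obtain ⟨j', hj0', hj1', hj'⟩ := h.exists_ubr_mem _ hj
  obtain ⟨j'', hj0'', hj1'', hj''⟩ := h.exists_ubr_mem _ hj'
  have hS : ∀ q ∈ badSet 4 4 T O Y, |q.1| ≤ 1 / 2 := fun q hq => by
    have := hO.abs_fst_mul_le_of_mem_badSet h (by norm_num) hq
    push_cast at this
    linarith
  set p₁ := ubr 4 4 i z with hp₁
  set t₁ := ubr 4 4 j z with ht₁
  set p₂ := ubr 4 4 i' p₁ with hp₂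
  set t₂ := ubr 4 4 j' t₁ with ht₂
  set p₃ := ubr 4 4 i'' p₂ with hp₃
  set t₃ := ubr 4 4 j'' t₂ with ht₃
  have e1 : p₂.1 - t₂.1 = (j - i : ℤ) := by
    simp only [hp₂, ht₂, hp₁, ht₁, ubr]; push_cast; ring
  have e2 : p₃.1 - t₃.1 = (4 * (j - i) + j' - i' : ℤ) := by
    simp only [hp₃, ht₃, hp₂, ht₂, hp₁, ht₁, ubr]; push_cast; ring
  have e3 : p₃.2 - t₃.2 = (4 * (4 * (j - i) + j' - i') - 4 * (j - i) + j'' - i'' : ℤ) := by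
    simp only [hp₃, ht₃, hp₂, ht₂, hp₁, ht₁, ubr]; push_cast; ring
  have b1 := hS _ hi'
  have b2 := (h.abs_le_four hj').1
  have b3 := hS _ hi''
  have b4 := (h.abs_le_four hj'').1
  have f1 : |j - i| ≤ 2 := by
    have : |((j - i : ℤ) : ℝ)| ≤ 2 := by
      rw [← e1]; exact (abs_sub _ _).trans (by linarith)
    exact_mod_cast this
  have f2 : |4 * (j - i) + j' - i'| ≤ 2 := by
    have : |((4 * (j - i) + j' - i' : ℤ) : ℝ)| ≤ 2 := by
      rw [← e2]; exact (abs_sub _ _).trans (by linarith)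
    exact_mod_cast this
  rw [_root_.abs_le] at f1 f2
  by_contra hne
  have f3 : 2 ≤ |4 * (j - i) + j' - i'| := by
    rw [le_abs']; omega
  have f4 : (2 : ℝ) ≤ |p₃.1 - t₃.1| := by rw [e2]; exact_mod_cast f3
  have f5 := f4.trans (abs_sub _ _)
  have ht : t₃ ∈ halfInts := by
    rcases h.eq_of_three_half_le hj'' (by linarith) with e | e <;> rw [e]
    · exact ⟨1, 1, by norm_num, by norm_num⟩
    · exact ⟨-2, -2, by norm_num, by norm_num⟩
  have hp : p₃ ∈ halfInts := by
    obtain ⟨m, n, hm, hn⟩ := ht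
    refine ⟨m + (4 * (j - i) + j' - i'),
      n + (4 * (4 * (j - i) + j' - i') - 4 * (j - i) + j'' - i''), ?_, ?_⟩
    · rw [Int.cast_add, ← e2, hm]; ring
    · rw [Int.cast_add, ← e3, hn]; ring
  have hp1 : p₁ ∈ halfInts := hY _ hi.1 _ (hY _ hi'.1 _ hp)
  obtain ⟨m, n, hm, hn⟩ := hY _ hz.1 _ hp1
  have ht1 : t₁ ∈ halfInts := by
    refine ⟨n, 4 * n - 4 * m - j + 1, ?_, ?_⟩
    · simp only [ht₁, ubr, hn]
    · simp only [ht₁, ubr, hn, hm]; push_cast; ring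
  have g1 := h.fst_eq_snd_of_mem_halfInts (hO.badSet_subset h (by norm_num) hi) hp1
  have g2 := h.fst_eq_snd_of_mem_halfInts hj ht1
  have g3 : p₁.1 = t₁.1 := rfl
  have g4 : p₁.2 - t₁.2 = (j - i : ℤ) := by
    simp only [hp₁, ht₁, ubr]; push_cast; ring
  have : ((j - i : ℤ) : ℝ) = 0 := by rw [← g4, ← g1, ← g2, g3, sub_self]
  have : j - i = 0 := by exact_mod_cast this
  omega

/-- The interior of the union of the tile and its translate by `v = (0, 1)`. -/
def pairInterior (T : Set (ℝ × ℝ)) : Set (ℝ × ℝ) := interior {p | p ∈ T ∨ p - (0, 1) ∈ T}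

theorem isOpen_pairInterior (T : Set (ℝ × ℝ)) : IsOpen (pairInterior T) := isOpen_interior

theorem mem_or_mem_of_mem_pairInterior {T : Set (ℝ × ℝ)} {p : ℝ × ℝ} (hp : p ∈ pairInterior T) :
    p ∈ T ∨ p - (0, 1) ∈ T :=
  interior_subset (s := {p | p ∈ T ∨ p - (0, 1) ∈ T}) hp

namespace IsTile
variable {a B : ℤ} {T : Set (ℝ × ℝ)} (h : IsTile a B T)
include h

theorem mem_pairInterior_of_forall_ubr {p : ℝ × ℝ}
    (hp : ∀ m n : ℤ, ubr a B 0 p - ((m : ℝ), (n : ℝ)) ∈ T →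
      m = 0 ∧ 0 ≤ n ∧ n < B ∨ m = 1 ∧ a ≤ n ∧ n < a + B) : p ∈ pairInterior T := by
  have h1 := h.mem_interior_of_forall
    (S := {s | s.1 = 0 ∧ 0 ≤ s.2 ∧ s.2 < B ∨ s.1 = 1 ∧ a ≤ s.2 ∧ s.2 < a + B}) hp
  rw [pairInterior, mem_interior]
  refine ⟨_, ?_, h.isOpen_image_br 0 isOpen_interior, ⟨_, h1, h.br_ubr 0 p⟩⟩
  rintro _ ⟨q, hq, rfl⟩
  obtain ⟨⟨m, n⟩, ⟨hm, hn0, hn1⟩ | ⟨hm, hn0, hn1⟩, hT⟩ := interior_subset hq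
  · simp only at hm hn0 hn1 hT
    left
    rw [hm, Int.cast_zero] at hT
    have := h.br_mem n hn0 hn1 _ hT
    have e := br_add a B 0 n (q - (0, (n : ℝ)))
    rw [sub_add_cancel, zero_add] at e
    rwa [e]
  · simp only at hm hn0 hn1 hT
    right
    rw [hm, Int.cast_one] at hT
    convert h.br_mem (n - a) (by omega) (by omega) _ hT using 1
    simp only [br, Prod.mk_sub_mk, Prod.fst_sub, Prod.snd_sub, Prod.mk.injEq, and_true]
    push_cast
    ring

theorem image_br_subset_pairInterior {j : ℤ} (h0 : 0 ≤ j) (h1 : j + 1 < B) {X : Set (ℝ × ℝ)}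
    (hX : X ⊆ pairInterior T) : br a B j '' X ⊆ pairInterior T := by
  refine (image_mono hX).trans (interior_maximal ?_ (h.isOpen_image_br j isOpen_interior))
  rintro _ ⟨p, hp, rfl⟩
  left
  rcases interior_subset hp with hT | hT
  · exact h.br_mem j h0 (by omega) p hT
  · rw [IsBead.br_eq_br_succ]; exact h.br_mem _ (by omega) h1 _ hT

theorem reflect_subset_pairInterior {X : Set (ℝ × ℝ)} (hX : X ⊆ pairInterior T) :
    (fun p => (0, 1) - p) '' X ⊆ pairInterior T := by
  rintro _ ⟨p, hp, rfl⟩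
  have : (fun p : ℝ × ℝ => (0, 1) - p) ⁻¹' pairInterior T ⊆ {p | p ∈ T ∨ p - (0, 1) ∈ T} := by
    intro q hq
    rcases interior_subset hq with hT | hT
    · right; simpa using h.neg_mem hT
    · left; simpa using h.neg_mem hT
  refine interior_maximal this ((isOpen_pairInterior T).preimage (by fun_prop)) ?_
  simpa using hX hp

/-- An invariant connected open set `P` whose closure contains the centre of reflection gives
rise to a bead. -/
theorem isBead_of_isOpen {P Y : Set (ℝ × ℝ)} (hPo : IsOpen P) (hPc : IsPreconnected P)
    (hPT : ∀ p ∈ P, p ∈ T ∨ p - (0, 1) ∈ T) (hbr : ∀ p ∈ P, br a B (a - 2) p ∈ P)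
    (hbr' : ∀ p ∈ P, br a B (a - 2) ((0, 1) - p) ∈ P) (hYu : ∀ z ∈ Y, ∀ j, ubr a B j z ∈ Y)
    (hYn : ∀ z ∈ Y, -z ∈ Y) (hYr : ∀ z ∈ Y, (0, 1) - z ∈ Y)
    (hYb : ∀ z ∉ Y, br a B (a - 2) z ∉ Y) (hβ : ((0, 1 / 2) : ℝ × ℝ) ∈ closure P)
    (hβY : ((0, 1 / 2) : ℝ × ℝ) ∈ P ∨ ((0, 1 / 2) : ℝ × ℝ) ∉ Y) : ∃ O, IsBead a B T O Y := by
  set r : ℝ × ℝ → ℝ × ℝ := fun p => (0, 1) - p with hr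
  have hrc : Continuous r := by fun_prop
  have hrr : ∀ p, r (r p) = p := fun p => sub_sub_cancel _ _
  have hYr' : ∀ z ∉ Y, r z ∉ Y := fun z hz hz' => hz (by rw [← hrr z]; exact hYr _ hz')
  set Q : Set (ℝ × ℝ) := P ∪ closure P \ Y with hQ
  have hPQ : P ⊆ Q := subset_union_left
  have hQP : Q ⊆ closure P := union_subset subset_closure sdiff_subset
  have hcl : ∀ {g : ℝ × ℝ → ℝ × ℝ}, Continuous g → (∀ p ∈ P, g p ∈ P) →
      (∀ z ∉ Y, g z ∉ Y) → ∀ p ∈ Q, g p ∈ Q := by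
    rintro g hg hgP hgY p (hp | hp)
    · exact Or.inl (hgP p hp)
    · exact Or.inr ⟨map_mem_closure hg hp.1 hgP, hgY p hp.2⟩
  have hQbr := hcl (continuous_br a B (a - 2)) hbr hYb
  have hQbr' := hcl (g := fun p => br a B (a - 2) (r p)) ((continuous_br a B (a - 2)).comp hrc)
    hbr' fun z hz => hYb _ (hYr' z hz)
  have hTc : IsClosed {p | p ∈ T ∨ p - (0, 1) ∈ T} :=
    h.isCompact.isClosed.union (h.isCompact.isClosed.preimage (by fun_prop))
  have hQT : ∀ p ∈ Q, p ∈ T ∨ p - (0, 1) ∈ T := fun p hp =>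
    closure_minimal (s := P) hPT hTc (hQP hp)
  have hQz : ∀ z, IsPreconnected (Q \ {z}) := fun z =>
    (hPc.diff_singleton_of_isOpen hPo z).subset_closure (sdiff_subset_sdiff_left hPQ)
      (sdiff_subset.trans (hQP.trans (subset_closure_diff_singleton_of_isOpen hPo z)))
  have hβQ : ((0, 1 / 2) : ℝ × ℝ) ∈ Q := hβY.imp id fun hn => ⟨hβ, hn⟩
  have hrβ : r (0, 1 / 2) = (0, 1 / 2) := by simp only [hr, Prod.mk_sub_mk]; norm_num
  have hrinj : Function.Injective r := Function.LeftInverse.injective hrr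
  have hPne : P.Nonempty := closure_nonempty_iff.1 ⟨_, hβ⟩
  have hQr : ∀ z ∈ Y, (Q \ {z} ∩ (r '' Q \ {z})).Nonempty := by
    intro z hz
    rcases hβY with hP | hn
    · have hop : IsOpen (P ∩ r ⁻¹' P) := hPo.inter (hPo.preimage hrc)
      have hm : ((0, 1 / 2) : ℝ × ℝ) ∈ P ∩ r ⁻¹' P := ⟨hP, by rw [mem_preimage, hrβ]; exact hP⟩
      obtain ⟨q, hq⟩ := closure_nonempty_iff.1
        ⟨_, subset_closure_diff_singleton_of_isOpen hop z (subset_closure hm)⟩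
      exact ⟨q, ⟨hPQ hq.1.1, hq.2⟩, ⟨r q, hPQ hq.1.2, hrr q⟩, hq.2⟩
    · have hne : ((0, 1 / 2) : ℝ × ℝ) ∉ ({z} : Set (ℝ × ℝ)) := by
        rintro rfl; exact hn hz
      exact ⟨_, ⟨hβQ, hne⟩, ⟨_, hβQ, hrβ⟩, hne⟩
  refine ⟨Q ∪ r '' Q, ?_⟩
  constructor
  · exact hYu
  · exact hYn
  · rintro _ (hp | ⟨p, hp, rfl⟩)
    · exact hQT _ hp
    · rcases hQT p hp with hT | hT
      · right; simpa [hr] using h.neg_mem hT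
      · left; simpa [hr] using h.neg_mem hT
  · rintro _ (hp | ⟨p, hp, rfl⟩)
    · exact Or.inr ⟨_, hp, rfl⟩
    · left
      change r (r p) ∈ Q
      rwa [hrr]
  · rintro _ (hp | ⟨p, hp, rfl⟩)
    · exact Or.inl (hQbr _ hp)
    · exact Or.inl (hQbr' _ hp)
  · intro z hz
    rw [union_sdiff_distrib]
    obtain ⟨q, hq1, hq2⟩ := hQr z hz
    refine (hQz z).union q hq1 hq2 ?_
    rw [show r '' Q \ {z} = r '' (Q \ {r z}) by rw [image_sdiff hrinj, image_singleton, hrr]]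
    exact (hQz _).image _ hrc.continuousOn
  · obtain ⟨p, hp⟩ := hPne
    obtain ⟨q, hq⟩ := closure_nonempty_iff.1
        ⟨_, subset_closure_diff_singleton_of_isOpen hPo p (subset_closure hp)⟩
    exact ⟨p, Or.inl (hPQ hp), q, Or.inl (hPQ hq.1), fun e => hq.2 e.symm⟩

end IsTile

namespace IsTile
variable {a B : ℤ} {T : Set (ℝ × ℝ)} (h : IsTile a B T)
include h

theorem exists_isBead_univ (ha : 3 ≤ a) (hT1 : ∀ p ∈ T, |p.1| < 3 / 2)
    (hT2 : ∀ p ∈ T, |p.2 - 2 * p.1| < 3 / 2) : ∃ O, IsBead a B T O univ := by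
  have hB := h.two_le
  have hBR := h.two_le_real
  have hB0 : (B : ℝ) ≠ 0 := by linarith
  have haB := (_root_.abs_le.1 h.abs_le).2
  have haBR : (a : ℝ) ≤ B := by exact_mod_cast haB
  have haR : (3 : ℝ) ≤ a := by exact_mod_cast ha
  have hT3 : ∀ p ∈ T, |p.2| < 3 / 2 := fun p => h.abs_snd_lt hT1
  have leg1 : ∀ x ∈ Icc (0 : ℝ) (1 / 2), br a B 0 (x, a - 3 / 2 + 2 * x) ∈ pairInterior T := by
    rintro x ⟨hx0, hx1⟩
    refine h.mem_pairInterior_of_forall_ubr fun m n hmn => ?_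
    rw [h.ubr_br] at hmn
    have e1 := abs_lt.1 (hT1 _ hmn)
    have e2 := abs_lt.1 (hT2 _ hmn)
    have e3 := abs_lt.1 (hT3 _ hmn)
    simp only [Prod.mk_sub_mk] at e1 e2 e3
    have f1 : -2 < m := by exact_mod_cast (by linarith : (-2 : ℝ) < m)
    have f2 : m < 2 := by exact_mod_cast (by linarith : (m : ℝ) < 2)
    have f3 : a - 3 < n - 2 * m := by exact_mod_cast (by linarith : (a : ℝ) - 3 < n - 2 * m)
    have f4 : n - 2 * m < a := by exact_mod_cast (by linarith : (n : ℝ) - 2 * m < a)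
    have f5 : a - 3 < n := by exact_mod_cast (by linarith : (a : ℝ) - 3 < n)
    omega
  have leg2 : ∀ y ∈ Icc ((a : ℝ) - 1 / 2) ((a + B - 1) / 2),
      br a B 0 (1 / 2, y) ∈ pairInterior T := by
    rintro y ⟨hy0, hy1⟩
    refine h.mem_pairInterior_of_forall_ubr fun m n hmn => ?_
    rw [h.ubr_br] at hmn
    have e1 := abs_lt.1 (hT1 _ hmn)
    have e2 := abs_lt.1 (hT2 _ hmn)
    have e3 := abs_lt.1 (hT3 _ hmn)
    simp only [Prod.mk_sub_mk] at e1 e2 e3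
    have f1 : -1 < m := by exact_mod_cast (by linarith : (-1 : ℝ) < m)
    have f2 : m < 2 := by exact_mod_cast (by linarith : (m : ℝ) < 2)
    rcases (by omega : m = 0 ∨ m = 1) with rfl | rfl
    · left
      push_cast at e1 e2 e3
      have f3 : a - 2 < n := by exact_mod_cast (by linarith : (a : ℝ) - 2 < n)
      have f4 : n < B := by exact_mod_cast (by linarith : (n : ℝ) < B)
      omega
    · right
      push_cast at e1 e2 e3
      have f3 : a - 1 < n := by exact_mod_cast (by linarith : (a : ℝ) - 1 < n)
      have f4 : n < a + B := by exact_mod_cast (by linarith : (n : ℝ) < a + B)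
      omega
  set K₁ := (fun x : ℝ => br a B 0 (x, a - 3 / 2 + 2 * x)) '' Icc (0 : ℝ) (1 / 2) with hK₁
  set K₂ := (fun y : ℝ => br a B 0 (1 / 2, y)) '' Icc ((a : ℝ) - 1 / 2) ((a + B - 1) / 2) with hK₂
  have hKc : IsPreconnected (K₁ ∪ K₂) := by
    refine IsPreconnected.union (br a B 0 (1 / 2, a - 1 / 2)) ?_ ?_
      (isPreconnected_Icc.image _ ?_) (isPreconnected_Icc.image _ ?_)
    · exact ⟨1 / 2, ⟨by norm_num, le_rfl⟩, congrArg (br a B 0) (Prod.ext rfl (by simp only; ring))⟩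
    · exact ⟨a - 1 / 2, ⟨le_rfl, by linarith⟩, rfl⟩
    · exact ((continuous_br a B 0).comp (by fun_prop)).continuousOn
    · exact ((continuous_br a B 0).comp (by fun_prop)).continuousOn
  have hKΩ : K₁ ∪ K₂ ⊆ pairInterior T := by
    rintro _ (⟨x, hx, rfl⟩ | ⟨y, hy, rfl⟩)
    · exact leg1 x hx
    · exact leg2 y hy
  have hβK : ((0, 1 / 2) : ℝ × ℝ) ∈ K₁ ∪ K₂ := by
    refine Or.inr ⟨(a + B - 1) / 2, ⟨by linarith, le_rfl⟩, ?_⟩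
    simp only [br, Prod.mk.injEq, and_true]
    push_cast
    rw [div_eq_zero_iff]
    left
    ring
  have hαK : br a B (a - 2) (0, 1 / 2) ∈ K₁ ∪ K₂ := by
    refine Or.inl ⟨0, ⟨le_rfl, by norm_num⟩, ?_⟩
    simp only [br, Prod.mk.injEq, and_true]
    push_cast
    ring
  set P := connectedComponentIn (pairInterior T) (0, 1 / 2) with hP
  have hKP : K₁ ∪ K₂ ⊆ P := hKc.subset_connectedComponentIn hβK hKΩ
  have hPo : IsOpen P := (isOpen_pairInterior T).connectedComponentIn
  have hPc : IsPreconnected P := isPreconnected_connectedComponentIn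
  have hPΩ : P ⊆ pairInterior T := connectedComponentIn_subset _ _
  have hPb : br a B (a - 2) '' P ⊆ P := by
    have e := connectedComponentIn_eq (hKP hαK)
    refine subset_trans ?_ e.symm.subset
    exact (hPc.image _ (continuous_br a B _).continuousOn).subset_connectedComponentIn
      ⟨_, hKP hβK, rfl⟩ (h.image_br_subset_pairInterior (by omega) (by omega) hPΩ)
  have hPr : (fun p : ℝ × ℝ => (0, 1) - p) '' P ⊆ P := by
    refine (hPc.image _ (by fun_prop)).subset_connectedComponentIn ⟨_, hKP hβK, ?_⟩
      (h.reflect_subset_pairInterior hPΩ)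
    simp only [Prod.mk_sub_mk, sub_zero, Prod.mk.injEq, true_and]
    norm_num
  exact h.isBead_of_isOpen hPo hPc (fun p hp => mem_or_mem_of_mem_pairInterior (hPΩ hp))
    (fun p hp => hPb ⟨p, hp, rfl⟩) (fun p hp => hPb ⟨_, hPr ⟨p, hp, rfl⟩, rfl⟩)
    (fun _ _ _ => mem_univ _) (fun _ _ => mem_univ _) (fun _ _ => mem_univ _)
    (fun z hz => absurd (mem_univ z) hz) (subset_closure (hKP hβK)) (Or.inl (hKP hβK))

/-- There are no cut points when `2 * a - B` is `3` or `4`, apart from one exceptional case. -/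
theorem isPreconnected_diff_of_ne_four (hd : 2 * a = B + 3 ∨ 2 * a = B + 4 ∧ B ≠ 4)
    (z : ℝ × ℝ) : IsPreconnected (T \ {z}) := by
  have haB := (_root_.abs_le.1 h.abs_le).2
  have hB := h.two_le
  have hbd : ∀ p ∈ T, |p.1| < 3 / 2 ∧ |p.2 - 2 * p.1| < 3 / 2 := by
    rcases hd with hd | ⟨hd, h4⟩
    · exact h.abs_lt_of_add_three hd
    · intro p hp
      have h6 : (6 : ℝ) ≤ B := by exact_mod_cast (by omega : 6 ≤ B)
      have := h.abs_le_of_add_four hd p hp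
      constructor <;> by_contra! hc <;> nlinarith [this.1, this.2]
  obtain ⟨O, hO⟩ := h.exists_isBead_univ (by omega) (fun p hp => (hbd p hp).1)
    (fun p hp => (hbd p hp).2)
  exact hO.isPreconnected_diff_of_uniqueDigits h (hO.uniqueDigits_of_ne_four h hd) (by omega)
    (mem_univ z)

end IsTile

/-- The points whose orbit under the expanding maps for `a = B = 4` meets the half-integers. -/
inductive MeetsHalfInts : ℝ × ℝ → Prop
  | of_mem {z : ℝ × ℝ} : z ∈ halfInts → MeetsHalfInts z
  | of_ubr {z : ℝ × ℝ} (j : ℤ) : MeetsHalfInts (ubr 4 4 j z) → MeetsHalfInts z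

theorem ubr_mem_halfInts {z : ℝ × ℝ} (hz : z ∈ halfInts) (j : ℤ) : ubr 4 4 j z ∈ halfInts := by
  obtain ⟨m, n, hm, hn⟩ := hz
  refine ⟨n, 4 * n - 4 * m - j + 1, hn, ?_⟩
  simp only [ubr, hm, hn]
  push_cast
  ring

theorem sub_mem_halfInts {z : ℝ × ℝ} (hz : z ∈ halfInts) (m n : ℤ) :
    ((m : ℝ), (n : ℝ)) - z ∈ halfInts := by
  obtain ⟨k, l, hk, hl⟩ := hz
  refine ⟨m - k - 1, n - l - 1, ?_, ?_⟩
  · simp only [Prod.fst_sub, hk]; push_cast; ring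
  · simp only [Prod.snd_sub, hl]; push_cast; ring

theorem MeetsHalfInts.sub {z : ℝ × ℝ} (hz : MeetsHalfInts z) :
    ∀ m n : ℤ, MeetsHalfInts (((m : ℝ), (n : ℝ)) - z) := by
  induction hz with
  | of_mem hz => exact fun m n => .of_mem (sub_mem_halfInts hz m n)
  | @of_ubr z j _ ih =>
    intro m n
    refine .of_ubr (3 - j) ?_
    convert ih n (4 * n - 4 * m) using 1
    simp only [ubr, Prod.mk_sub_mk, Prod.fst_sub, Prod.snd_sub, Prod.mk.injEq, true_and]
    push_cast
    ring

/-- The points that are half-integers as soon as their orbit meets the half-integers. -/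
def tameSet : Set (ℝ × ℝ) := {z | MeetsHalfInts z → z ∈ halfInts}

theorem sub_mem_tameSet {z : ℝ × ℝ} (hz : z ∈ tameSet) (m n : ℤ) :
    ((m : ℝ), (n : ℝ)) - z ∈ tameSet := by
  intro hm
  refine sub_mem_halfInts (hz ?_) m n
  have := hm.sub m n
  rwa [sub_sub_cancel] at this

namespace IsTile
variable {T : Set (ℝ × ℝ)} (h : IsTile 4 4 T)
include h

theorem ubr_zero_mem_of_lt {p : ℝ × ℝ} (hp : p ∈ T) (h1 : p.2 - 2 * p.1 < -1) :
    ubr 4 4 0 p ∈ T := by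
  obtain ⟨j, hj0, hj1, hj⟩ := h.exists_ubr_mem p hp
  have e := (_root_.abs_le.1 (h.abs_le_four hj).2).1
  simp only [ubr] at e
  push_cast at e
  have : j < 1 := by exact_mod_cast (by linarith : (j : ℝ) < 1)
  obtain rfl : j = 0 := by omega
  exact hj

theorem mk_mem_pairInterior {x s : ℝ} (hx0 : -(1 / 16) < x) (hx1 : x < 1 / 2)
    (hs0 : -(1 / 24) < s) (hs1 : s < 1 / 36) (hxs : s < 0 ∨ 0 < x ∧ x < 1 / 12) :
    ((2 * x - 1 - s) / 4, x) ∈ pairInterior T := by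
  refine h.mem_pairInterior_of_forall_ubr fun m n hmn => ?_
  have e0 : ubr 4 4 0 ((2 * x - 1 - s) / 4, x) - ((m : ℝ), (n : ℝ)) =
      (x - m, 5 / 2 + 2 * x + s - n) := by
    simp only [ubr, Prod.mk_sub_mk, Prod.mk.injEq, true_and]
    push_cast
    ring
  rw [e0] at hmn
  have e1 := _root_.abs_le.1 (h.abs_le_four hmn).1
  have e2 := _root_.abs_le.1 (h.abs_le_four hmn).2
  have e3 := _root_.abs_le.1 (h.abs_snd_le_four hmn)
  simp only at e1 e2 e3
  have f1 : -2 < m := by exact_mod_cast (by linarith : (-2 : ℝ) < m)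
  have f2 : m < 2 := by exact_mod_cast (by linarith : (m : ℝ) < 2)
  have f3 : 0 < n - 2 * m := by exact_mod_cast (by linarith : (0 : ℝ) < n - 2 * m)
  have f4 : n - 2 * m < 5 := by exact_mod_cast (by linarith : (n : ℝ) - 2 * m < 5)
  have tip : ∀ {y r : ℝ}, (y + 1, 1 / 2 + 2 * y + r) ∈ T → r < 1 / 4 → 1 ≤ 8 * y + 12 * r := by
    intro y r hm hr
    have g1 := h.ubr_zero_mem_of_lt hm (by simp only; linarith)
    have g2 := h.ubr_zero_mem_of_lt g1 (by simp only [ubr]; push_cast; linarith)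
    have g3 := (_root_.abs_le.1 (h.abs_snd_le_four g2)).1
    simp only [ubr] at g3
    push_cast at g3
    linarith
  rcases (by omega : m = -1 ∨ m = 0 ∨ m = 1) with rfl | rfl | rfl
  · exfalso
    push_cast at e1 e2 e3 hmn
    rcases (by omega : n ≤ 0 ∨ n = 1 ∨ n = 2) with hn | rfl | rfl
    · have : (n : ℝ) ≤ 0 := by exact_mod_cast hn
      linarith
    · have hs : s < 0 := by
        rcases hxs with hs | hs
        · exact hs
        · push_cast at e3; linarith [hs.1]
      obtain ⟨j, hj0, hj1, hj⟩ := h.exists_ubr_mem _ hmn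
      have g1 := (_root_.abs_le.1 (h.abs_le_four hj).2).1
      have g2 := (_root_.abs_le.1 (h.abs_snd_le_four hj)).2
      simp only [ubr] at g1 g2
      push_cast at g1 g2
      have hj : j < 2 := by exact_mod_cast (by linarith : (j : ℝ) < 2)
      have hj' : (j : ℝ) ≤ 1 := by exact_mod_cast (by omega : j ≤ 1)
      linarith
    · push_cast at e2
      have := tip (y := x) (r := s) (by convert hmn using 2 <;> push_cast <;> ring) (by linarith)
      rcases hxs with hs | hs
      · linarith
      · linarith [hs.2]
  · left
    refine ⟨rfl, by omega, ?_⟩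
    by_contra! hn
    obtain rfl : n = 4 := by omega
    have g1 := h.ubr_zero_mem_of_lt hmn (by simp only; push_cast; linarith)
    have g2 := (_root_.abs_le.1 (h.abs_snd_le_four g1)).1
    simp only [ubr] at g2
    push_cast at g2
    linarith
  · right
    refine ⟨rfl, ?_, by omega⟩
    by_contra! hn
    obtain rfl : n = 3 := by omega
    have g := h.neg_mem hmn
    have := tip (y := -x) (r := -s)
      (by convert g using 1; simp only [Prod.neg_mk, Prod.mk.injEq]; push_cast
          constructor <;> ring) (by linarith)
    linarith

theorem exists_isBead_tameSet : ∃ O, IsBead 4 4 T O tameSet := by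
  set g : ℝ × ℝ → ℝ × ℝ := fun q => ((2 * q.1 - 1 - q.2) / 4, q.1) with hg
  have hgc : Continuous g := by fun_prop
  set R₁ : Set (ℝ × ℝ) := g '' (Ioo (-(1 / 16)) (1 / 2) ×ˢ Ioo (-(1 / 24)) 0) with hR₁
  set R₂ : Set (ℝ × ℝ) := g '' (Ioo 0 (1 / 12) ×ˢ Ioo (-(1 / 36)) (1 / 36)) with hR₂
  have hb : g (1 / 24, -(1 / 48)) ∈ R₁ := mem_image_of_mem _ (by constructor <;> norm_num)
  have hb' : g (1 / 24, -(1 / 48)) ∈ R₂ := mem_image_of_mem _ (by constructor <;> norm_num)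
  have hRc : IsPreconnected (R₁ ∪ R₂) :=
    ((isPreconnected_Ioo.prod isPreconnected_Ioo).image _ hgc.continuousOn).union _ hb hb'
      ((isPreconnected_Ioo.prod isPreconnected_Ioo).image _ hgc.continuousOn)
  have hRΩ : R₁ ∪ R₂ ⊆ pairInterior T := by
    rintro _ (⟨⟨x, s⟩, ⟨⟨hx0, hx1⟩, hs0, hs1⟩, rfl⟩ | ⟨⟨x, s⟩, ⟨⟨hx0, hx1⟩, hs0, hs1⟩, rfl⟩)
    · exact h.mk_mem_pairInterior hx0 hx1 hs0 (by linarith) (Or.inl hs1)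
    · exact h.mk_mem_pairInterior (by linarith) (by linarith) (by linarith) hs1
        (Or.inr ⟨hx0, hx1⟩)
  set P := connectedComponentIn (pairInterior T) (g (1 / 24, -(1 / 48))) with hP
  have hRP : R₁ ∪ R₂ ⊆ P := hRc.subset_connectedComponentIn (Or.inl hb) hRΩ
  have hPo : IsOpen P := (isOpen_pairInterior T).connectedComponentIn
  have hPc : IsPreconnected P := isPreconnected_connectedComponentIn
  have hPΩ : P ⊆ pairInterior T := connectedComponentIn_subset _ _
  have hsub : ∀ {X : Set (ℝ × ℝ)} {p : ℝ × ℝ}, IsPreconnected X → X ⊆ pairInterior T → p ∈ X →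
      p ∈ R₁ ∪ R₂ → X ⊆ P := by
    intro X p hX hXΩ hpX hpR
    have e := connectedComponentIn_eq (hRP hpR)
    exact subset_trans (hX.subset_connectedComponentIn hpX hXΩ) e.symm.subset
  have hPb : br 4 4 2 '' P ⊆ P := by
    refine hsub (hPc.image _ (continuous_br 4 4 2).continuousOn)
      (h.image_br_subset_pairInterior (by norm_num) (by norm_num) hPΩ)
      ⟨g (2 / 5, -(1 / 48)), hRP (Or.inl ⟨_, ?_, rfl⟩), rfl⟩
      (Or.inl ⟨(2 / 5 / 2 - 1 / 4 + 1 / 48 / 4, -(1 / 96)), ?_, ?_⟩)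
    · constructor <;> norm_num
    · constructor <;> norm_num
    · simp only [hg, br, Prod.mk.injEq]
      norm_num
  have hPb' : br 4 4 2 '' ((fun p => (0, 1) - p) '' P) ⊆ P := by
    refine hsub ((hPc.image _ (by fun_prop)).image _ (continuous_br 4 4 2).continuousOn)
      (h.image_br_subset_pairInterior (by norm_num) (by norm_num)
        (h.reflect_subset_pairInterior hPΩ))
      ⟨_, ⟨g (35 / 96, -(1 / 48)), hRP (Or.inl ⟨_, ?_, rfl⟩), rfl⟩, rfl⟩
      (Or.inr ⟨(1 / 16, 1 / 96), ?_, ?_⟩)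
    · constructor <;> norm_num
    · constructor <;> norm_num
    · simp only [hg, br, Prod.mk_sub_mk, Prod.mk.injEq]
      norm_num
  have hβ : ((0, 1 / 2) : ℝ × ℝ) ∈ closure P := by
    have e : g (1 / 2, 0) = (0, 1 / 2) := by simp only [hg, Prod.mk.injEq]; norm_num
    rw [← e]
    refine map_mem_closure (s := Ioo (-(1 / 16)) (1 / 2) ×ˢ Ioo (-(1 / 24)) 0) hgc ?_
      fun q hq => hRP (Or.inl ⟨q, hq, rfl⟩)
    rw [closure_prod_eq, closure_Ioo (by norm_num), closure_Ioo (by norm_num)]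
    constructor <;> norm_num
  refine h.isBead_of_isOpen hPo hPc (fun p hp => mem_or_mem_of_mem_pairInterior (hPΩ hp))
    (fun p hp => hPb ⟨p, hp, rfl⟩) (fun p hp => hPb' ⟨_, ⟨p, hp, rfl⟩, rfl⟩)
    (fun z hz j hm => ubr_mem_halfInts (hz (.of_ubr j hm)) j) (fun z hz => ?_) (fun z hz => ?_)
    (fun z hz hz' => ?_) hβ (Or.inr fun hβ => ?_)
  · have := sub_mem_tameSet hz 0 0
    rwa [Int.cast_zero, ← Prod.zero_eq_mk, zero_sub] at this
  · simpa using sub_mem_tameSet hz 0 1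
  · refine hz fun hm => ?_
    have := ubr_mem_halfInts (hz' (.of_ubr (4 - 2) (by rwa [h.ubr_br]))) (4 - 2)
    rwa [h.ubr_br] at this
  · obtain ⟨m, -, hm, -⟩ := hβ (.of_ubr 0 (.of_mem ⟨0, 3, by simp [ubr], by simp [ubr]; norm_num⟩))
    simp only at hm
    have : 2 * m + 1 = 0 := by exact_mod_cast (by linarith : 2 * (m : ℝ) + 1 = 0)
    omega

theorem isPreconnected_diff_of_ubr {z : ℝ × ℝ}
    (hz : ∀ j, IsPreconnected (T \ {ubr 4 4 j z})) : IsPreconnected (T \ {z}) := by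
  have e : T \ {z} = ⋃ j ∈ Icc (0 : ℤ) 3, br 4 4 j '' (T \ {ubr 4 4 j z}) := by
    ext p
    simp only [mem_iUnion₂, ← h.image_br_diff]
    constructor
    · rintro ⟨hp, hpz⟩
      obtain ⟨j, hj0, hj1, hj⟩ := h.exists_ubr_mem p hp
      exact ⟨j, ⟨hj0, by omega⟩, ⟨_, hj, h.br_ubr j p⟩, hpz⟩
    · rintro ⟨j, ⟨hj0, hj1⟩, hp, hpz⟩
      exact ⟨h.image_br_subset hj0 (by omega) hp, hpz⟩
  rw [e]
  refine IsPreconnected.biUnion_of_chain ordConnected_Icc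
    (fun j _ => (hz j).image _ (continuous_br 4 4 j).continuousOn) fun j _ _ => ?_
  have h1 : ((3 / 4, 3 / 2) : ℝ × ℝ) ∈ T := by
    convert h.br_mem 3 (by norm_num) (by norm_num) _
      (h.diag_mem (j := 0) (x := 3 / 2) le_rfl (by norm_num) (by norm_num)) using 1
    simp only [br, Prod.mk.injEq, and_true]
    norm_num
  have h2 : ((3 / 4, 1 / 2) : ℝ × ℝ) ∈ T := by
    convert h.br_mem 0 (by norm_num) (by norm_num) _
      (h.diag_mem (j := 1) (x := 1 / 2) (by norm_num) (by norm_num) (by norm_num)) using 1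
    simp only [br, Prod.mk.injEq, and_true]
    norm_num
  have key : ∀ p ∈ T, p - (0, 1) ∈ T → br 4 4 j p ≠ z →
      (br 4 4 j '' (T \ {ubr 4 4 j z}) ∩
        br 4 4 (Order.succ j) '' (T \ {ubr 4 4 (Order.succ j) z})).Nonempty := by
    intro p hp hp' hpz
    refine ⟨br 4 4 j p, ?_, ?_⟩
    · rw [← h.image_br_diff]; exact ⟨⟨p, hp, rfl⟩, hpz⟩
    · rw [← h.image_br_diff]; exact ⟨⟨_, hp', (IsBead.br_eq_br_succ 4 4 j p).symm⟩, hpz⟩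
  by_cases hc : br 4 4 j (3 / 4, 3 / 2) = z
  · refine key (-(3 / 4), -(1 / 2) + 0) ?_ ?_ ?_
    · simpa using h.neg_mem h2
    · convert h.neg_mem h1 using 1
      simp only [Prod.mk_sub_mk, Prod.neg_mk, Prod.mk.injEq]
      norm_num
    · rw [← hc]
      intro e
      have := congrArg Prod.fst (h.br_injective j e)
      norm_num at this
  · refine key _ h1 ?_ hc
    convert h2 using 1
    simp only [Prod.mk_sub_mk, Prod.mk.injEq]
    norm_num

theorem isPreconnected_diff_four (z : ℝ × ℝ) : IsPreconnected (T \ {z}) := by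
  obtain ⟨O, hO⟩ := h.exists_isBead_tameSet
  have hY : ∀ z ∈ tameSet, IsPreconnected (T \ {z}) := fun z hz =>
    hO.isPreconnected_diff_of_uniqueDigits h
      (hO.uniqueDigits_four h fun z hz j hj => hz (.of_ubr j (.of_mem hj))) (by norm_num) hz
  have key : ∀ z, MeetsHalfInts z → ∀ m n : ℤ,
      IsPreconnected (T \ {((m : ℝ), (n : ℝ)) - z}) ∧
      IsPreconnected (T \ {z - ((m : ℝ), (n : ℝ))}) := by
    intro z hz
    induction hz with
    | @of_mem z hz =>
      intro m n
      have h1 := sub_mem_halfInts hz m n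
      have h2 := sub_mem_halfInts h1 0 0
      rw [Int.cast_zero, ← Prod.zero_eq_mk, zero_sub, neg_sub] at h2
      exact ⟨hY _ fun _ => h1, hY _ fun _ => h2⟩
    | @of_ubr z j _ ih =>
      intro m n
      constructor <;> refine h.isPreconnected_diff_of_ubr fun i => ?_
      · convert (ih n (4 * n - 4 * m - i + 3 - j)).1 using 3
        simp only [ubr, Prod.mk_sub_mk, Prod.fst_sub, Prod.snd_sub, Prod.mk.injEq, true_and]
        push_cast
        ring
      · convert (ih n (4 * n - 4 * m + i - j)).2 using 3
        simp only [ubr, Prod.mk_sub_mk, Prod.fst_sub, Prod.snd_sub, Prod.mk.injEq, true_and]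
        push_cast
        ring
  by_cases hz : MeetsHalfInts z
  · have := (key z hz 0 0).2
    rwa [Int.cast_zero, ← Prod.zero_eq_mk, sub_zero] at this
  · exact hY z fun hm => absurd hm hz

end IsTile

theorem Homeomorph.isConnected_and_cutPoint_iff_preimage {E F : Type*} [TopologicalSpace E]
    [TopologicalSpace F] (e : E ≃ₜ F) (T : Set F) (P : Prop)
    (h : IsConnected (e ⁻¹' T) ∧ ((∃ z ∈ e ⁻¹' T, ¬ IsPreconnected ((e ⁻¹' T) \ {z})) ↔ P)) :
    IsConnected T ∧ ((∃ z ∈ T, ¬ IsPreconnected (T \ {z})) ↔ P) := by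
  refine ⟨e.isConnected_preimage.1 h.1, ?_⟩
  rw [← h.2, ← e.exists_congr_right]
  refine exists_congr fun z => and_congr Iff.rfl (not_congr ?_)
  rw [← e.isPreconnected_preimage, preimage_sdiff]
  have : e ⁻¹' {e.toEquiv z} = {z} := by ext; simp
  rw [this]

namespace IsTile
variable {a B : ℤ} {T : Set (ℝ × ℝ)} (h : IsTile a B T)
include h

theorem isConnected_and_cutPoint_iff_of_nonneg (ha : 0 ≤ a) :
    IsConnected T ∧ ((∃ z ∈ T, ¬ IsPreconnected (T \ {z})) ↔ 5 ≤ 2 * a - B) := by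
  have hB := h.two_le
  rcases le_or_gt 5 (2 * a - B) with hd | hd
  · exact ⟨h.isConnected_of_two_le (by omega), iff_of_true (h.exists_cutPoint hd) hd⟩
  have key : IsConnected T ∧ ∀ z, IsPreconnected (T \ {z}) := by
    rcases le_or_gt (2 * a) (B + 2) with hd' | hd'
    · exact h.isPreconnected_of_abs_fst_lt_one (h.abs_fst_lt_one ha hd')
    refine ⟨h.isConnected_of_two_le (by omega), ?_⟩
    by_cases h4 : a = 4 ∧ B = 4
    · obtain ⟨rfl, rfl⟩ := h4
      exact h.isPreconnected_diff_four
    · exact h.isPreconnected_diff_of_ne_four (by omega)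
  exact ⟨key.1, iff_of_false (fun ⟨z, _, hz⟩ => hz (key.2 z)) (by omega)⟩

theorem preimage_neg_fst :
    IsTile (-a) B ((Homeomorph.neg ℝ).prodCongr (Homeomorph.refl ℝ) ⁻¹' T) where
  two_le := h.two_le
  abs_le := by rw [abs_neg]; exact h.abs_le
  nonempty := h.nonempty.preimage (Homeomorph.surjective _)
  isCompact := (Homeomorph.isCompact_preimage _).2 h.isCompact
  exists_ubr_mem := by
    intro p hp
    obtain ⟨j, hj0, hj1, hj⟩ := h.exists_ubr_mem _ hp
    refine ⟨B - 1 - j, by omega, by omega, ?_⟩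
    rw [mem_preimage]
    convert h.neg_mem hj using 1
    ext
    · simp [ubr]
    · simp [ubr]
      ring
  br_mem := by
    intro j hj0 hj1 p hp
    have := h.br_mem (B - 1 - j) (by omega) (by omega) _ (h.neg_mem hp)
    rw [mem_preimage]
    convert this using 1
    ext
    · simp [br]
      ring
    · simp [br]

theorem isConnected_and_cutPoint_iff :
    IsConnected T ∧ ((∃ z ∈ T, ¬ IsPreconnected (T \ {z})) ↔ 5 ≤ 2 * |a| - B) := by
  rcases le_total 0 a with ha | ha
  · rw [abs_of_nonneg ha]
    exact h.isConnected_and_cutPoint_iff_of_nonneg ha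
  · rw [abs_of_nonpos ha]
    exact Homeomorph.isConnected_and_cutPoint_iff_preimage _ T _
      (h.preimage_neg_fst.isConnected_and_cutPoint_iff_of_nonneg (by omega))

end IsTile

theorem Matrix.mulVec_mulVec_of_charpoly (A B : ℤ) (M : Matrix (Fin 2) (Fin 2) ℤ)
    (hchar : M.charpoly = X ^ 2 + C A * X + C B) (x : Fin 2 → ℝ) :
    (M.map (Int.cast : ℤ → ℝ)).mulVec ((M.map (Int.cast : ℤ → ℝ)).mulVec x) =
      -(A : ℝ) • (M.map (Int.cast : ℤ → ℝ)).mulVec x - (B : ℝ) • x := by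
  have h0 := hchar
  rw [Matrix.charpoly_fin_two] at h0
  have hA : -M.trace = A := by
    simpa [coeff_X, coeff_C, -eq_intCast] using congrArg (coeff · 1) h0
  have hB : M.det = B := by
    simpa [coeff_X, coeff_C, -eq_intCast] using congrArg (coeff · 0) h0
  rw [← hA, ← hB, Matrix.trace_fin_two, Matrix.det_fin_two]
  ext i
  fin_cases i <;> simp [Matrix.mulVec, dotProduct, Fin.sum_univ_two] <;> ring

/-- For the self-affine tile `T` with collinear digit set
`{0, v, 2v, …, (B-1)v}` and expanding matrix `M` with characteristic polynomial
`x² + A x + B` (`|A| ≤ B`, `B ≥ 2`), `T` is connected and `T` has a cut point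
if and only if `2|A| - B ≥ 5`. -/
theorem tile_connected_and_cutPoint_iff
    (A B : ℤ) (hAB : |A| ≤ B) (hB : 2 ≤ B)
    (M : Matrix (Fin 2) (Fin 2) ℤ)
    (hchar : M.charpoly = X ^ 2 + C A * X + C B)
    (v : Fin 2 → ℤ)
    (hindep : LinearIndependent ℝ
      ![(fun i => (v i : ℝ)), (M.map (Int.cast : ℤ → ℝ)).mulVec fun i => (v i : ℝ)])
    (T : Set (Fin 2 → ℝ)) (hTne : T.Nonempty) (hTcp : IsCompact T)
    (hT : (M.map (Int.cast : ℤ → ℝ)).mulVec '' T =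
      ⋃ j ∈ Set.Icc (0 : ℤ) (B - 1),
        (fun x => x + (j : ℝ) • fun i => (v i : ℝ)) '' T) :
    IsConnected T ∧
      ((∃ z ∈ T, ¬ IsPreconnected (T \ {z})) ↔ 5 ≤ 2 * |A| - B) := by
  have hMM := Matrix.mulVec_mulVec_of_charpoly A B M hchar
  generalize M.map (Int.cast : ℤ → ℝ) = N at *
  generalize (fun i => (v i : ℝ)) = w at *
  have hBr : (2 : ℝ) ≤ B := by exact_mod_cast hB
  have hAr : -(A : ℝ) ≤ B := by exact_mod_cast (neg_le_abs A).trans hAB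
  have hinj : ∀ x y, N.mulVec x = N.mulVec y → x = y := by
    intro x y e
    have h1 := hMM x
    rw [e, hMM y, sub_right_inj] at h1
    exact (smul_right_injective _ (by linarith : (B : ℝ) ≠ 0) h1).symm
  let L : ℝ × ℝ →ₗ[ℝ] Fin 2 → ℝ :=
    { toFun := fun q => q.1 • N.mulVec w + (q.2 + A * q.1) • w
      map_add' := fun p q => by simp only [Prod.fst_add, Prod.snd_add]; module
      map_smul' := fun r q => by
        simp only [Prod.smul_fst, Prod.smul_snd, smul_eq_mul, RingHom.id_apply]; module }
  have hL : ∀ q, L q = q.1 • N.mulVec w + (q.2 + A * q.1) • w := fun _ => rfl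
  have hLinj : Function.Injective L := by
    rw [← LinearMap.ker_eq_bot, LinearMap.ker_eq_bot']
    intro q hq
    rw [hL, add_comm] at hq
    obtain ⟨h1, h2⟩ := LinearIndependent.pair_iff.1 hindep _ _ hq
    rw [h2, mul_zero, add_zero] at h1
    exact Prod.ext h2 h1
  let e : (ℝ × ℝ) ≃ₜ (Fin 2 → ℝ) :=
    (LinearEquiv.ofInjectiveOfFinrankEq L hLinj (by simp)).toContinuousLinearEquiv.toHomeomorph
  have he : ∀ q, e q = L q := fun _ => rfl
  let c : ℝ := (B - 1) / 2 / (-A - B - 1)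
  have hc : (-A - B - 1 : ℝ) * c = (B - 1) / 2 := mul_div_cancel₀ _ (by linarith)
  let Ψ : (ℝ × ℝ) ≃ₜ (Fin 2 → ℝ) := (Homeomorph.addRight (c, c)).trans e
  have hΨ : ∀ j : ℤ, ∀ p, N.mulVec (Ψ p) = Ψ (ubr (-A) B j p) + (j : ℝ) • w := by
    intro j p
    have hΨL : ∀ q, Ψ q = L (q + (c, c)) := fun _ => rfl
    simp only [hΨL, hL, ubr, Matrix.mulVec_add, Matrix.mulVec_smul, hMM, Prod.fst_add,
      Prod.snd_add, Int.cast_neg]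
    rw [← hc]
    module
  have hmem : ∀ y, y ∈ N.mulVec '' T ↔ ∃ j : ℤ, (0 ≤ j ∧ j < B) ∧ ∃ x ∈ T, x + (j : ℝ) • w = y := by
    intro y
    rw [hT]
    simp only [mem_iUnion, mem_image, mem_Icc, Int.le_sub_one_iff, exists_prop]
  have htile : IsTile (-A) B (Ψ ⁻¹' T) :=
    { two_le := hB
      abs_le := by rwa [abs_neg]
      nonempty := hTne.preimage Ψ.surjective
      isCompact := Ψ.isCompact_preimage.2 hTcp
      exists_ubr_mem := by
        intro p hp
        obtain ⟨j, ⟨hj0, hj1⟩, x, hx, hxe⟩ := (hmem _).1 ⟨_, hp, rfl⟩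
        rw [hΨ j, add_left_inj] at hxe
        exact ⟨j, hj0, hj1, by rwa [mem_preimage, ← hxe]⟩
      br_mem := by
        intro j hj0 hj1 p hp
        obtain ⟨y, hy, hye⟩ := (hmem _).2 ⟨j, ⟨hj0, hj1⟩, _, hp, rfl⟩
        have : ubr (-A) B j (br (-A) B j p) = p := by
          have : (B : ℝ) ≠ 0 := by linarith
          ext <;> simp only [br, ubr]
          field_simp
          ring
        rw [mem_preimage, ← hinj y (Ψ (br (-A) B j p))]
        · exact hy
        · rw [hye, hΨ j, this] }
  rw [← abs_neg A]
  exact Ψ.isConnected_and_cutPoint_iff_preimage T _ htile.isConnected_and_cutPoint_iff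
end

section
/- Let A, B ∈ ℤ with |A| ≤ B and B ≥ 2, let M be a 2×2 integer matrix with characteristic polynomial x² + A·x + B, let v ∈ ℤ² be such that v and M·v are linearly independent over ℝ, and let T be the associated self-affine tile with digit set D = {0, v, 2v, …, (B−1)v}. If 2|A| − B ≥ 5, then there exists a point z ∈ T such that T ∖ {z} is not preconnected (T has a cut point). -/
open Polynomial

section BoundedSequences

variable {a B : ℤ} {β : ℕ → ℤ}

/-- A sequence that at least doubles (up to an excess of `2`) once keeps doing so, hence it
is unbounded. -/
lemma not_bounded_of_two_le_sub (h5 : B + 5 ≤ 2 * a) (haB : a ≤ B)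
    (hβ : ∀ n, |β (n + 2) - a * β (n + 1) + B * β n| ≤ B - 1) {K : ℤ} (hK : ∀ n, |β n| ≤ K)
    {n : ℕ} (h0 : 0 ≤ β n) (h1 : 2 ≤ β (n + 1) - 2 * β n) : False := by
  have key : ∀ k : ℕ, (k : ℤ) ≤ β (n + k) ∧ 2 ≤ β (n + k + 1) - 2 * β (n + k) := by
    intro k
    induction k with
    | zero => simpa using ⟨h0, h1⟩
    | succ k ih =>
      obtain ⟨ih0, ih1⟩ := ih
      have h := (abs_le.1 (hβ (n + k))).1
      have e1 : n + (k + 1) = n + k + 1 := by ring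
      rw [e1]
      refine ⟨by push_cast; linarith, ?_⟩
      have e2 : n + k + 1 + 1 = n + k + 2 := by ring
      rw [e2]
      have hk : (0 : ℤ) ≤ k := Int.natCast_nonneg k
      nlinarith [mul_nonneg (by linarith : 0 ≤ a - 2)
          (by linarith : 0 ≤ β (n + k + 1) - 2 * β (n + k) - 2),
        mul_nonneg (by linarith : 0 ≤ 2 * a - 4 - B - 1) (by linarith : 0 ≤ β (n + k) + 1)]
  have hK0 : 0 ≤ K := (abs_nonneg _).trans (hK 0)
  have h2 := (key (K.toNat + 1)).1
  have h3 := (abs_le.1 (hK (n + (K.toNat + 1)))).2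
  push_cast at h2
  rw [Int.toNat_of_nonneg hK0] at h2
  linarith

lemma not_bounded_of_sub_le_neg_two (h5 : B + 5 ≤ 2 * a) (haB : a ≤ B)
    (hβ : ∀ n, |β (n + 2) - a * β (n + 1) + B * β n| ≤ B - 1) {K : ℤ} (hK : ∀ n, |β n| ≤ K)
    {n : ℕ} (h0 : β n ≤ 0) (h1 : β (n + 1) - 2 * β n ≤ -2) : False := by
  refine not_bounded_of_two_le_sub (β := fun n => - β n) (n := n) (K := K) h5 haB ?_ ?_ ?_ ?_
  · intro m
    have e : -β (m + 2) - a * -β (m + 1) + B * -β m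
        = -(β (m + 2) - a * β (m + 1) + B * β m) := by ring
    simpa only [e, abs_neg] using hβ m
  · simpa using hK
  · simpa using h0
  · linarith

lemma le_succ_of_two_le (h5 : B + 5 ≤ 2 * a) (haB : a ≤ B)
    (hβ : ∀ n, |β (n + 2) - a * β (n + 1) + B * β n| ≤ B - 1) {K : ℤ} (hK : ∀ n, |β n| ≤ K)
    {n : ℕ} (hn : 2 ≤ β n) : β n ≤ β (n + 1) := by
  by_contra! hlt
  have hr := (abs_le.1 (hβ n)).2
  by_cases hq : 1 ≤ β (n + 1)
  · have hr' : β (n + 2) ≤ -1 := by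
      nlinarith [mul_nonneg (by linarith : 0 ≤ B - a) (by linarith : 0 ≤ β (n + 1)),
        mul_nonneg (by linarith : 0 ≤ B) (by linarith : 0 ≤ β n - 1 - β (n + 1))]
    have hs := (abs_le.1 (hβ (n + 1))).2
    refine not_bounded_of_sub_le_neg_two h5 haB hβ hK (n := n + 2) (by linarith) ?_
    change β (n + 3) - a * β (n + 2) + B * β (n + 1) ≤ B - 1 at hs
    change β (n + 3) - _ ≤ _
    nlinarith [mul_nonneg (by linarith : 0 ≤ a - 2) (by linarith : 0 ≤ - β (n + 2) - 1),
      mul_nonneg (by linarith : 0 ≤ B) (by linarith : 0 ≤ β (n + 1) - 1)]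
  · refine not_bounded_of_sub_le_neg_two h5 haB hβ hK (n := n + 1) (by linarith) ?_
    change β (n + 2) - _ ≤ _
    nlinarith [mul_nonneg (by linarith : 0 ≤ a - 2) (by linarith : 0 ≤ - β (n + 1)),
      mul_nonneg (by linarith : 0 ≤ B) (by linarith : 0 ≤ β n - 2)]

/-- From a value at least `2` on, a bounded sequence increases to a limit which is limited
by the digit bound. -/
lemma mul_le_of_two_le (h5 : B + 5 ≤ 2 * a) (haB : a ≤ B)
    (hβ : ∀ n, |β (n + 2) - a * β (n + 1) + B * β n| ≤ B - 1) {K : ℤ} (hK : ∀ n, |β n| ≤ K)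
    {n : ℕ} (hn : 2 ≤ β n) : β n * (B - a + 1) ≤ B - 1 := by
  have hmono : ∀ k, β n ≤ β (n + k) := by
    intro k
    induction k with
    | zero => simp
    | succ k ih => exact ih.trans (le_succ_of_two_le h5 haB hβ hK (hn.trans ih))
  obtain ⟨_, ⟨⟨k, rfl⟩, hmax⟩⟩ := Int.exists_greatest_of_bdd (P := fun z => ∃ k, β (n + k) = z)
    ⟨K, by rintro _ ⟨k, rfl⟩; exact (abs_le.1 (hK _)).2⟩ ⟨_, 0, rfl⟩
  have h2 : 2 ≤ β (n + k) := hn.trans (hmono k)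
  have e1 : β (n + k + 1) = β (n + k) :=
    le_antisymm (hmax _ ⟨k + 1, rfl⟩) (le_succ_of_two_le h5 haB hβ hK h2)
  have e2 : β (n + k + 2) = β (n + k) :=
    le_antisymm (hmax _ ⟨k + 2, rfl⟩)
      (e1 ▸ le_succ_of_two_le h5 haB hβ hK (n := n + k + 1) (e1.symm ▸ h2))
  have h := (abs_le.1 (hβ (n + k))).2
  rw [e1, e2] at h
  nlinarith [mul_nonneg (by linarith : 0 ≤ B - a + 1) (sub_nonneg.2 (hmono k))]

lemma lt_two_of_start_zero (h5 : B + 5 ≤ 2 * a) (haB : a ≤ B)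
    (hβ : ∀ n, |β (n + 2) - a * β (n + 1) + B * β n| ≤ B - 1) {K : ℤ} (hK : ∀ n, |β n| ≤ K)
    (h0 : β 0 = 0) : β 1 < 2 := by
  by_contra! h
  exact not_bounded_of_two_le_sub h5 haB hβ hK (n := 0) h0.ge (by simpa [h0] using h)

lemma lt_three_of_start_one (h5 : B + 5 ≤ 2 * a) (haB : a ≤ B)
    (hβ : ∀ n, |β (n + 2) - a * β (n + 1) + B * β n| ≤ B - 1) {K : ℤ} (hK : ∀ n, |β n| ≤ K)
    (h0 : β 0 = 1) : β 1 < 3 := by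
  by_contra! h
  have h1 := mul_le_of_two_le h5 haB hβ hK (n := 1) (by linarith)
  have h12 := le_succ_of_two_le h5 haB hβ hK (n := 1) (by linarith)
  have h2 := mul_le_of_two_le h5 haB hβ hK (n := 2) (by linarith)
  have hr := (abs_le.1 (hβ 0)).1
  simp only [zero_add, h0] at hr
  have hD : 0 ≤ B - a := by linarith
  have hB : 3 * (B - a + 1) ≤ B - 1 := by nlinarith
  have hr' : B - 3 * (B - a) + 1 ≤ β 2 := by nlinarith
  nlinarith [mul_nonneg (by linarith : 0 ≤ B - a + 1) (sub_nonneg.2 hr'),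
    mul_nonneg hD (by linarith : 0 ≤ B - 3 * (B - a) - 4)]

end BoundedSequences

section Topology

open Set Function

variable {X : Type*} [TopologicalSpace X] [T2Space X]

lemma exists_not_isPreconnected_sdiff_singleton {T P Q : Set X} {g : X → X}
    (hTne : T.Nonempty) (hT : IsCompact T) (hP : IsCompact P) (hQ : IsCompact Q)
    (hPne : P.Nonempty) (hQne : Q.Nonempty) (hg : Continuous g) (hginj : Injective g)
    (hcover : T = P ∪ Q ∪ g '' T)
    (hPQ : Disjoint P Q) (hPgQ : Disjoint P (g '' Q)) (hQgP : Disjoint Q (g '' P))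
    (hPT : Disjoint P (g '' (g '' T))) (hQT : Disjoint Q (g '' (g '' T)))
    (hsub : ∀ x y, (∀ n, x ∈ g^[n] '' T) → (∀ n, y ∈ g^[n] '' T) → x = y) :
    ∃ z ∈ T, ¬ IsPreconnected (T \ {z}) := by
  have hPsub : P ⊆ T := fun x hx => by rw [hcover]; exact Or.inl (Or.inl hx)
  have hQsub : Q ⊆ T := fun x hx => by rw [hcover]; exact Or.inl (Or.inr hx)
  have hgsub : g '' T ⊆ T := fun x hx => by rw [hcover]; exact Or.inr hx
  have hanti : Antitone fun n => g^[n] '' T := by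
    refine antitone_nat_of_succ_le fun n => ?_
    change g^[n + 1] '' T ⊆ g^[n] '' T
    rw [iterate_succ, image_comp]
    exact image_mono hgsub
  have hcpt : ∀ n, IsCompact (g^[n] '' T) := fun n => hT.image (hg.iterate n)
  obtain ⟨z, hz⟩ := IsCompact.nonempty_iInter_of_directed_nonempty_isCompact_isClosed
    (fun n => g^[n] '' T) hanti.directed_ge (fun n => hTne.image _) hcpt
    (fun n => (hcpt n).isClosed)
  rw [mem_iInter] at hz
  have hzT : z ∈ T := by simpa using hz 0
  have e2 : g^[2] '' T = g '' (g '' T) := by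
    rw [show g^[2] = g ∘ g from rfl, image_comp]
  have hz2 : z ∈ g '' (g '' T) := e2 ▸ hz 2
  have hdeep : ∀ S ⊆ T, ∀ n, g^[n + 2] '' S ⊆ g '' (g '' T) := by
    intro S hS n
    exact e2 ▸ (image_mono hS).trans (hanti (Nat.le_add_left 2 n))
  have hclosed : ∀ S ⊆ T, IsCompact S → IsClosed ((⋃ n, g^[n] '' S) ∪ {z}) := by
    intro S hST hS
    have e : (⋃ n, g^[n] '' S) ∪ {z}
        = ⋂ n, ((⋃ m ∈ Iio n, g^[m] '' S) ∪ g^[n] '' T) := by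
      ext x
      simp only [mem_union, mem_iUnion, mem_singleton_iff, mem_iInter, mem_Iio]
      constructor
      · rintro (⟨m, hm⟩ | rfl) n
        · rcases lt_or_ge m n with h | h
          · exact Or.inl ⟨m, h, hm⟩
          · exact Or.inr (hanti h (image_mono hST hm))
        · exact Or.inr (hz n)
      · intro h
        by_contra! hx
        refine hx.2 (hsub _ _ (fun n => ?_) hz)
        rcases h n with ⟨m, -, hm⟩ | h
        · exact absurd hm (hx.1 m)
        · exact h
    rw [e]
    refine isClosed_iInter fun n => IsClosed.union ?_ (hcpt n).isClosed
    exact (finite_Iio n).isClosed_biUnion fun m _ => (hS.image (hg.iterate m)).isClosed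
  have hlevels : ∀ S ⊆ T, ∀ R ⊆ T, Disjoint S R → Disjoint S (g '' R) →
      Disjoint S (g '' (g '' T)) → ∀ m k x, x ∈ g^[m] '' S → x ∉ g^[m + k] '' R := by
    rintro S hS R hR h0 h1 h2 m k _ ⟨s, hs, rfl⟩ ⟨r, hr, hsr⟩
    rw [iterate_add_apply] at hsr
    have hsr := hginj.iterate m hsr
    match k with
    | 0 => exact disjoint_left.1 h0 hs (hsr ▸ hr)
    | 1 => exact disjoint_left.1 h1 hs ⟨r, hr, hsr⟩
    | k + 2 => exact disjoint_left.1 h2 hs (hdeep R hR k ⟨r, hr, hsr⟩)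
  refine ⟨z, hzT, fun hpre => ?_⟩
  rw [isPreconnected_closed_iff] at hpre
  have hmeet := hpre _ _ (hclosed P hPsub hP) (hclosed Q hQsub hQ) ?_ ?_ ?_
  · obtain ⟨x, ⟨-, hxz⟩, hxU, hxV⟩ := hmeet
    obtain ⟨m, hm⟩ := mem_iUnion.1 (hxU.resolve_right hxz)
    obtain ⟨k, hk⟩ := mem_iUnion.1 (hxV.resolve_right hxz)
    rcases le_total m k with h | h
    · obtain ⟨d, rfl⟩ := Nat.exists_eq_add_of_le h
      exact hlevels P hPsub Q hQsub hPQ hPgQ hPT m d x hm hk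
    · obtain ⟨d, rfl⟩ := Nat.exists_eq_add_of_le h
      exact hlevels Q hQsub P hPsub hPQ.symm hQgP hQT k d x hk hm
  · rintro x ⟨hxT, hxz⟩
    by_contra hx
    simp only [mem_union, mem_iUnion, not_or, not_exists] at hx
    refine hxz (hsub _ _ (fun n => ?_) hz)
    induction n with
    | zero => simpa using hxT
    | succ n ih =>
      obtain ⟨t, ht, rfl⟩ := ih
      rw [hcover] at ht
      rcases ht with (ht | ht) | ⟨s, hs, rfl⟩
      · exact absurd ⟨t, ht, rfl⟩ (hx.1.1 n)
      · exact absurd ⟨t, ht, rfl⟩ (hx.2.1 n)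
      · exact ⟨s, hs, rfl⟩
  · obtain ⟨p, hp⟩ := hPne
    refine ⟨p, ⟨hPsub hp, ?_⟩, Or.inl (mem_iUnion.2 ⟨0, by simpa using hp⟩)⟩
    rintro rfl
    exact disjoint_left.1 hPT hp hz2
  · obtain ⟨q, hq⟩ := hQne
    refine ⟨q, ⟨hQsub hq, ?_⟩, Or.inl (mem_iUnion.2 ⟨0, by simpa using hq⟩)⟩
    rintro rfl
    exact disjoint_left.1 hQT hq hz2

lemma exists_not_isPreconnected_sdiff_singleton_of_alternating {T P Q : Set X} {g : X → X}
    (hTne : T.Nonempty) (hT : IsCompact T) (hP : IsCompact P) (hQ : IsCompact Q)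
    (hPne : P.Nonempty) (hQne : Q.Nonempty) (hg : Continuous g) (hginj : Injective g)
    (hcover : T = P ∪ Q ∪ g '' T)
    (hPQ : Disjoint P Q) (hPgP : Disjoint P (g '' P)) (hQgQ : Disjoint Q (g '' Q))
    (hPT : Disjoint P (g '' (g '' T))) (hQT : Disjoint Q (g '' (g '' T)))
    (hsub : ∀ x y, (∀ n, x ∈ g^[n] '' T) → (∀ n, y ∈ g^[n] '' T) → x = y) :
    ∃ z ∈ T, ¬ IsPreconnected (T \ {z}) := by
  have hPsub : P ⊆ T := fun x hx => by rw [hcover]; exact Or.inl (Or.inl hx)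
  have hQsub : Q ⊆ T := fun x hx => by rw [hcover]; exact Or.inl (Or.inr hx)
  have hgsub : g '' T ⊆ T := fun x hx => by rw [hcover]; exact Or.inr hx
  have hggT : ∀ S ⊆ T, (g ∘ g) '' S ⊆ g '' (g '' T) := fun S hS => by
    rw [image_comp]; exact image_mono (image_mono hS)
  have hdisj : ∀ P' Q' : Set X, P' ⊆ T → Q' ⊆ T → Disjoint P' (g '' (g '' T)) →
      Disjoint Q' (g '' (g '' T)) → Disjoint Q' (g '' Q') →
      Disjoint (P' ∪ g '' Q') ((g ∘ g) '' (Q' ∪ g '' P')) := by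
    intro P' Q' hP' hQ' h1 h2 h3
    have hsubT : Q' ∪ g '' P' ⊆ T := union_subset hQ' ((image_mono hP').trans hgsub)
    refine disjoint_union_left.2 ⟨h1.mono_right (hggT _ hsubT), ?_⟩
    rw [image_comp, disjoint_image_iff hginj, image_union]
    exact disjoint_union_right.2 ⟨h3, h2.mono_right (image_mono (image_mono hP'))⟩
  have hdeep : ∀ P' Q' : Set X, Disjoint P' (g '' (g '' T)) → Disjoint Q' (g '' (g '' T)) →
      Disjoint (P' ∪ g '' Q') ((g ∘ g) '' ((g ∘ g) '' T)) := by
    intro P' Q' h1 h2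
    have hs : (g ∘ g) '' T ⊆ T := (hggT T subset_rfl).trans ((image_mono hgsub).trans hgsub)
    refine disjoint_union_left.2 ⟨h1.mono_right (hggT _ hs), ?_⟩
    rw [image_comp, disjoint_image_iff hginj, image_comp]
    exact h2.mono_right (image_mono (image_mono hgsub))
  refine exists_not_isPreconnected_sdiff_singleton (P := P ∪ g '' Q) (Q := Q ∪ g '' P)
    (g := g ∘ g) hTne hT (hP.union (hQ.image hg)) (hQ.union (hP.image hg)) hPne.inl hQne.inl
    (hg.comp hg) (hginj.comp hginj) ?_ ?_ (hdisj P Q hPsub hQsub hPT hQT hQgQ)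
    (hdisj Q P hQsub hPsub hQT hPT hPgP) (hdeep P Q hPT hQT) (hdeep Q P hQT hPT) ?_
  · have e : g '' T = g '' P ∪ g '' Q ∪ (g ∘ g) '' T := by
      conv_lhs => rw [hcover]
      rw [image_union, image_union, image_comp]
    conv_lhs => rw [hcover, e]
    ext x
    simp only [mem_union]
    tauto
  · refine disjoint_union_left.2 ⟨disjoint_union_right.2 ⟨hPQ, hPgP⟩,
      disjoint_union_right.2 ⟨hQgQ.symm, ?_⟩⟩
    exact (disjoint_image_iff hginj).2 hPQ.symm
  · have hsubn : ∀ n, (g ∘ g)^[n] '' T ⊆ g^[n] '' T := by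
      intro n
      rw [(Function.Commute.refl g).comp_iterate, image_comp]
      exact image_mono ((mapsTo_iff_image_subset.2 hgsub).iterate n).image_subset
    exact fun x y hx hy => hsub x y (fun n => hsubn n (hx n)) (fun n => hsubn n (hy n))

end Topology

section Recurrence

lemma eq_zero_of_bounded_geometric {μ C r : ℝ} (hμ : 1 < |μ|) (h : ∀ n : ℕ, |μ ^ n * r| ≤ C) :
    r = 0 := by
  by_contra hr
  have hr' : 0 < |r| := abs_pos.2 hr
  obtain ⟨n, hn⟩ := pow_unbounded_of_one_lt (C / |r|) hμ
  have := h n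
  rw [abs_mul, abs_pow] at this
  rw [div_lt_iff₀ hr'] at hn
  linarith

lemma eq_zero_of_bounded_recurrence {a B ε : ℝ} (hε : ε = 1 ∨ ε = -1) (h5 : B + 5 ≤ 2 * a)
    (haB : a ≤ B) {r : ℕ → ℝ} (hr : ∀ n, r (n + 2) = ε * a * r (n + 1) - B * r n)
    {C : ℝ} (hC : ∀ n, |r n| ≤ C) : r 0 = 0 ∧ r 1 = 0 := by
  have hε2 : ε * ε = 1 := by rcases hε with rfl | rfl <;> norm_num
  have hεabs : |ε| = 1 := by rcases hε with rfl | rfl <;> simp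
  have hΔ : 0 < a ^ 2 - 4 * B := by nlinarith [sq_nonneg (B - 3)]
  set d := √(a ^ 2 - 4 * B) with hd
  have hd0 : 0 < d := Real.sqrt_pos.2 hΔ
  have hd2 : d * d = a ^ 2 - 4 * B := Real.mul_self_sqrt hΔ.le
  have hda : d < a - 2 := by
    by_contra! h
    nlinarith [mul_self_le_mul_self (by linarith : 0 ≤ a - 2) h]
  have key : ∀ δ : ℝ, δ = d ∨ δ = -d →
      r 1 - ε * ((a - δ) / 2) * r 0 = 0 := by
    intro δ hδ
    have hδ2 : δ * δ = a ^ 2 - 4 * B := by rcases hδ with rfl | rfl <;> linarith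
    have hμ : 1 < |ε * ((a + δ) / 2)| := by
      rw [abs_mul, hεabs, one_mul]
      refine lt_of_lt_of_le ?_ (le_abs_self _)
      rcases hδ with rfl | rfl <;> linarith
    refine eq_zero_of_bounded_geometric (C := C + |ε * ((a - δ) / 2)| * C) hμ fun n => ?_
    have e : (ε * ((a + δ) / 2)) ^ n * (r 1 - ε * ((a - δ) / 2) * r 0)
        = r (n + 1) - ε * ((a - δ) / 2) * r n := by
      induction n with
      | zero => simp
      | succ n ih =>
        rw [pow_succ', mul_assoc, ih, show n + 1 + 1 = n + 2 from rfl, hr n]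
        linear_combination (-(a * a - δ * δ) / 4 * r n) * hε2 + r n / 4 * hδ2
    rw [e]
    refine (abs_sub _ _).trans (add_le_add (hC _) ?_)
    rw [abs_mul]
    exact mul_le_mul_of_nonneg_left (hC _) (abs_nonneg _)
  have h1 := key d (Or.inl rfl)
  have h2 := key (-d) (Or.inr rfl)
  have h3 : r 0 = 0 := by
    have : d * r 0 = 0 := by linear_combination ε * (h1 - h2) - d * r 0 * hε2
    exact (mul_eq_zero.1 this).resolve_left hd0.ne'
  refine ⟨h3, ?_⟩
  rw [h3] at h1
  linarith

end Recurrence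

section ConjugateTile

open Set Function

variable {E : Type*} [NormedAddCommGroup E] [NormedSpace ℝ E]
  {L : E ≃L[ℝ] E} {φ : E →L[ℝ] ℝ} {v : E} {a B ε : ℤ} {T : Set E}

lemma exists_bound_sub (hTcp : IsCompact T) :
    ∃ C : ℝ, ∀ x ∈ T, ∀ y ∈ T, |φ (x - y)| ≤ C := by
  obtain ⟨C, hC⟩ := (hTcp.image φ.continuous).isBounded.exists_norm_le
  refine ⟨C + C, fun x hx y hy => ?_⟩
  rw [map_sub]
  exact (abs_sub _ _).trans
    (add_le_add (hC _ (mem_image_of_mem _ hx)) (hC _ (mem_image_of_mem _ hy)))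

/-- The differences of the successive images of two points of the tile, read through `φ`,
form a bounded integer sequence satisfying the recurrence up to a digit difference. -/
lemma exists_bounded_sequence (hε : ε = 1 ∨ ε = -1)
    (hL : ∀ x, L (L x) = ((ε * a : ℤ) : ℝ) • L x - (B : ℝ) • x)
    (hφv : φ v = 0) (hφLv : φ (L v) = 1) (hTcp : IsCompact T)
    (hT : ∀ x ∈ T, ∃ i : ℤ, 0 ≤ i ∧ i ≤ B - 1 ∧ L x - (i : ℝ) • v ∈ T)
    {x y : E} (hx : x ∈ T) (hy : y ∈ T) {p q : ℤ}
    (hp : φ (x - y) = p) (hq : φ (L (x - y)) = (ε * q : ℤ)) :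
    ∃ β : ℕ → ℤ, β 0 = p ∧ β 1 = q ∧
      (∀ n, |β (n + 2) - a * β (n + 1) + B * β n| ≤ B - 1) ∧ ∃ K, ∀ n, |β n| ≤ K := by
  have hε2 : ε * ε = 1 := by rcases hε with rfl | rfl <;> norm_num
  have hεabs : |ε| = 1 := by rcases hε with rfl | rfl <;> simp
  choose! d hd0 hd1 hd using hT
  let F : E → E := fun u => L u - (d u : ℝ) • v
  have hF : MapsTo F T T := fun u hu => hd u hu
  let X : ℕ → E := fun n => F^[n] x
  let Y : ℕ → E := fun n => F^[n] y
  have hX : ∀ n, X n ∈ T := fun n => hF.iterate n hx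
  have hY : ∀ n, Y n ∈ T := fun n => hF.iterate n hy
  have hs : ∀ n, X (n + 1) - Y (n + 1)
      = L (X n - Y n) - ((d (X n) - d (Y n) : ℤ) : ℝ) • v := by
    intro n
    simp only [X, Y, iterate_succ_apply', F, map_sub]
    push_cast
    module
  have h1 : ∀ n, φ (X (n + 1) - Y (n + 1)) = φ (L (X n - Y n)) := by
    intro n
    rw [hs, map_sub, map_smul, hφv, smul_zero, sub_zero]
  have h2 : ∀ n, φ (X (n + 2) - Y (n + 2))
      = ((ε * a : ℤ) : ℝ) * φ (X (n + 1) - Y (n + 1)) - B * φ (X n - Y n)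
        - ((d (X n) - d (Y n) : ℤ) : ℝ) := by
    intro n
    rw [h1 (n + 1), h1 n, hs n, map_sub, map_smul, map_sub, map_smul, hφLv, hL, map_sub,
      map_smul, map_smul]
    simp only [smul_eq_mul, mul_one]
  have hint : ∀ n, ∃ b : ℤ, φ (X n - Y n) = b := by
    intro n
    induction n using Nat.twoStepInduction with
    | zero => exact ⟨p, hp⟩
    | one => exact ⟨ε * q, (h1 0).trans hq⟩
    | more n ih0 ih1 =>
      obtain ⟨b0, hb0⟩ := ih0
      obtain ⟨b1, hb1⟩ := ih1
      refine ⟨ε * a * b1 - B * b0 - (d (X n) - d (Y n)), ?_⟩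
      rw [h2, hb0, hb1]
      push_cast
      ring
  choose b hb using hint
  have hrec : ∀ n, b (n + 2) = ε * a * b (n + 1) - B * b n - (d (X n) - d (Y n)) := by
    intro n
    have := h2 n
    rw [hb, hb, hb] at this
    exact_mod_cast this
  have hpow : ∀ n, |ε ^ n| = 1 := fun n => by rw [abs_pow, hεabs, one_pow]
  refine ⟨fun n => ε ^ n * b n, ?_, ?_, fun n => ?_, ?_⟩
  · have : (b 0 : ℝ) = p := (hb 0).symm.trans hp
    simpa using this
  · have h : (b 1 : ℝ) = (ε * q : ℤ) := (hb 1).symm.trans ((h1 0).trans hq)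
    have h' : b 1 = ε * q := by exact_mod_cast h
    simp only [pow_one, h']
    linear_combination q * hε2
  · have e : ε ^ (n + 2) * b (n + 2) - a * (ε ^ (n + 1) * b (n + 1)) + B * (ε ^ n * b n)
        = ε ^ n * (d (Y n) - d (X n)) := by
      rw [hrec n]
      linear_combination ε ^ n * (ε * a * b (n + 1) - B * b n - (d (X n) - d (Y n))) * hε2
    simp only [e]
    rw [abs_mul, hpow, one_mul, abs_le]
    constructor <;> linarith [hd0 _ (hX n), hd1 _ (hX n), hd0 _ (hY n), hd1 _ (hY n)]
  · obtain ⟨C, hC⟩ := exists_bound_sub (φ := φ) hTcp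
    refine ⟨⌈C⌉, fun n => ?_⟩
    rw [abs_mul, hpow, one_mul]
    have := hC _ (hX n) _ (hY n)
    rw [hb n] at this
    exact_mod_cast this.trans (Int.le_ceil C)

lemma eq_of_mem_iterates (hε : ε = 1 ∨ ε = -1) (h5 : B + 5 ≤ 2 * a) (haB : a ≤ B)
    (hL : ∀ x, L (L x) = ((ε * a : ℤ) : ℝ) • L x - (B : ℝ) • x)
    (hsep : ∀ x, φ x = 0 → φ (L x) = 0 → x = 0) (hTcp : IsCompact T)
    {g : E → E} (hg : ∀ x y, L (g x - g y) = x - y)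
    {x y : E} (hx : ∀ n, x ∈ g^[n] '' T) (hy : ∀ n, y ∈ g^[n] '' T) : x = y := by
  obtain ⟨C, hC⟩ := exists_bound_sub (φ := φ) hTcp
  have hgn : ∀ n x y, L^[n] (g^[n] x - g^[n] y) = x - y := by
    intro n
    induction n with
    | zero => simp
    | succ n ih =>
      intro x y
      rw [iterate_succ_apply, iterate_succ_apply', iterate_succ_apply', hg, ih]
  have hbd : ∀ n, |φ (L^[n] (x - y))| ≤ C := by
    intro n
    obtain ⟨s, hs, rfl⟩ := hx n
    obtain ⟨t, ht, hty⟩ := hy n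
    rw [← hty, hgn]
    exact hC s hs t ht
  have h := eq_zero_of_bounded_recurrence (a := a) (B := B) (ε := ε)
    (r := fun n => φ (L^[n] (x - y)))
    (by rcases hε with rfl | rfl <;> simp) (by exact_mod_cast h5) (by exact_mod_cast haB) ?_ hbd
  · exact sub_eq_zero.1 (hsep _ h.1 h.2)
  · intro n
    simp only [iterate_succ_apply', hL, map_sub, map_smul, smul_eq_mul]
    push_cast
    ring

theorem exists_cutPoint_of_functional (hε : ε = 1 ∨ ε = -1) (h5 : B + 5 ≤ 2 * a)
    (haB : a ≤ B) (hL : ∀ x, L (L x) = ((ε * a : ℤ) : ℝ) • L x - (B : ℝ) • x)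
    (hφv : φ v = 0) (hφLv : φ (L v) = 1) (hsep : ∀ x, φ x = 0 → φ (L x) = 0 → x = 0)
    (hTne : T.Nonempty) (hTcp : IsCompact T)
    (hT : ∀ x, x ∈ T ↔ ∃ i : ℤ, 0 ≤ i ∧ i ≤ B - 1 ∧ L x - (i : ℝ) • v ∈ T) :
    ∃ z ∈ T, ¬ IsPreconnected (T \ {z}) := by
  have hε2 : ε * ε = 1 := by rcases hε with rfl | rfl <;> norm_num
  have hstart0 : ∀ x ∈ T, ∀ y ∈ T, ∀ q : ℤ, φ (x - y) = 0 → φ (L (x - y)) = (ε * q : ℤ) →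
      q < 2 := by
    intro x hx y hy q hp hq
    obtain ⟨β, h0, h1, hβ, K, hK⟩ := exists_bounded_sequence (p := 0) hε hL hφv hφLv hTcp
      (fun x => (hT x).1) hx hy (by simpa using hp) hq
    exact h1 ▸ lt_two_of_start_zero h5 haB hβ hK h0
  have hstart1 : ∀ x ∈ T, ∀ y ∈ T, ∀ q : ℤ, φ (x - y) = 1 → φ (L (x - y)) = (ε * q : ℤ) →
      q < 3 := by
    intro x hx y hy q hp hq
    obtain ⟨β, h0, h1, hβ, K, hK⟩ := exists_bounded_sequence (p := 1) hε hL hφv hφLv hTcp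
      (fun x => (hT x).1) hx hy (by simpa using hp) hq
    exact h1 ▸ lt_three_of_start_one h5 haB hβ hK h0
  have hgap : ∀ x : E, ∀ i k : ℤ, L x - (i : ℝ) • v ∈ T → L x - (k : ℝ) • v ∈ T →
      i < k → k = i + 1 := by
    intro x i k hi hk hik
    have e : (L x - (i : ℝ) • v) - (L x - (k : ℝ) • v) = ((k - i : ℤ) : ℝ) • v := by
      push_cast
      module
    have e' : (L x - (k : ℝ) • v) - (L x - (i : ℝ) • v) = ((i - k : ℤ) : ℝ) • v := by
      push_cast
      module
    rcases hε with rfl | rfl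
    · have := hstart0 _ hi _ hk (k - i) (by rw [e, map_smul, hφv, smul_zero])
        (by rw [e, map_smul, map_smul, hφLv]; simp)
      omega
    · have := hstart0 _ hk _ hi (k - i) (by rw [e', map_smul, hφv, smul_zero])
        (by rw [e', map_smul, map_smul, hφLv]; simp)
      omega
  have hadj : ∀ x : E, ∀ i s t : ℤ, L (L x - (i : ℝ) • v) - (s : ℝ) • v ∈ T →
      L (L x - ((i + 1 : ℤ) : ℝ) • v) - (t : ℝ) • v ∈ T → a - 2 ≤ ε * (s - t) := by
    intro x i s t hs ht
    have e : (L (L x - (i : ℝ) • v) - (s : ℝ) • v)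
        - (L (L x - ((i + 1 : ℤ) : ℝ) • v) - (t : ℝ) • v) = L v - ((s - t : ℤ) : ℝ) • v := by
      simp only [map_sub, map_smul]
      push_cast
      module
    have := hstart1 _ hs _ ht (a - ε * (s - t))
      (by rw [e, map_sub, map_smul, hφv, hφLv, smul_zero, sub_zero])
      (by
        have hε2' : (ε : ℝ) * ε = 1 := by exact_mod_cast hε2
        simp only [map_sub, map_smul, hL, hφv, hφLv, smul_eq_mul]
        push_cast
        linear_combination ((s : ℝ) - t) * hε2')
    omega
  set j : ℤ := a - 3 with hj
  let g : E → E := fun u => L.symm (u + (j : ℝ) • v)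
  have hLg : ∀ u, L (g u) - (j : ℝ) • v = u := fun u => by simp [g]
  have hmem : ∀ (S : Set E) (x : E), x ∈ g '' S ↔ L x - (j : ℝ) • v ∈ S := by
    intro S x
    constructor
    · rintro ⟨u, hu, rfl⟩
      rwa [hLg]
    · intro h
      exact ⟨_, h, by simp [g]⟩
  have hg : Continuous g := by fun_prop
  have hginj : Injective g := fun x y h => by rw [← hLg x, h, hLg]
  let F : ℤ → Set E := fun i => {x | L x - (i : ℝ) • v ∈ T}
  have hFcp : ∀ i, IsCompact (F i) := by
    intro i
    have e : F i = (fun u => L.symm (u + (i : ℝ) • v)) '' T := by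
      ext x
      constructor
      · intro h
        exact ⟨_, h, by simp⟩
      · rintro ⟨u, hu, rfl⟩
        simpa [F] using hu
    rw [e]
    exact hTcp.image (by fun_prop)
  have hFne : ∀ i, (F i).Nonempty := by
    intro i
    obtain ⟨t, ht⟩ := hTne
    exact ⟨L.symm (t + (i : ℝ) • v), by simpa [F] using ht⟩
  let lo : Set E := ⋃ i ∈ Ico 0 j, F i
  let hi : Set E := ⋃ i ∈ Ioc j (B - 1), F i
  have hlo : ∀ x, x ∈ lo ↔ ∃ i : ℤ, 0 ≤ i ∧ i < j ∧ x ∈ F i := fun x => by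
    simp [lo, and_assoc]
  have hhi : ∀ x, x ∈ hi ↔ ∃ i : ℤ, j < i ∧ i ≤ B - 1 ∧ x ∈ F i := fun x => by
    simp [hi, and_assoc]
  have hgT : g '' T = F j := by
    ext x
    exact hmem T x
  have hcover : T = lo ∪ hi ∪ g '' T := by
    rw [hgT]
    ext x
    rw [mem_union, mem_union, hlo, hhi, hT]
    constructor
    · rintro ⟨i, h0, h1, h⟩
      rcases lt_trichotomy i j with hij | rfl | hij
      · exact Or.inl (Or.inl ⟨i, h0, hij, h⟩)
      · exact Or.inr h
      · exact Or.inl (Or.inr ⟨i, hij, h1, h⟩)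
    · rintro ((⟨i, h0, h1, h⟩ | ⟨i, h0, h1, h⟩) | h)
      · exact ⟨i, h0, by omega, h⟩
      · exact ⟨i, by omega, h1, h⟩
      · exact ⟨j, by omega, by omega, h⟩
  have hlohi : Disjoint lo hi := by
    refine disjoint_left.2 fun x h1 h2 => ?_
    obtain ⟨i, -, hi1, hi2⟩ := (hlo x).1 h1
    obtain ⟨k, hk1, -, hk2⟩ := (hhi x).1 h2
    have := hgap x i k hi2 hk2 (by omega)
    omega
  have hlog : ∀ x ∈ lo, ∀ t, L x - (j : ℝ) • v ∈ T → L x - (j : ℝ) • v ∈ F t →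
      ∃ s, 0 ≤ s ∧ s ≤ B - 1 ∧ a - 2 ≤ ε * (s - t) := by
    intro x hx t hxT ht
    obtain ⟨i, -, hi1, hi2⟩ := (hlo x).1 hx
    have hij := hgap x i j hi2 hxT hi1
    obtain ⟨s, hs0, hs1, hs⟩ := (hT _).1 hi2
    rw [hij] at ht
    exact ⟨s, hs0, hs1, hadj x i s t hs ht⟩
  have hhig : ∀ x ∈ hi, ∀ s, L x - (j : ℝ) • v ∈ T → L x - (j : ℝ) • v ∈ F s →
      ∃ t, 0 ≤ t ∧ t ≤ B - 1 ∧ a - 2 ≤ ε * (s - t) := by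
    intro x hx s hxT hs
    obtain ⟨i, hi1, -, hi2⟩ := (hhi x).1 hx
    have hij := hgap x j i hxT hi2 hi1
    obtain ⟨t, ht0, ht1, ht⟩ := (hT _).1 hi2
    rw [hij] at ht
    exact ⟨t, ht0, ht1, hadj x j s t hs ht⟩
  have hloT : lo ⊆ T := fun x hx => by rw [hcover]; exact Or.inl (Or.inl hx)
  have hhiT : hi ⊆ T := fun x hx => by rw [hcover]; exact Or.inl (Or.inr hx)
  have hFjT : F j ⊆ T := fun x hx => by rw [hcover, hgT]; exact Or.inr hx
  have hloT2 : Disjoint lo (g '' (g '' T)) := by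
    refine disjoint_left.2 fun x h1 h2 => ?_
    rw [hgT, hmem] at h2
    obtain ⟨s, hs0, hs1, hs⟩ := hlog x h1 j (hFjT h2) h2
    rcases hε with rfl | rfl <;> omega
  have hhiT2 : Disjoint hi (g '' (g '' T)) := by
    refine disjoint_left.2 fun x h1 h2 => ?_
    rw [hgT, hmem] at h2
    obtain ⟨s, hs0, hs1, hs⟩ := hhig x h1 j (hFjT h2) h2
    rcases hε with rfl | rfl <;> omega
  have hlocp : IsCompact lo := (finite_Ico 0 j).isCompact_biUnion fun i _ => hFcp i
  have hhicp : IsCompact hi := (finite_Ioc j (B - 1)).isCompact_biUnion fun i _ => hFcp i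
  have hlone : lo.Nonempty := (hFne 0).mono fun x hx => (hlo x).2 ⟨0, le_rfl, by omega, hx⟩
  have hhine : hi.Nonempty :=
    (hFne (B - 1)).mono fun x hx => (hhi x).2 ⟨B - 1, by omega, le_rfl, hx⟩
  have hsub : ∀ x y, (∀ n, x ∈ g^[n] '' T) → (∀ n, y ∈ g^[n] '' T) → x = y :=
    fun x y hx hy => eq_of_mem_iterates hε h5 haB hL hsep hTcp
      (fun x y => by simp [g]) hx hy
  rcases hε with rfl | rfl
  · refine exists_not_isPreconnected_sdiff_singleton hTne hTcp hlocp hhicp hlone hhine hg hginj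
      hcover hlohi ?_ ?_ hloT2 hhiT2 hsub
    · refine disjoint_left.2 fun x h1 h2 => ?_
      rw [hmem] at h2
      obtain ⟨t, ht1, ht2, ht⟩ := (hhi _).1 h2
      obtain ⟨s, hs0, hs1, hs⟩ := hlog x h1 t (hhiT h2) ht
      omega
    · refine disjoint_left.2 fun x h1 h2 => ?_
      rw [hmem] at h2
      obtain ⟨t, ht1, ht2, ht⟩ := (hlo _).1 h2
      obtain ⟨s, hs0, hs1, hs⟩ := hhig x h1 t (hloT h2) ht
      omega
  · refine exists_not_isPreconnected_sdiff_singleton_of_alternating hTne hTcp hlocp hhicp hlone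
      hhine hg hginj hcover hlohi ?_ ?_ hloT2 hhiT2 hsub
    · refine disjoint_left.2 fun x h1 h2 => ?_
      rw [hmem] at h2
      obtain ⟨t, ht1, ht2, ht⟩ := (hlo _).1 h2
      obtain ⟨s, hs0, hs1, hs⟩ := hlog x h1 t (hloT h2) ht
      omega
    · refine disjoint_left.2 fun x h1 h2 => ?_
      rw [hmem] at h2
      obtain ⟨t, ht1, ht2, ht⟩ := (hhi _).1 h2
      obtain ⟨s, hs0, hs1, hs⟩ := hhig x h1 t (hhiT h2) ht
      omega

end ConjugateTile

lemma map_intCast_mulVec_mulVec {A B : ℤ} {M : Matrix (Fin 2) (Fin 2) ℤ}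
    (hchar : M.charpoly = X ^ 2 + C A * X + C B) (x : Fin 2 → ℝ) :
    (M.map (Int.cast : ℤ → ℝ)).mulVec ((M.map (Int.cast : ℤ → ℝ)).mulVec x)
      = ((-A : ℤ) : ℝ) • (M.map (Int.cast : ℤ → ℝ)).mulVec x - (B : ℝ) • x := by
  have hR : (M.map (Int.cast : ℤ → ℝ)).charpoly = X ^ 2 + C (A : ℝ) * X + C (B : ℝ) := by
    have h := M.charpoly_map (Int.castRingHom ℝ)
    rw [hchar] at h
    simpa using h
  have h := (M.map (Int.cast : ℤ → ℝ)).aeval_self_charpoly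
  rw [hR] at h
  simp only [map_add, map_mul, map_pow, aeval_X, aeval_C, Algebra.algebraMap_eq_smul_one,
    smul_mul_assoc, one_mul] at h
  have h' := congrArg (fun N => N.mulVec x) h
  simp only [Matrix.add_mulVec, Matrix.smul_mulVec, Matrix.one_mulVec, Matrix.zero_mulVec, pow_two,
    ← Matrix.mulVec_mulVec] at h'
  push_cast
  rw [neg_smul]
  linear_combination h'

/-- If `2|A| - B ≥ 5`, the self-affine tile `T` with collinear
digit set has a cut point. -/
theorem tile_has_cutPoint_of_five_le
    (A B : ℤ) (hAB : |A| ≤ B) (hB : 2 ≤ B)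
    (M : Matrix (Fin 2) (Fin 2) ℤ)
    (hchar : M.charpoly = X ^ 2 + C A * X + C B)
    (v : Fin 2 → ℤ)
    (hindep : LinearIndependent ℝ
      ![(fun i => (v i : ℝ)), (M.map (Int.cast : ℤ → ℝ)).mulVec fun i => (v i : ℝ)])
    (T : Set (Fin 2 → ℝ)) (hTne : T.Nonempty) (hTcp : IsCompact T)
    (hT : (M.map (Int.cast : ℤ → ℝ)).mulVec '' T =
      ⋃ j ∈ Set.Icc (0 : ℤ) (B - 1),
        (fun x => x + (j : ℝ) • fun i => (v i : ℝ)) '' T)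
    (h5 : 5 ≤ 2 * |A| - B) :
    ∃ z ∈ T, ¬ IsPreconnected (T \ {z}) := by
  have hCH := map_intCast_mulVec_mulVec hchar
  set N := M.map (Int.cast : ℤ → ℝ)
  set w : Fin 2 → ℝ := fun i => (v i : ℝ)
  have hB0 : (B : ℝ) ≠ 0 := by
    have : B ≠ 0 := by omega
    exact_mod_cast this
  have hker : ∀ x, N.mulVec x = 0 → x = 0 := by
    intro x hx
    have h := hCH x
    rw [hx, Matrix.mulVec_zero, smul_zero, zero_sub, eq_comm, neg_eq_zero] at h
    exact (smul_eq_zero.1 h).resolve_left hB0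
  have hinj : Function.Injective N.mulVecLin := by
    rw [injective_iff_map_eq_zero]
    exact hker
  let L : (Fin 2 → ℝ) ≃L[ℝ] (Fin 2 → ℝ) :=
    (LinearEquiv.ofInjectiveEndo N.mulVecLin hinj).toContinuousLinearEquiv
  have hL : ∀ x, L x = N.mulVec x := fun x => rfl
  let b := basisOfLinearIndependentOfCardEqFinrank hindep (by simp)
  have hb0 : b 0 = w := by simp [b]
  have hb1 : b 1 = N.mulVec w := by simp [b]
  let φ : (Fin 2 → ℝ) →L[ℝ] ℝ := LinearMap.toContinuousLinearMap (b.coord 1)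
  have hφ : ∀ x, φ x = b.repr x 1 := fun x => rfl
  have hφv : φ w = 0 := by rw [hφ, ← hb0]; simp
  have hφLv : φ (L w) = 1 := by rw [hφ, hL, ← hb1]; simp
  have hsep : ∀ x, φ x = 0 → φ (L x) = 0 → x = 0 := by
    intro x h0 h1
    have hx : x = b.repr x 0 • w := by
      conv_lhs => rw [← b.sum_repr x, Fin.sum_univ_two, ← hφ x, h0, zero_smul, add_zero, hb0]
    rw [hx, map_smul, map_smul, hφLv, smul_eq_mul, mul_one] at h1
    rw [hx, h1, zero_smul]
  have hT' : ∀ x, x ∈ T ↔ ∃ i : ℤ, 0 ≤ i ∧ i ≤ B - 1 ∧ L x - (i : ℝ) • w ∈ T := by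
    intro x
    have h1 : x ∈ T ↔ N.mulVec x ∈ N.mulVec '' T := (hinj.mem_set_image (s := T)).symm
    rw [h1, hT]
    simp only [Set.mem_iUnion, Set.mem_Icc, exists_prop, Set.mem_image, and_assoc, hL]
    refine exists_congr fun i => and_congr_right fun _ => and_congr_right fun _ => ?_
    constructor
    · rintro ⟨y, hy, h⟩
      rwa [← h, add_sub_cancel_right]
    · intro h
      exact ⟨_, h, sub_add_cancel _ _⟩
  obtain ⟨ε, hε, hεA⟩ : ∃ ε : ℤ, (ε = 1 ∨ ε = -1) ∧ -A = ε * |A| := by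
    rcases abs_choice A with h | h
    · exact ⟨-1, Or.inr rfl, by rw [h]; ring⟩
    · exact ⟨1, Or.inl rfl, by rw [h]; ring⟩
  exact exists_cutPoint_of_functional (L := L) (φ := φ) (v := w) hε (by linarith) hAB
    (fun x => by simpa only [hL, ← hεA] using hCH x) hφv hφLv hsep hTne hTcp hT'
end
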